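/- Let p ≥ 1, let σ₁ ≥ σ₂ ≥ … ≥ σ_{2p} be real numbers, and let C = A + B be the sum of two real symmetric 2p×2p matrices A and B each having ordered spectrum (σ₁, …, σ_{2p}). Let γ̂₁ ≥ γ̂₂ ≥ … ≥ γ̂_{2p} be the ordered spectrum of C and set ν_k = (γ̂_{2k−1} + γ̂_{2k})/2 for k = 1, …, p. Then for every r < p and every triple (I, J, K) ∈ T^p_r, the Horn inequality ∑_{k∈K} ν_k ≤ ∑_{i∈I} σ_{2i−1} + ∑_{j∈J} σ_{2j} holds. -/

import Mathlib

open Matrix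

/-- The `f`-th smallest element (1-indexed) of a finite set of natural numbers. -/
def nthElt (I : Finset ℕ) (f : ℕ) : ℕ :=
  (I.sort (· ≤ ·)).getD (f - 1) 0

/-- `(I, J, K) ∈ U^n_r`: `I`, `J`, `K` are `r`-element subsets of `{1, …, n}` with
`∑_{i∈I} i + ∑_{j∈J} j = ∑_{k∈K} k + r(r+1)/2`. -/
def IsU (n r : ℕ) (I J K : Finset ℕ) : Prop :=
  I ⊆ Finset.Icc 1 n ∧ J ⊆ Finset.Icc 1 n ∧ K ⊆ Finset.Icc 1 n ∧
  I.card = r ∧ J.card = r ∧ K.card = r ∧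
  ∑ i ∈ I, i + ∑ j ∈ J, j = ∑ k ∈ K, k + r * (r + 1) / 2

/-- `(I, J, K) ∈ T^n_r`, defined recursively: `T^n_1 = U^n_1` and, for `r > 1`,
`(I, J, K) ∈ T^n_r` iff `(I, J, K) ∈ U^n_r` and for all `1 ≤ s < r` and all
`(F, G, H) ∈ T^r_s` one has
`∑_{f∈F} i_f + ∑_{g∈G} j_g ≤ ∑_{h∈H} k_h + s(s+1)/2`,
where `i_f` denotes the `f`-th smallest element of `I`, etc. -/
def IsT (n r : ℕ) (I J K : Finset ℕ) : Prop :=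
  IsU n r I J K ∧
  ∀ s, 1 ≤ s → s < r → ∀ F G H : Finset ℕ, IsT r s F G H →
    ∑ f ∈ F, nthElt I f + ∑ g ∈ G, nthElt J g ≤ ∑ h ∈ H, nthElt K h + s * (s + 1) / 2
termination_by r

namespace Horn

open Module

open scoped Cardinal in
/-- Finite algebraically independent families of complex numbers extend to transcendence bases
indexed by a set of the cardinality of the continuum. -/
theorem exists_sum_isTranscendenceBasis {ι : Type} [Finite ι] {x : ι → ℂ}
    (hx : AlgebraicIndependent ℚ x) :
    ∃ (s : Set ℂ), IsTranscendenceBasis ℚ (Sum.elim x ((↑) : s → ℂ)) ∧ Cardinal.mk s = 𝔠 := by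
  obtain ⟨t, hxt, ht⟩ := exists_isTranscendenceBasis_superset
    (show AlgebraicIndepOn ℚ id (Set.range x) from hx.coe_range)
  have hcard : Cardinal.mk t = 𝔠 := by
    rw [← IsAlgClosed.cardinal_eq_cardinal_transcendence_basis_of_aleph0_lt' _ ht (by simp)
      (by simp [Cardinal.aleph0_lt_continuum]), Cardinal.mk_complex]
  classical
  refine ⟨(t \ Set.range x : Set ℂ), ?_, ?_⟩
  · let e : ι ⊕ (t \ Set.range x : Set ℂ) ≃ t :=
      ((Equiv.ofInjective x hx.injective).sumCongr (Equiv.refl _)).trans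
        (Equiv.Set.sumDiffSubset hxt)
    have he : (Sum.elim x ((↑) : (t \ Set.range x : Set ℂ) → ℂ)) = ((↑) : t → ℂ) ∘ e := by
      funext i
      rcases i with i | i <;> simp [e]
    rw [he]
    exact ht.comp_equiv e
  · have h1 : Cardinal.mk (t \ Set.range x : Set ℂ) + Cardinal.mk (Set.range x) =
        Cardinal.mk t := Cardinal.mk_sdiff_add_mk hxt
    rw [hcard] at h1
    have h2 : Cardinal.mk (Set.range x) < ℵ₀ := Cardinal.lt_aleph0_of_finite _
    exact Cardinal.eq_of_add_eq_of_aleph0_le (by rwa [add_comm] at h1)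
      (h2.trans Cardinal.aleph0_lt_continuum) Cardinal.aleph0_le_continuum

/-- Field automorphisms of `ℂ` act transitively on algebraically independent families. -/
theorem exists_ringEquiv_of_algebraicIndependent {ι : Type} [Finite ι] {x y : ι → ℂ}
    (hx : AlgebraicIndependent ℚ x) (hy : AlgebraicIndependent ℚ y) :
    ∃ τ : ℂ ≃+* ℂ, ∀ i, τ (x i) = y i := by
  obtain ⟨s, hs, hsc⟩ := exists_sum_isTranscendenceBasis hx
  obtain ⟨t, ht, htc⟩ := exists_sum_isTranscendenceBasis hy
  obtain ⟨e⟩ := Cardinal.eq.1 (hsc.trans htc.symm)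
  let := IsAlgClosed.isAlgClosure_of_transcendence_basis _ hs
  let := IsAlgClosed.isAlgClosure_of_transcendence_basis _ ht
  let f : MvPolynomial (ι ⊕ s) ℚ ≃ₐ[ℚ] MvPolynomial (ι ⊕ t) ℚ :=
    MvPolynomial.renameEquiv ℚ ((Equiv.refl ι).sumCongr e)
  let g := (hs.1.aevalEquiv.symm.trans f).trans ht.1.aevalEquiv
  refine ⟨IsAlgClosure.equivOfEquiv ℂ ℂ g.toRingEquiv, fun i => ?_⟩
  have h1 : x i = algebraMap _ ℂ (hs.1.aevalEquiv (MvPolynomial.X (Sum.inl i))) := by simp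
  rw [h1, IsAlgClosure.equivOfEquiv_algebraMap]
  simp [g, f]

open scoped IntermediateField.algebraAdjoinAdjoin in
theorem formallySmooth_adjoin {ι : Type} {z : ι → ℂ} (hz : IsTranscendenceBasis ℚ z) :
    Algebra.FormallySmooth (Algebra.adjoin ℚ (Set.range z)) ℂ := by
  have h1 : Algebra.FormallySmooth (Algebra.adjoin ℚ (Set.range z))
      (IntermediateField.adjoin ℚ (Set.range z)) :=
    .of_isLocalization (nonZeroDivisors _)
  have h2 : Algebra.IsAlgebraic (IntermediateField.adjoin ℚ (Set.range z)) ℂ :=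
    hz.isAlgebraic_field
  have h3 : Algebra.FormallyEtale (IntermediateField.adjoin ℚ (Set.range z)) ℂ :=
    Algebra.FormallyEtale.of_isSeparable _ ℂ
  exact .comp _ (IntermediateField.adjoin ℚ (Set.range z)) _

/-- A derivation of `ℂ` may be prescribed arbitrarily on an algebraically independent family. -/
theorem exists_derivation {ι : Type} [Finite ι] {x : ι → ℂ}
    (hx : AlgebraicIndependent ℚ x) (v : ι → ℂ) :
    ∃ δ : Derivation ℤ ℂ ℂ, ∀ i, δ (x i) = v i := by
  obtain ⟨s, hs, -⟩ := exists_sum_isTranscendenceBasis hx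
  set z : ι ⊕ s → ℂ := Sum.elim x (↑) with hz
  let A := Algebra.adjoin ℚ (Set.range z)
  let E := TrivSqZeroExt ℂ ℂ
  let ψ : A →ₐ[ℚ] E := (MvPolynomial.aeval fun i =>
    (TrivSqZeroExt.inl (z i) + TrivSqZeroExt.inr (Sum.elim v 0 i) : E)).comp
      hs.1.aevalEquiv.symm.toAlgHom
  have hψz : ∀ i, ψ (hs.1.aevalEquiv (MvPolynomial.X i)) =
      TrivSqZeroExt.inl (z i) + TrivSqZeroExt.inr (Sum.elim v 0 i) := by
    intro i
    simp [ψ]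
  have hfst : ∀ a : A, (ψ a).fst = (a : ℂ) := by
    have : ((TrivSqZeroExt.fstHom ℚ ℂ ℂ).comp ψ).comp hs.1.aevalEquiv.toAlgHom =
        A.val.comp hs.1.aevalEquiv.toAlgHom := by
      ext i
      change (ψ (hs.1.aevalEquiv (MvPolynomial.X i))).fst =
        ((hs.1.aevalEquiv (MvPolynomial.X i) : A) : ℂ)
      rw [hψz, TrivSqZeroExt.fst_add, TrivSqZeroExt.fst_inl, TrivSqZeroExt.fst_inr]
      simp
    intro a
    obtain ⟨b, rfl⟩ := hs.1.aevalEquiv.surjective a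
    exact DFunLike.congr_fun this b
  let : Algebra A E := ψ.toRingHom.toAlgebra
  have hsm : Algebra.FormallySmooth A ℂ := formallySmooth_adjoin hs
  let fst' : E →ₐ[A] ℂ := { TrivSqZeroExt.fstHom ℚ ℂ ℂ with
    commutes' := fun a => hfst a }
  have hker : IsNilpotent (RingHom.ker (fst' : E →+* ℂ)) := by
    refine ⟨2, ?_⟩
    exact TrivSqZeroExt.kerIdeal_sq ℂ ℂ
  let θ := Algebra.FormallySmooth.liftOfSurjective (AlgHom.id A ℂ) fst'
    TrivSqZeroExt.fst_surjective hker
  have hθ : ∀ c, (θ c).fst = c := fun c =>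
    Algebra.FormallySmooth.liftOfSurjective_apply (AlgHom.id A ℂ) fst'
      TrivSqZeroExt.fst_surjective hker c
  let D : ℂ →+ ℂ := 
    { toFun := fun c => (θ c).snd
      map_zero' := by simp
      map_add' := fun a b => by rw [map_add]; exact TrivSqZeroExt.snd_add _ _ }
  refine ⟨Derivation.mk' D.toIntLinearMap fun a b => ?_, fun i => ?_⟩
  · change (θ (a * b)).snd = a • (θ b).snd + b • (θ a).snd
    rw [map_mul]
    refine (TrivSqZeroExt.snd_mul _ _).trans ?_
    rw [hθ, hθ]
    simpa using mul_comm _ _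
  · change (θ (x i)).snd = v i
    have h1 : x i = algebraMap A ℂ (hs.1.aevalEquiv (MvPolynomial.X (Sum.inl i))) := by
      change _ = ((hs.1.aevalEquiv (MvPolynomial.X (Sum.inl i)) : A) : ℂ)
      simp [z]
    rw [h1, θ.commutes]
    change (ψ (hs.1.aevalEquiv (MvPolynomial.X (Sum.inl i)))).snd = v i
    rw [hψz, TrivSqZeroExt.snd_add, TrivSqZeroExt.snd_inl, TrivSqZeroExt.snd_inr]
    simp

/-- Algebraically independent families are dense. -/
theorem dense_algebraicIndependent (ι : Type) [Fintype ι] :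
    Dense {x : ι → ℂ | AlgebraicIndependent ℚ x} := by
  have h : {x : ι → ℂ | AlgebraicIndependent ℚ x} =
      ⋂ p : {p : MvPolynomial ι ℚ // p ≠ 0}, {x | MvPolynomial.aeval x p.1 ≠ 0} := by
    ext x
    simp only [Set.mem_ofPred_eq, Set.mem_iInter, Subtype.forall]
    rw [algebraicIndependent_iff]
    exact forall_congr' fun p => ⟨fun h h' h'' => h' (h h''), fun h h' => by_contra fun h'' => h h'' h'⟩
  rw [h]
  have : Countable {p : MvPolynomial ι ℚ // p ≠ 0} := by
    have : Countable (MvPolynomial ι ℚ) := by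
      rw [← Cardinal.mk_le_aleph0_iff]
      refine MvPolynomial.cardinalMk_le_max.trans ?_
      simp
    infer_instance
  refine dense_iInter_of_isOpen ?_ ?_
  · intro p
    refine isOpen_ne_fun ?_ continuous_const
    have : (fun x : ι → ℂ => MvPolynomial.aeval x p.1) =
        fun x => MvPolynomial.eval x (MvPolynomial.map (algebraMap ℚ ℂ) p.1) := by
      funext x
      simp [MvPolynomial.aeval_def, MvPolynomial.eval_map]
    rw [this]
    exact MvPolynomial.continuous_eval _
  · rintro ⟨p, hp⟩
    rw [Metric.dense_iff]
    intro x ε hε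
    by_contra hcon
    rw [Set.not_nonempty_iff_eq_empty, Set.eq_empty_iff_forall_notMem] at hcon
    refine hp ?_
    have h0 : MvPolynomial.map (algebraMap ℚ ℂ) p = 0 := by
      refine MvPolynomial.funext_set (fun i => Metric.ball (x i) ε)
        (fun i => infinite_of_mem_nhds (x i) (Metric.ball_mem_nhds _ hε)) fun y hy => ?_
      have hy' : y ∈ Metric.ball x ε := by
        rw [ball_pi _ hε]
        exact hy
      have := hcon y
      simp only [Set.mem_inter_iff, hy', true_and, Set.mem_ofPred_eq, not_not] at this
      rw [map_zero, ← this]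
      simp [MvPolynomial.aeval_def, MvPolynomial.eval_map]
    exact MvPolynomial.map_injective _ (algebraMap ℚ ℂ).injective (by simpa using h0)

section LinearAlgebra

variable {E V Q : Type} [AddCommGroup E] [Module ℂ E] [AddCommGroup V] [Module ℂ V]
  [AddCommGroup Q] [Module ℂ Q]

/-- Three subspaces are in general position when every triple of elements can be matched
simultaneously modulo the three subspaces. -/
def Transverse (X : Fin 3 → Submodule ℂ E) : Prop :=
  ∀ x : Fin 3 → E, ∃ y, ∀ m, y - x m ∈ X m

theorem finrank_iInf_aux [FiniteDimensional ℂ E] (X : Fin 3 → Submodule ℂ E) :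
    ∃ c : ℕ, (finrank ℂ ↥(⨅ m, X m) : ℤ) = ∑ m, (finrank ℂ (X m) : ℤ) - 2 * finrank ℂ E + c ∧
      (c = 0 ↔ Transverse X) := by
  let L : E →ₗ[ℂ] (∀ m, E ⧸ X m) := LinearMap.pi fun m => (X m).mkQ
  have hker : LinearMap.ker L = ⨅ m, X m := by
    ext x
    simp [L, funext_iff, Submodule.mem_iInf]
  have h1 := LinearMap.finrank_range_add_finrank_ker L
  rw [hker] at h1
  have h2 : finrank ℂ (∀ m, E ⧸ X m) = ∑ m, finrank ℂ (E ⧸ X m) := finrank_pi_fintype ℂ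
  have h3 : ∀ m, finrank ℂ (E ⧸ X m) + finrank ℂ (X m) = finrank ℂ E := fun m =>
    Submodule.finrank_quotient_add_finrank _
  have h4 : finrank ℂ (LinearMap.range L) ≤ finrank ℂ (∀ m, E ⧸ X m) := Submodule.finrank_le _
  have h5 : ∑ m, (finrank ℂ (E ⧸ X m) : ℤ) = 3 * finrank ℂ E - ∑ m, (finrank ℂ (X m) : ℤ) := by
    rw [eq_sub_iff_add_eq, ← Finset.sum_add_distrib]
    simp_rw [← Nat.cast_add, h3]
    simp
  refine ⟨finrank ℂ (∀ m, E ⧸ X m) - finrank ℂ (LinearMap.range L), ?_, ?_⟩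
  · push_cast [h4]
    rw [h2]
    push_cast
    rw [h5]
    omega
  · have h6 : finrank ℂ (∀ m, E ⧸ X m) - finrank ℂ (LinearMap.range L) = 0 ↔
        LinearMap.range L = ⊤ := by
      rw [Nat.sub_eq_zero_iff_le]
      exact ⟨fun h => Submodule.eq_top_of_finrank_eq (le_antisymm h4 h), fun h => by
        rw [h, finrank_top]⟩
    rw [h6, LinearMap.range_eq_top]
    constructor
    · intro h x
      obtain ⟨y, hy⟩ := h fun m => (X m).mkQ (x m)
      refine ⟨y, fun m => ?_⟩
      rw [← Submodule.Quotient.eq]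
      exact congrFun hy m
    · intro h z
      choose x hx using fun m => (X m).mkQ_surjective (z m)
      obtain ⟨y, hy⟩ := h x
      refine ⟨y, funext fun m => ?_⟩
      rw [← hx m]
      exact (Submodule.Quotient.eq _).2 (hy m)

theorem le_finrank_iInf [FiniteDimensional ℂ E] (X : Fin 3 → Submodule ℂ E) :
    ∑ m, (finrank ℂ (X m) : ℤ) - 2 * finrank ℂ E ≤ finrank ℂ ↥(⨅ m, X m) := by
  obtain ⟨c, h, -⟩ := finrank_iInf_aux X
  omega

theorem transverse_iff [FiniteDimensional ℂ E] (X : Fin 3 → Submodule ℂ E) :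
    Transverse X ↔
      (finrank ℂ ↥(⨅ m, X m) : ℤ) ≤ ∑ m, (finrank ℂ (X m) : ℤ) - 2 * finrank ℂ E := by
  obtain ⟨c, h, h'⟩ := finrank_iInf_aux X
  rw [← h']
  omega

/-- Modify a linear map on `B` without changing it on `A`. -/
theorem exists_eqOn_and_mapsTo (A B : Submodule ℂ V) (G : Submodule ℂ Q) (φ : V →ₗ[ℂ] Q)
    (h : ∀ x ∈ A, x ∈ B → φ x ∈ G) :
    ∃ φ' : V →ₗ[ℂ] Q, (∀ x ∈ A, φ' x = φ x) ∧ ∀ x ∈ B, φ' x ∈ G := by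
  obtain ⟨C, hC⟩ := exists_isCompl ((A ⊓ B).submoduleOf B)
  let C' := C.map B.subtype
  have hCB : C' ≤ B := Submodule.map_subtype_le _ _
  have hdisj : Disjoint A C' := by
    rw [Submodule.disjoint_def]
    rintro x hxA ⟨c, hc, rfl⟩
    have := Submodule.disjoint_def.1 hC.disjoint c ⟨hxA, c.2⟩ hc
    simp [this]
  obtain ⟨D, hCD, hD⟩ := hdisj.symm.exists_isCompl
  let φ' := LinearMap.ofIsCompl hD 0 (φ.domRestrict A)
  have h1 : ∀ x ∈ A, φ' x = φ x := fun x hx =>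
    LinearMap.ofIsCompl_apply_right hD (⟨x, hx⟩ : A)
  have h2 : ∀ x ∈ C', φ' x = 0 := fun x hx =>
    LinearMap.ofIsCompl_apply_left hD (⟨x, hCD hx⟩ : D)
  refine ⟨φ', h1, fun x hx => ?_⟩
  obtain ⟨a, ha, c, hc, hac⟩ := Submodule.mem_sup.1
    (show (⟨x, hx⟩ : B) ∈ (A ⊓ B).submoduleOf B ⊔ C from hC.sup_eq_top ▸ trivial)
  have hx' : x = (a : V) + c := congrArg Subtype.val hac.symm
  rw [hx', map_add, h2 c ⟨c, hc, rfl⟩, add_zero, h1 a ha.1]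
  exact h a ha.1 a.2

end LinearAlgebra

/-- A finite filtration of a vector space, indexed by times `0, …, T`. -/
structure Filt (T : ℕ) (V : Type) [AddCommGroup V] [Module ℂ V] where
  F : ℕ → Submodule ℂ V
  mono : Monotone F
  zero : F 0 = ⊥
  top : F T = ⊤

/-- Euler pairing of two dimension functions. -/
def eul (T : ℕ) (N M : ℕ → ℕ) : ℤ :=
  ∑ t ∈ Finset.range T, ((N (t + 1) : ℤ) - N t) * M (t + 1)

namespace Filt

variable {T : ℕ} {V Q R : Type} [AddCommGroup V] [Module ℂ V] [AddCommGroup Q] [Module ℂ Q]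
  [AddCommGroup R] [Module ℂ R]

/-- Dimension function of a filtration. -/
noncomputable def dim (f : Filt T V) (t : ℕ) : ℕ := finrank ℂ (f.F t)

/-- Filtered linear maps. -/
def Hom (f : Filt T V) (g : Filt T Q) : Submodule ℂ (V →ₗ[ℂ] Q) where
  carrier := {φ | ∀ t, ∀ x ∈ f.F t, φ x ∈ g.F t}
  add_mem' hφ hψ t x hx := add_mem (hφ t x hx) (hψ t x hx)
  zero_mem' _ _ _ := zero_mem _
  smul_mem' c _ hφ t x hx := Submodule.smul_mem _ c (hφ t x hx)

theorem mem_Hom {f : Filt T V} {g : Filt T Q} {φ : V →ₗ[ℂ] Q} :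
    φ ∈ f.Hom g ↔ ∀ t, ∀ x ∈ f.F t, φ x ∈ g.F t := Iff.rfl

theorem F_eq_top (f : Filt T V) {t : ℕ} (ht : T ≤ t) : f.F t = ⊤ :=
  top_le_iff.1 (f.top ▸ f.mono ht)

theorem dim_zero (f : Filt T V) : f.dim 0 = 0 := by
  rw [dim, f.zero, finrank_bot]

theorem dim_top (f : Filt T V) : f.dim T = finrank ℂ V := by
  rw [dim, f.top, finrank_top]

theorem dim_mono [FiniteDimensional ℂ V] (f : Filt T V) : Monotone f.dim := fun _ _ h =>
  Submodule.finrank_mono (f.mono h)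

/-- Induced filtration on a subspace. -/
def sub (f : Filt T V) (S : Submodule ℂ V) : Filt T S where
  F t := (f.F t).comap S.subtype
  mono _ _ h := Submodule.comap_mono (f.mono h)
  zero := by rw [f.zero, Submodule.comap_bot, Submodule.ker_subtype]
  top := by rw [f.top, Submodule.comap_top]

/-- Image filtration under a surjective linear map. -/
def map (f : Filt T V) (π : V →ₗ[ℂ] R) (hπ : Function.Surjective π) : Filt T R where
  F t := (f.F t).map π
  mono _ _ h := Submodule.map_mono (f.mono h)
  zero := by rw [f.zero, Submodule.map_bot]
  top := by rw [f.top, Submodule.map_top, LinearMap.range_eq_top.2 hπ]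

theorem dim_sub (f : Filt T V) (S : Submodule ℂ V) (t : ℕ) :
    (f.sub S).dim t = finrank ℂ ↥(S ⊓ f.F t) := by
  rw [← Submodule.map_comap_subtype, dim, sub]
  exact (Submodule.equivMapOfInjective S.subtype S.injective_subtype _).finrank_eq

theorem dim_eq_add [FiniteDimensional ℂ V] (f : Filt T V) (π : V →ₗ[ℂ] R)
    (hπ : Function.Surjective π) (t : ℕ) :
    f.dim t = (f.sub (LinearMap.ker π)).dim t + (f.map π hπ).dim t := by
  have h := LinearMap.finrank_range_add_finrank_ker (π.domRestrict (f.F t))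
  rw [LinearMap.range_domRestrict] at h
  rw [dim_sub, dim, ← h, add_comm]
  congr 1
  have : LinearMap.ker (π.domRestrict (f.F t)) = (LinearMap.ker π).comap (f.F t).subtype := rfl
  rw [this, inf_comm, ← Submodule.map_comap_subtype]
  exact (Submodule.equivMapOfInjective (f.F t).subtype (f.F t).injective_subtype _).finrank_eq

/-- Filtered maps on a subspace extend to filtered maps on the whole space. -/
theorem exists_extend (f : Filt T V) (g : Filt T Q) (S : Submodule ℂ V) (ψ : S →ₗ[ℂ] Q)
    (hψ : ψ ∈ (f.sub S).Hom g) : ∃ φ ∈ f.Hom g, ∀ x : S, φ x = ψ x := by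
  have key : ∀ n, ∃ φ : V →ₗ[ℂ] Q, (∀ x : S, φ x = ψ x) ∧ ∀ t ≤ n, ∀ x ∈ f.F t, φ x ∈ g.F t := by
    intro n
    induction n with
    | zero =>
      obtain ⟨φ, hφ⟩ := LinearMap.exists_extend ψ
      refine ⟨φ, fun x => LinearMap.congr_fun hφ x, fun t ht x hx => ?_⟩
      obtain rfl : t = 0 := by omega
      rw [f.zero, Submodule.mem_bot] at hx
      simp [hx]
    | succ n ih =>
      obtain ⟨φ, hφS, hφ⟩ := ih
      obtain ⟨φ', h1, h2⟩ := exists_eqOn_and_mapsTo (S ⊔ f.F n) (f.F (n + 1)) (g.F (n + 1)) φ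
        (by
          intro x hx hx'
          obtain ⟨s, hs, y, hy, rfl⟩ := Submodule.mem_sup.1 hx
          have hs' : s ∈ f.F (n + 1) := by
            simpa using sub_mem hx' (f.mono n.le_succ hy)
          rw [map_add]
          exact add_mem (by rw [hφS ⟨s, hs⟩]; exact hψ (n + 1) ⟨s, hs⟩ hs')
            (g.mono n.le_succ (hφ n le_rfl y hy)))
      refine ⟨φ', fun x => ?_, fun t ht x hx => ?_⟩
      · rw [h1 x (Submodule.mem_sup_left x.2), hφS]
      · rcases Nat.lt_or_ge n t with h | h
        · obtain rfl : t = n + 1 := by omega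
          exact h2 x hx
        · rw [h1 x (Submodule.mem_sup_right (f.mono h hx))]
          exact hφ t h x hx
  obtain ⟨φ, h1, h2⟩ := key T
  refine ⟨φ, fun t x hx => ?_, h1⟩
  rcases le_total t T with h | h
  · exact h2 t h x hx
  · rw [g.F_eq_top h]
    trivial

theorem finrank_Hom [FiniteDimensional ℂ V] [FiniteDimensional ℂ Q] (f : Filt T V)
    (g : Filt T Q) : (finrank ℂ (f.Hom g) : ℤ) = eul T f.dim g.dim := by
  let H : ℕ → Submodule ℂ (V →ₗ[ℂ] Q) := fun n =>
    { carrier := {φ | ∀ t ≤ n, ∀ x ∈ f.F t, φ x ∈ g.F t}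
      add_mem' := fun hφ hψ t ht x hx => add_mem (hφ t ht x hx) (hψ t ht x hx)
      zero_mem' := fun t _ x _ => zero_mem _
      smul_mem' := fun c φ hφ t ht x hx => Submodule.smul_mem _ c (hφ t ht x hx) }
  have hstep : ∀ n, (finrank ℂ (H (n + 1)) : ℤ) = finrank ℂ (H n) -
      ((f.dim (n + 1) : ℤ) - f.dim n) * (finrank ℂ Q - g.dim (n + 1)) := by
    intro n
    let A := f.F (n + 1)
    let B := Q ⧸ g.F (n + 1)
    let res : (A →ₗ[ℂ] B) →ₗ[ℂ] (f.F n →ₗ[ℂ] B) :=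
      LinearMap.lcomp ℂ B (Submodule.inclusion (f.mono n.le_succ))
    let L : H n →ₗ[ℂ] (A →ₗ[ℂ] B) :=
      (LinearMap.lcomp ℂ B A.subtype ∘ₗ LinearMap.compRight ℂ (g.F (n + 1)).mkQ) ∘ₗ (H n).subtype
    have hL : ∀ φ x, L φ x = (g.F (n + 1)).mkQ (φ.1 x) := fun _ _ => rfl
    have hres : Function.Surjective res := by
      intro ψ
      obtain ⟨χ, hχ⟩ := LinearMap.exists_extend
        (ψ ∘ₗ (Submodule.submoduleOfEquivOfLe (f.mono n.le_succ)).toLinearMap)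
      refine ⟨χ, LinearMap.ext fun x => ?_⟩
      exact LinearMap.congr_fun hχ ⟨Submodule.inclusion (f.mono n.le_succ) x, x.2⟩
    have hrange : LinearMap.range L = LinearMap.ker res := by
      ext ψ
      constructor
      · rintro ⟨φ, rfl⟩
        refine LinearMap.ext fun x => ?_
        change (g.F (n + 1)).mkQ (φ.1 x) = 0
        rw [← LinearMap.mem_ker, Submodule.ker_mkQ]
        exact g.mono n.le_succ (φ.2 n le_rfl x x.2)
      · intro hψ
        obtain ⟨s, hs⟩ := (g.F (n + 1)).mkQ.exists_rightInverse_of_surjective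
          (Submodule.range_mkQ _)
        obtain ⟨χ, hχ⟩ := LinearMap.exists_extend (s ∘ₗ ψ)
        refine ⟨⟨χ, fun t ht x hx => ?_⟩, LinearMap.ext fun x => ?_⟩
        · have hx' := f.mono ht hx
          have h1 : χ x = s (ψ ⟨x, f.mono n.le_succ hx'⟩) :=
            LinearMap.congr_fun hχ ⟨x, f.mono n.le_succ hx'⟩
          have h2 : ψ ⟨x, f.mono n.le_succ hx'⟩ = 0 := LinearMap.congr_fun hψ ⟨x, hx'⟩
          rw [h1, h2, map_zero]
          exact zero_mem _
        · rw [hL]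
          have h1 : χ x = s (ψ x) := LinearMap.congr_fun hχ x
          change (g.F (n + 1)).mkQ (χ x) = ψ x
          rw [h1]
          exact LinearMap.congr_fun hs (ψ x)
    have hker : finrank ℂ (LinearMap.ker L) = finrank ℂ (H (n + 1)) := by
      have hle : H (n + 1) ≤ H n := fun φ hφ t ht => hφ t (ht.trans n.le_succ)
      have : LinearMap.ker L = (H (n + 1)).comap (H n).subtype := by
        ext φ
        rw [LinearMap.mem_ker, LinearMap.ext_iff]
        simp only [hL, ← LinearMap.mem_ker, LinearMap.zero_apply]
        constructor
        · intro h t ht x hx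
          rcases Nat.lt_or_ge n t with h' | h'
          · obtain rfl : t = n + 1 := by omega
            exact (Submodule.Quotient.mk_eq_zero _).1 (h ⟨x, hx⟩)
          · exact φ.2 t h' x hx
        · intro h x
          exact (Submodule.Quotient.mk_eq_zero _).2 (h (n + 1) le_rfl x x.2)
      rw [this]
      exact (Submodule.submoduleOfEquivOfLe hle).finrank_eq
    have e1 := LinearMap.finrank_range_add_finrank_ker L
    have e2 := LinearMap.finrank_range_add_finrank_ker res
    rw [LinearMap.range_eq_top.2 hres, finrank_top, finrank_linearMap, finrank_linearMap] at e2
    rw [hrange, hker] at e1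
    have e3 : finrank ℂ B + g.dim (n + 1) = finrank ℂ Q :=
      Submodule.finrank_quotient_add_finrank _
    have e4 : (finrank ℂ B : ℤ) = finrank ℂ Q - g.dim (n + 1) := by omega
    rw [← e4, sub_mul]
    have e5 : (finrank ℂ (f.F n) : ℤ) * finrank ℂ B + finrank ℂ (LinearMap.ker res) =
      finrank ℂ A * finrank ℂ B := by exact_mod_cast e2
    have e6 : (f.dim (n + 1) : ℤ) = finrank ℂ A := rfl
    have e7 : (f.dim n : ℤ) = finrank ℂ (f.F n) := rfl
    rw [e6, e7]
    have e8 : (finrank ℂ (LinearMap.ker res) : ℤ) + finrank ℂ (H (n + 1)) = finrank ℂ (H n) := by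
      exact_mod_cast e1
    linarith
  have hn : ∀ n, (finrank ℂ (H n) : ℤ) = finrank ℂ V * finrank ℂ Q -
      finrank ℂ Q * f.dim n + ∑ t ∈ Finset.range n, ((f.dim (t + 1) : ℤ) - f.dim t) *
        g.dim (t + 1) := by
    intro n
    induction n with
    | zero =>
      have : H 0 = ⊤ := by
        refine top_le_iff.1 fun φ _ t ht x hx => ?_
        obtain rfl : t = 0 := by omega
        rw [f.zero, Submodule.mem_bot] at hx
        simp [hx]
      rw [this, finrank_top, finrank_linearMap, f.dim_zero]
      simp
    | succ n ih =>
      rw [hstep, ih, Finset.sum_range_succ]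
      ring
  have hT : f.Hom g = H T := by
    ext φ
    refine ⟨fun h t _ => h t, fun h t x hx => ?_⟩
    rcases le_total t T with h' | h'
    · exact h t h' x hx
    · rw [g.F_eq_top h']
      trivial
  rw [hT, hn, f.dim_top, eul]
  ring

end Filt

theorem eul_add_left (T : ℕ) (N N' N'' M : ℕ → ℕ) (h : ∀ t, N t = N' t + N'' t) :
    eul T N M = eul T N' M + eul T N'' M := by
  simp only [eul, ← Finset.sum_add_distrib]
  refine Finset.sum_congr rfl fun t _ => ?_
  rw [h, h]
  push_cast
  ring

theorem eul_abel (T : ℕ) (N M : ℕ → ℕ) (h0 : N 0 = 0) :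
    eul T N M = N T * M T - ∑ t ∈ Finset.range T, (N t : ℤ) * (M (t + 1) - M t) := by
  unfold eul
  induction T with
  | zero => simp [h0]
  | succ T ih =>
    rw [Finset.sum_range_succ, Finset.sum_range_succ, ih]
    ring

/-- Earlier jumps give a smaller Euler pairing. -/
theorem eul_anti (T : ℕ) (N N' M : ℕ → ℕ) (h0 : N 0 = 0) (h0' : N' 0 = 0) (hT : N T = N' T)
    (hM : Monotone M) (h : ∀ t, N t ≤ N' t) : eul T N' M ≤ eul T N M := by
  rw [eul_abel T N M h0, eul_abel T N' M h0', hT]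
  refine sub_le_sub_left (Finset.sum_le_sum fun t _ => ?_) _
  have h1 : (M t : ℤ) ≤ M (t + 1) := by exact_mod_cast hM t.le_succ
  have h2 : (N t : ℤ) ≤ N' t := by exact_mod_cast h t
  exact mul_le_mul_of_nonneg_right h2 (by omega)

theorem eul_nonneg (T : ℕ) (N M : ℕ → ℕ) (hN : Monotone N) : 0 ≤ eul T N M := by
  refine Finset.sum_nonneg fun t _ => mul_nonneg ?_ (by positivity)
  have : (N t : ℤ) ≤ N (t + 1) := by exact_mod_cast hN t.le_succ
  omega

/-- Euler characteristic attached to two triples of dimension functions of total dimensions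
`d` and `q`. -/
def chi (T d q : ℕ) (N M : Fin 3 → ℕ → ℕ) : ℤ :=
  ∑ m, eul T (N m) (M m) - 2 * d * q

theorem chi_add_left (T d d' d'' q : ℕ) (N N' N'' M : Fin 3 → ℕ → ℕ) (hd : d = d' + d'')
    (h : ∀ m t, N m t = N' m t + N'' m t) :
    chi T d q N M = chi T d' q N' M + chi T d'' q N'' M := by
  simp only [chi, fun m => eul_add_left T _ _ _ (M m) (h m), Finset.sum_add_distrib, hd]
  push_cast
  ring

section Triples

variable {T : ℕ} {V Q R : Type} [AddCommGroup V] [Module ℂ V] [AddCommGroup Q] [Module ℂ Q]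
  [AddCommGroup R] [Module ℂ R]

/-- Linear maps respecting three filtrations. -/
def Hom3 (f : Fin 3 → Filt T V) (g : Fin 3 → Filt T Q) : Submodule ℂ (V →ₗ[ℂ] Q) :=
  ⨅ m, (f m).Hom (g m)

theorem mem_Hom3 {f : Fin 3 → Filt T V} {g : Fin 3 → Filt T Q} {φ : V →ₗ[ℂ] Q} :
    φ ∈ Hom3 f g ↔ ∀ m t, ∀ x ∈ (f m).F t, φ x ∈ (g m).F t := by
  simp [Hom3, Submodule.mem_iInf, Filt.mem_Hom]

/-- Vanishing of the obstruction space between two triply filtered spaces. -/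
def Surj (f : Fin 3 → Filt T V) (g : Fin 3 → Filt T Q) : Prop :=
  Transverse fun m => (f m).Hom (g m)

/-- Euler characteristic of a pair of triply filtered spaces. -/
noncomputable def chiF (f : Fin 3 → Filt T V) (g : Fin 3 → Filt T Q) : ℤ :=
  chi T (finrank ℂ V) (finrank ℂ Q) (fun m => (f m).dim) (fun m => (g m).dim)

variable [FiniteDimensional ℂ V] [FiniteDimensional ℂ Q] [FiniteDimensional ℂ R]

theorem chiF_eq (f : Fin 3 → Filt T V) (g : Fin 3 → Filt T Q) :
    chiF f g = ∑ m, (finrank ℂ ((f m).Hom (g m)) : ℤ) - 2 * finrank ℂ (V →ₗ[ℂ] Q) := by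
  simp only [Filt.finrank_Hom, finrank_linearMap, chiF, chi]
  push_cast
  ring

theorem chiF_le (f : Fin 3 → Filt T V) (g : Fin 3 → Filt T Q) :
    chiF f g ≤ finrank ℂ (Hom3 f g) := by
  rw [chiF_eq]
  exact le_finrank_iInf _

theorem surj_iff (f : Fin 3 → Filt T V) (g : Fin 3 → Filt T Q) :
    Surj f g ↔ (finrank ℂ (Hom3 f g) : ℤ) ≤ chiF f g := by
  rw [chiF_eq]
  exact transverse_iff _

theorem Surj.finrank_eq {f : Fin 3 → Filt T V} {g : Fin 3 → Filt T Q} (h : Surj f g) :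
    (finrank ℂ (Hom3 f g) : ℤ) = chiF f g :=
  le_antisymm ((surj_iff f g).1 h) (chiF_le f g)

omit [FiniteDimensional ℂ V] [FiniteDimensional ℂ Q] in
theorem Surj.sub {f : Fin 3 → Filt T V} {g : Fin 3 → Filt T Q} (h : Surj f g)
    (S : Submodule ℂ V) : Surj (fun m => (f m).sub S) g := by
  intro ψ
  choose ξ hξ using fun m => LinearMap.exists_extend (ψ m)
  obtain ⟨φ, hφ⟩ := h ξ
  refine ⟨φ ∘ₗ S.subtype, fun m t x hx => ?_⟩
  have := hφ m t x hx
  rwa [LinearMap.sub_apply, ← LinearMap.congr_fun (hξ m) x]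

omit [FiniteDimensional ℂ Q] [FiniteDimensional ℂ R] in
theorem chiF_eq_add_ker (f : Fin 3 → Filt T V) (g : Fin 3 → Filt T Q) (π : V →ₗ[ℂ] R)
    (hπ : Function.Surjective π) :
    chiF f g = chiF (fun m => (f m).sub (LinearMap.ker π)) g +
      chiF (fun m => (f m).map π hπ) g := by
  refine chi_add_left _ _ _ _ _ _ _ _ _ ?_ fun m t => (f m).dim_eq_add π hπ t
  rw [← LinearMap.finrank_range_add_finrank_ker π, LinearMap.range_eq_top.2 hπ, finrank_top,
    add_comm]

end Triples

section Perturbation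

variable {U Q : Type} [AddCommGroup U] [Module ℂ U] [AddCommGroup Q] [Module ℂ Q]

theorem finite_not_injective_add_smul [FiniteDimensional ℂ U] (φ ψ : U →ₗ[ℂ] Q)
    (hφ : Function.Injective φ) : {c : ℂ | ¬ Function.Injective (φ + c • ψ)}.Finite := by
  obtain ⟨L, hL⟩ := φ.exists_leftInverse_of_injective (LinearMap.ker_eq_bot.2 hφ)
  refine ((Module.End.finite_hasEigenvalue (L ∘ₗ ψ)).image fun μ => -μ⁻¹).subset ?_
  intro c hc
  rw [Set.mem_ofPred_eq, ← LinearMap.ker_eq_bot, Submodule.eq_bot_iff] at hc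
  push Not at hc
  obtain ⟨u, hu, hu0⟩ := hc
  have h1 : u + c • L (ψ u) = 0 := by
    have := congrArg L (LinearMap.mem_ker.1 hu)
    rw [LinearMap.add_apply, LinearMap.smul_apply, map_add, map_smul, map_zero] at this
    have h2 := LinearMap.congr_fun hL u
    simp only [LinearMap.comp_apply, LinearMap.id_apply] at h2
    rwa [h2] at this
  have hc0 : c ≠ 0 := by
    rintro rfl
    simp [hu0] at h1
  refine ⟨-c⁻¹, ?_, by field_simp⟩
  refine Module.End.hasEigenvalue_of_hasEigenvector (x := u) ⟨?_, hu0⟩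
  rw [Module.End.mem_eigenspace_iff, LinearMap.comp_apply]
  have : L (ψ u) = c⁻¹ • (c • L (ψ u)) := by rw [smul_smul, inv_mul_cancel₀ hc0, one_smul]
  rw [this, eq_neg_of_add_eq_zero_right h1, smul_neg, neg_smul]

theorem finite_finrank_range_lt [FiniteDimensional ℂ U] (φ ψ : U →ₗ[ℂ] Q) :
    {c : ℂ | finrank ℂ (LinearMap.range (φ + c • ψ)) < finrank ℂ (LinearMap.range φ)}.Finite := by
  obtain ⟨C, hC⟩ := exists_isCompl (LinearMap.ker φ)
  have hinj : Function.Injective (φ.domRestrict C) := by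
    rw [← LinearMap.ker_eq_bot, Submodule.eq_bot_iff]
    intro u hu
    exact Subtype.ext (Submodule.disjoint_def.1 hC.disjoint u hu u.2)
  have hdim : finrank ℂ (LinearMap.range φ) = finrank ℂ C := by
    have h1 := LinearMap.finrank_range_add_finrank_ker φ
    have h2 := Submodule.finrank_add_eq_of_isCompl hC
    omega
  refine (finite_not_injective_add_smul _ (ψ.domRestrict C) hinj).subset fun c hc hc' => ?_
  have h1 := LinearMap.finrank_range_of_inj hc'
  have h2 : finrank ℂ (LinearMap.range (φ.domRestrict C + c • ψ.domRestrict C)) ≤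
      finrank ℂ (LinearMap.range (φ + c • ψ)) := by
    refine Submodule.finrank_mono ?_
    rintro _ ⟨x, rfl⟩
    exact ⟨x, rfl⟩
  rw [Set.mem_ofPred_eq] at hc
  omega

theorem finite_finrank_range_le [FiniteDimensional ℂ U] (φ ψ : U →ₗ[ℂ] Q) (x : U) (hx : φ x = 0)
    (hψ : ψ x ∉ LinearMap.range φ) :
    {c : ℂ | finrank ℂ (LinearMap.range (φ + c • ψ)) ≤ finrank ℂ (LinearMap.range φ)}.Finite := by
  obtain ⟨C, hC⟩ := exists_isCompl (LinearMap.ker φ)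
  have hinj : Function.Injective ((φ.domRestrict C).coprod (LinearMap.toSpanSingleton ℂ Q (ψ x))) := by
    rw [← LinearMap.ker_eq_bot, Submodule.eq_bot_iff]
    rintro ⟨u, s⟩ hus
    simp only [LinearMap.mem_ker, LinearMap.coprod_apply, LinearMap.domRestrict_apply,
      LinearMap.toSpanSingleton_apply] at hus
    have hs : s = 0 := by
      by_contra hs
      refine hψ ⟨-s⁻¹ • u, ?_⟩
      rw [map_smul, eq_neg_of_add_eq_zero_left hus, neg_smul, smul_neg, neg_neg, smul_smul,
        inv_mul_cancel₀ hs, one_smul]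
    rw [hs, zero_smul, add_zero] at hus
    have := Submodule.disjoint_def.1 hC.disjoint u hus u.2
    ext <;> simp [this, hs]
  have hdim : finrank ℂ (LinearMap.range φ) = finrank ℂ C := by
    have h1 := LinearMap.finrank_range_add_finrank_ker φ
    have h2 := Submodule.finrank_add_eq_of_isCompl hC
    omega
  refine ((finite_not_injective_add_smul _ ((ψ.domRestrict C) ∘ₗ LinearMap.fst ℂ C ℂ) hinj).union
    (Set.finite_singleton 0)).subset fun c hc => ?_
  by_contra hc'
  simp only [Set.mem_union, Set.mem_ofPred_eq, not_or, not_not, Set.mem_singleton_iff] at hc'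
  obtain ⟨hc', hc0⟩ := hc'
  have h1 := LinearMap.finrank_range_of_inj hc'
  rw [finrank_prod, finrank_self] at h1
  have h2 : finrank ℂ (LinearMap.range ((φ.domRestrict C).coprod
      (LinearMap.toSpanSingleton ℂ Q (ψ x)) + c • (ψ.domRestrict C) ∘ₗ LinearMap.fst ℂ C ℂ)) ≤
      finrank ℂ (LinearMap.range (φ + c • ψ)) := by
    refine Submodule.finrank_mono ?_
    rintro _ ⟨⟨u, s⟩, rfl⟩
    refine ⟨u + (c⁻¹ * s) • x, ?_⟩
    simp [hx, smul_smul]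
    field_simp
    abel
  rw [Set.mem_ofPred_eq] at hc
  omega

end Perturbation

section Movable

variable {T r q : ℕ}

/-- Every infinitesimal motion of the filtrations is realised by a derivation of `ℂ`. -/
def Movable (f : Fin 3 → Filt T (Fin r → ℂ)) (g : Fin 3 → Filt T (Fin q → ℂ)) : Prop :=
  ∀ (e : Fin 3 → (Fin r → ℂ) →ₗ[ℂ] (Fin r → ℂ)) (k : Fin 3 → (Fin q → ℂ) →ₗ[ℂ] (Fin q → ℂ)),
    ∃ δ : Derivation ℤ ℂ ℂ, (∀ m t, ∀ x ∈ (f m).F t, (fun i => δ (x i)) - e m x ∈ (f m).F t) ∧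
      ∀ m t, ∀ x ∈ (g m).F t, (fun i => δ (x i)) - k m x ∈ (g m).F t

/-- Commutator of a linear map with a coordinatewise derivation. -/
def derivMap (δ : Derivation ℤ ℂ ℂ) (φ : (Fin r → ℂ) →ₗ[ℂ] (Fin q → ℂ)) :
    (Fin r → ℂ) →ₗ[ℂ] (Fin q → ℂ) where
  toFun x := (fun i => δ (φ x i)) - φ fun i => δ (x i)
  map_add' x y := by
    have : (fun i => δ ((x + y) i)) = (fun i => δ (x i)) + fun i => δ (y i) := by
      ext i; simp
    rw [this, map_add, map_add]
    ext i
    simp only [Pi.add_apply, Pi.sub_apply, map_add]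
    ring
  map_smul' c x := by
    have : (fun i => δ ((c • x) i)) = c • (fun i => δ (x i)) + δ c • x := by
      ext i; simp [mul_comm]
    rw [this, map_add, map_smul, map_smul, map_smul]
    ext i
    simp only [Pi.add_apply, Pi.sub_apply, Pi.smul_apply, smul_eq_mul, RingHom.id_apply,
      Derivation.leibniz]
    ring

theorem derivMap_apply (δ : Derivation ℤ ℂ ℂ) (φ : (Fin r → ℂ) →ₗ[ℂ] (Fin q → ℂ))
    (x : Fin r → ℂ) : derivMap δ φ x = (fun i => δ (φ x i)) - φ fun i => δ (x i) := rfl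

variable {f : Fin 3 → Filt T (Fin r → ℂ)} {g : Fin 3 → Filt T (Fin q → ℂ)}

theorem Movable.exists_hom (h : Movable f g) {φ : (Fin r → ℂ) →ₗ[ℂ] (Fin q → ℂ)}
    (hφ : φ ∈ Hom3 f g) (e : Fin 3 → (Fin r → ℂ) →ₗ[ℂ] (Fin r → ℂ))
    (k : Fin 3 → (Fin q → ℂ) →ₗ[ℂ] (Fin q → ℂ)) :
    ∃ φ' : (Fin r → ℂ) →ₗ[ℂ] (Fin q → ℂ), ∀ m t, ∀ x ∈ (f m).F t,
      φ' x + φ (e m x) - k m (φ x) ∈ (g m).F t ∧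
      (φ x = 0 → φ' x + φ (e m x) ∈ ((f m).F t).map φ) := by
  obtain ⟨δ, h1, h2⟩ := h e k
  rw [mem_Hom3] at hφ
  refine ⟨derivMap δ φ, fun m t x hx => ⟨?_, fun hx0 => ?_⟩⟩
  · have a1 := hφ m t _ (h1 m t x hx)
    have a2 := h2 m t _ (hφ m t x hx)
    have := sub_mem a2 a1
    rw [map_sub] at this
    rw [derivMap_apply]
    convert this using 1
    abel
  · refine ⟨_, neg_mem (h1 m t x hx), ?_⟩
    rw [derivMap_apply, hx0, map_neg, map_sub]
    have : (fun i => δ ((0 : Fin q → ℂ) i)) = 0 := by ext i; simp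
    rw [this]
    abel

theorem Movable.surj_mkQ (h : Movable f g) (S : Submodule ℂ (Fin r → ℂ)) :
    Surj (fun m => (f m).sub S) (fun m => (f m).map S.mkQ S.mkQ_surjective) := by
  intro ψ
  have he : ∀ m, ∃ e : (Fin r → ℂ) →ₗ[ℂ] (Fin r → ℂ), ∀ x : S, S.mkQ (e x) = ψ m x := by
    intro m
    obtain ⟨s, hs⟩ := S.mkQ.exists_rightInverse_of_surjective (Submodule.range_mkQ _)
    obtain ⟨e, he⟩ := LinearMap.exists_extend (s ∘ₗ ψ m)
    refine ⟨e, fun x => ?_⟩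
    have := LinearMap.congr_fun he x
    simp only [LinearMap.comp_apply, Submodule.subtype_apply] at this
    rw [this]
    exact LinearMap.congr_fun hs _
  choose e he using he
  obtain ⟨δ, h1, -⟩ := h e 0
  let u : S →ₗ[ℂ] ((Fin r → ℂ) ⧸ S) :=
    { toFun := fun x => S.mkQ fun i => δ ((x : Fin r → ℂ) i)
      map_add' := fun x y => by
        rw [← map_add]
        congr 1
        ext i
        simp
      map_smul' := fun c x => by
        have : (fun i => δ (((c • x : S) : Fin r → ℂ) i)) =
            c • (fun i => δ ((x : Fin r → ℂ) i)) + δ c • (x : Fin r → ℂ) := by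
          ext i; simp [mul_comm]
        rw [this, map_add, map_smul, map_smul]
        have hx : S.mkQ x = 0 := (Submodule.Quotient.mk_eq_zero _).2 x.2
        simp [hx] }
  refine ⟨u, fun m t x hx => ?_⟩
  refine ⟨_, h1 m t x hx, ?_⟩
  rw [map_sub, he, LinearMap.sub_apply]
  rfl

/-- A filtered map whose image filtrations have maximal dimensions absorbs all others. -/
theorem exists_maximal_hom (f : Fin 3 → Filt T (Fin r → ℂ)) (g : Fin 3 → Filt T (Fin q → ℂ)) :
    ∃ φ ∈ Hom3 f g, ∀ ψ ∈ Hom3 f g, ∀ m t, ∀ x ∈ (f m).F t, φ x = 0 →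
      ψ x ∈ ((f m).F t).map φ := by
  let rk : ((Fin r → ℂ) →ₗ[ℂ] (Fin q → ℂ)) → Fin 3 × Fin (T + 1) → ℕ := fun φ i =>
    finrank ℂ (LinearMap.range (φ.domRestrict ((f i.1).F i.2)))
  have hbdd : BddAbove (Set.range fun φ : Hom3 f g => ∑ i, rk φ i) := by
    refine ⟨∑ i : Fin 3 × Fin (T + 1), q, ?_⟩
    rintro _ ⟨φ, rfl⟩
    refine Finset.sum_le_sum fun i _ => ?_
    refine (Submodule.finrank_le _).trans ?_
    simp
  obtain ⟨φ, hφ⟩ := Nat.sSup_mem (Set.range_nonempty _) hbdd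
  have hmax : ∀ ψ : Hom3 f g, ∑ i, rk ψ i ≤ ∑ i, rk φ i := fun ψ => by
    refine (le_csSup hbdd ⟨ψ, rfl⟩).trans hφ.ge
  refine ⟨φ, φ.2, fun ψ hψ m t x hx hx0 => ?_⟩
  by_contra hcon
  obtain ⟨j, hxj, hj⟩ : ∃ j : Fin (T + 1), x ∈ (f m).F j ∧ ψ x ∉ ((f m).F j).map φ.1 := by
    rcases Nat.lt_or_ge t (T + 1) with h | h
    · exact ⟨⟨t, h⟩, hx, hcon⟩
    · have e1 := (f m).F_eq_top (t := t) (by omega)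
      refine ⟨⟨T, T.lt_succ_self⟩, ?_, ?_⟩
      · rw [(f m).top]; trivial
      · rw [(f m).top]; rwa [e1] at hcon
  have hfin : (⋃ i : Fin 3 × Fin (T + 1), {c : ℂ | rk (φ.1 + c • ψ) i < rk φ i}).Finite :=
    Set.finite_iUnion fun i => finite_finrank_range_lt
      (φ.1.domRestrict ((f i.1).F i.2)) (ψ.domRestrict ((f i.1).F i.2))
  have hfin2 : {c : ℂ | rk (φ.1 + c • ψ) (m, j) ≤ rk φ (m, j)}.Finite := by
    refine finite_finrank_range_le (φ.1.domRestrict ((f m).F j)) (ψ.domRestrict ((f m).F j))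
      ⟨x, hxj⟩ hx0 ?_
    rwa [LinearMap.range_domRestrict]
  obtain ⟨c, hc⟩ := (hfin.union hfin2).infinite_compl.nonempty
  simp only [Set.mem_compl_iff, Set.mem_union, Set.mem_iUnion, Set.mem_ofPred_eq, not_or,
    not_exists, not_lt, not_le] at hc
  refine absurd (hmax ⟨φ.1 + c • ψ, add_mem φ.2 (Submodule.smul_mem _ c hψ)⟩) (not_le.2 ?_)
  exact Finset.sum_lt_sum (fun i _ => hc.1 i) ⟨(m, j), Finset.mem_univ _, hc.2⟩

/-- The image filtrations on the range of a linear map. -/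
noncomputable def onRange {T : ℕ} {V Q : Type} [AddCommGroup V] [Module ℂ V]
    [AddCommGroup Q] [Module ℂ Q] (f : Fin 3 → Filt T V) (φ : V →ₗ[ℂ] Q) (m : Fin 3) :
    Filt T (LinearMap.range φ) :=
  (f m).map φ.rangeRestrict (LinearMap.surjective_rangeRestrict φ)

theorem mem_onRange {T : ℕ} {V Q : Type} [AddCommGroup V] [Module ℂ V]
    [AddCommGroup Q] [Module ℂ Q] {f : Fin 3 → Filt T V} {φ : V →ₗ[ℂ] Q} {m : Fin 3} {t : ℕ}
    {y : LinearMap.range φ} : y ∈ (onRange f φ m).F t ↔ (y : Q) ∈ ((f m).F t).map φ := by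
  constructor
  · rintro ⟨x, hx, rfl⟩
    exact ⟨x, hx, rfl⟩
  · rintro ⟨x, hx, hxy⟩
    exact ⟨x, hx, Subtype.ext hxy⟩

variable {f : Fin 3 → Filt T (Fin r → ℂ)} {g : Fin 3 → Filt T (Fin q → ℂ)}

theorem Movable.surj_ker_range (h : Movable f g) {φ : (Fin r → ℂ) →ₗ[ℂ] (Fin q → ℂ)}
    (hφ : φ ∈ Hom3 f g) : Surj (fun m => (f m).sub (LinearMap.ker φ)) (onRange f φ) := by
  intro ψ
  have he : ∀ m, ∃ e : (Fin r → ℂ) →ₗ[ℂ] (Fin r → ℂ), ∀ x : LinearMap.ker φ,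
      φ (e x) = ψ m x := by
    intro m
    obtain ⟨s, hs⟩ := φ.rangeRestrict.exists_rightInverse_of_surjective φ.range_rangeRestrict
    obtain ⟨e, he⟩ := LinearMap.exists_extend (s ∘ₗ ψ m)
    refine ⟨e, fun x => ?_⟩
    have := LinearMap.congr_fun he x
    simp only [LinearMap.comp_apply, Submodule.subtype_apply] at this
    rw [this]
    exact congrArg Subtype.val (LinearMap.congr_fun hs (ψ m x))
  choose e he using he
  obtain ⟨φ', hφ'⟩ := h.exists_hom hφ e 0
  have hr : ∀ x : LinearMap.ker φ, φ' x ∈ LinearMap.range φ := by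
    intro x
    have := (hφ' 0 T x (by rw [(f 0).top]; trivial)).2 x.2
    rw [he] at this
    have h2 : φ' x + ψ 0 x ∈ LinearMap.range φ := LinearMap.map_le_range this
    simpa using sub_mem h2 (ψ 0 x).2
  refine ⟨-((φ'.domRestrict (LinearMap.ker φ)).codRestrict _ hr), fun m t x hx => ?_⟩
  rw [mem_onRange]
  have := neg_mem ((hφ' m t x hx).2 x.2)
  rw [he] at this
  convert this using 1
  change -φ' x - ψ m x = _
  abel

theorem finrank_eq_of_restrict {E F : Type} [AddCommGroup E] [Module ℂ E] [AddCommGroup F]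
    [Module ℂ F] [FiniteDimensional ℂ E] (ρ : E →ₗ[ℂ] F) (Y : Submodule ℂ E) :
    finrank ℂ Y = finrank ℂ (Y.map ρ) + finrank ℂ ↥(LinearMap.ker ρ ⊓ Y) := by
  have h := LinearMap.finrank_range_add_finrank_ker (ρ.domRestrict Y)
  rw [LinearMap.range_domRestrict] at h
  rw [← h]
  congr 1
  have : LinearMap.ker (ρ.domRestrict Y) = (LinearMap.ker ρ).comap Y.subtype := rfl
  rw [this, inf_comm, ← Submodule.map_comap_subtype]
  exact (Submodule.equivMapOfInjective Y.subtype Y.injective_subtype _).finrank_eq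

theorem Movable.exists_decomposition (h : Movable f g) :
    ∃ φ ∈ Hom3 f g, (finrank ℂ (Hom3 f g) : ℤ) ≤
      chiF (fun m => (f m).sub (LinearMap.ker φ)) (onRange f φ) + chiF (onRange f φ) g := by
  obtain ⟨φ, hφ, hmax⟩ := exists_maximal_hom f g
  refine ⟨φ, hφ, ?_⟩
  let S := LinearMap.ker φ
  let R := LinearMap.range φ
  let X : Submodule ℂ ((Fin r → ℂ) →ₗ[ℂ] (Fin q → ℂ)) :=
    { carrier := {ψ | ∀ m t, ∀ x ∈ (f m).F t, φ x = 0 → ψ x ∈ ((f m).F t).map φ}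
      add_mem' := fun ha hb m t x hx h0 => add_mem (ha m t x hx h0) (hb m t x hx h0)
      zero_mem' := fun m t x hx h0 => zero_mem _
      smul_mem' := fun c ψ ha m t x hx h0 => Submodule.smul_mem _ c (ha m t x hx h0) }
  let ρ : ((Fin r → ℂ) →ₗ[ℂ] (Fin q → ℂ)) →ₗ[ℂ] (S →ₗ[ℂ] (Fin q → ℂ)) :=
    LinearMap.lcomp ℂ _ S.subtype
  let Z : Submodule ℂ (S →ₗ[ℂ] (Fin q → ℂ)) :=
    (Hom3 (fun m => (f m).sub S) (onRange f φ)).map (LinearMap.compRight ℂ R.subtype)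
  have hφ3 := mem_Hom3.1 hφ
  have hmapg : ∀ m t, ((f m).F t).map φ ≤ (g m).F t := by
    rintro m t _ ⟨x, hx, rfl⟩
    exact hφ3 m t x hx
  have hXZ : ∀ ψ ∈ X, ρ ψ ∈ Z := by
    intro ψ hψ
    have hr : ∀ x : S, ψ x ∈ R := fun x =>
      LinearMap.map_le_range (hψ 0 T x (by rw [(f 0).top]; trivial) x.2)
    refine ⟨(ψ.domRestrict S).codRestrict _ hr, mem_Hom3.2 fun m t x hx => ?_, ?_⟩
    · rw [mem_onRange]
      exact hψ m t x hx x.2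
    · ext; rfl
  have hZX : ∀ m, ∀ η ∈ Z, ∃ ψ ∈ X ⊓ (f m).Hom (g m), ρ ψ = η := by
    rintro m _ ⟨ψ, hψ, rfl⟩
    have hψ := mem_Hom3.1 hψ
    obtain ⟨ξ, h1, h2⟩ := (f m).exists_extend (onRange f φ m) S ψ fun t x hx => hψ m t x hx
    refine ⟨R.subtype ∘ₗ ξ, ⟨fun m' t x hx h0 => ?_, fun t x hx => ?_⟩, ?_⟩
    · have := hψ m' t ⟨x, h0⟩ hx
      rw [← h2, mem_onRange] at this
      exact this
    · exact hmapg m t (mem_onRange.1 (h1 t x hx))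
    · refine LinearMap.ext fun x => congrArg Subtype.val (h2 x)
  let κ : (R →ₗ[ℂ] (Fin q → ℂ)) →ₗ[ℂ] ((Fin r → ℂ) →ₗ[ℂ] (Fin q → ℂ)) :=
    LinearMap.lcomp ℂ _ φ.rangeRestrict
  have hκ : Function.Injective κ := by
    intro a b hab
    refine LinearMap.ext fun y => ?_
    obtain ⟨x, rfl⟩ := LinearMap.surjective_rangeRestrict φ y
    exact LinearMap.congr_fun hab x
  have hκ0 : ∀ η x, φ x = 0 → κ η x = 0 := by
    intro η x hx
    have : φ.rangeRestrict x = 0 := Subtype.ext hx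
    change η (φ.rangeRestrict x) = 0
    rw [this, map_zero]
  have hκX : ∀ η, κ η ∈ LinearMap.ker ρ ⊓ X := by
    intro η
    refine ⟨LinearMap.ext fun x => hκ0 η x x.2, fun m t x _ h0 => ?_⟩
    rw [hκ0 η x h0]
    exact zero_mem _
  have hρker : ∀ ψ ∈ LinearMap.ker ρ, ∃ η, κ η = ψ := by
    intro ψ h0
    obtain ⟨s, hs⟩ := φ.rangeRestrict.exists_rightInverse_of_surjective φ.range_rangeRestrict
    refine ⟨ψ ∘ₗ s, LinearMap.ext fun x => ?_⟩
    have h1 : s (φ.rangeRestrict x) - x ∈ S := by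
      have := LinearMap.congr_fun hs (φ.rangeRestrict x)
      have h2 : φ (s (φ.rangeRestrict x)) = φ x := congrArg Subtype.val this
      exact (LinearMap.sub_mem_ker_iff).2 h2
    have h2 : ψ (s (φ.rangeRestrict x) - x) = 0 := LinearMap.congr_fun h0 ⟨_, h1⟩
    rw [map_sub, sub_eq_zero] at h2
    exact h2
  have hZ : finrank ℂ Z = finrank ℂ (Hom3 (fun m => (f m).sub S) (onRange f φ)) := by
    refine (Submodule.equivMapOfInjective _ ?_ _).finrank_eq.symm
    intro a b hab
    exact LinearMap.ext fun x => Subtype.ext (LinearMap.congr_fun hab x)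
  have hX : finrank ℂ X = finrank ℂ Z + finrank ℂ (R →ₗ[ℂ] (Fin q → ℂ)) := by
    rw [finrank_eq_of_restrict ρ X]
    have h1 : X.map ρ = Z := by
      refine le_antisymm ?_ fun η hη => ?_
      · rintro _ ⟨ψ, hψ, rfl⟩
        exact hXZ ψ hψ
      · obtain ⟨ψ, hψ, h⟩ := hZX 0 η hη
        exact ⟨ψ, hψ.1, h⟩
    have h2 : LinearMap.ker ρ ⊓ X = LinearMap.range κ := by
      refine le_antisymm (fun ψ hψ => hρker ψ hψ.1) ?_
      rintro _ ⟨η, rfl⟩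
      exact hκX η
    rw [h1, h2, LinearMap.finrank_range_of_inj hκ]
  have hY : ∀ m, finrank ℂ (((f m).Hom (g m)).comap X.subtype) =
      finrank ℂ Z + finrank ℂ ((onRange f φ m).Hom (g m)) := by
    intro m
    have h0 : finrank ℂ (((f m).Hom (g m)).comap X.subtype) =
        finrank ℂ ↥(X ⊓ (f m).Hom (g m)) := by
      rw [← Submodule.map_comap_subtype]
      exact (Submodule.equivMapOfInjective X.subtype X.injective_subtype _).finrank_eq
    rw [h0, finrank_eq_of_restrict ρ]
    have h1 : (X ⊓ (f m).Hom (g m)).map ρ = Z := by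
      refine le_antisymm ?_ fun η hη => hZX m η hη
      rintro _ ⟨ψ, hψ, rfl⟩
      exact hXZ ψ hψ.1
    have h2 : LinearMap.ker ρ ⊓ (X ⊓ (f m).Hom (g m)) = ((onRange f φ m).Hom (g m)).map κ := by
      refine le_antisymm (fun ψ hψ => ?_) ?_
      · obtain ⟨η, rfl⟩ := hρker ψ hψ.1
        refine ⟨η, ?_, rfl⟩
        rintro t _ ⟨x, hx, rfl⟩
        exact hψ.2.2 t x hx
      · rintro _ ⟨η, hη, rfl⟩
        exact ⟨(hκX η).1, (hκX η).2, fun t x hx => hη t _ ⟨x, hx, rfl⟩⟩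
    rw [h1, h2, (Submodule.equivMapOfInjective κ hκ _).finrank_eq]
  let Y : Fin 3 → Submodule ℂ X := fun m => ((f m).Hom (g m)).comap X.subtype
  have htr : Transverse (E := X) Y := by
    intro x
    have hx : ∀ m, ∃ k : (Fin q → ℂ) →ₗ[ℂ] (Fin q → ℂ),
        (x m : (Fin r → ℂ) →ₗ[ℂ] (Fin q → ℂ)) - k ∘ₗ φ ∈ (f m).Hom (g m) := by
      intro m
      obtain ⟨ξ, hξ, h1⟩ := hZX m _ (hXZ (x m) (x m).2)
      obtain ⟨η, h2⟩ := hρker ((x m : (Fin r → ℂ) →ₗ[ℂ] (Fin q → ℂ)) - ξ)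
        (by rw [LinearMap.mem_ker, map_sub, h1, sub_self])
      obtain ⟨k, hk⟩ := LinearMap.exists_extend η
      refine ⟨k, ?_⟩
      have : (x m : (Fin r → ℂ) →ₗ[ℂ] (Fin q → ℂ)) - k ∘ₗ φ = ξ := by
        have h3 : k ∘ₗ φ = κ η := by
          rw [← hk]
          rfl
        rw [h3, h2]
        abel
      rw [this]
      exact hξ.2
    choose k hk using hx
    obtain ⟨φ', hφ'⟩ := h.exists_hom hφ 0 k
    simp only [Pi.zero_apply, LinearMap.zero_apply, map_zero, add_zero] at hφ'
    refine ⟨⟨φ', fun m t x hx h0 => (hφ' m t x hx).2 h0⟩, fun m => ?_⟩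
    have h1 : φ' - k m ∘ₗ φ ∈ (f m).Hom (g m) := fun t y hy => (hφ' m t y hy).1
    have := sub_mem h1 (hk m)
    rw [sub_sub_sub_cancel_right] at this
    exact this
  have hfin := (transverse_iff _).1 htr
  have hle : Hom3 f g ≤ X := fun ψ hψ m t x hx h0 => hmax ψ hψ m t x hx h0
  have hI : finrank ℂ ↥(⨅ m, Y m) = finrank ℂ (Hom3 f g) := by
    have : ⨅ m, Y m = (Hom3 f g).comap X.subtype := (Submodule.comap_iInf _ _).symm
    rw [this]
    exact (Submodule.submoduleOfEquivOfLe hle).finrank_eq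
  have hY' : ∀ m, finrank ℂ (Y m) = _ := hY
  rw [hI] at hfin
  simp only [hY', hX, hZ] at hfin
  rw [chiF_eq (onRange f φ), ← (h.surj_ker_range hφ).finrank_eq]
  push_cast [Finset.sum_add_distrib] at hfin
  simp only [Finset.sum_const, Finset.card_univ, Fintype.card_fin] at hfin
  refine hfin.trans (le_of_eq ?_)
  rw [nsmul_eq_mul]
  change _ = (finrank ℂ (Hom3 (fun m => (f m).sub S) (onRange f φ)) : ℤ) +
    (∑ m, (finrank ℂ ((onRange f φ m).Hom (g m)) : ℤ) - 2 * finrank ℂ (R →ₗ[ℂ] (Fin q → ℂ)))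
  push_cast
  ring

end Movable

section HarderNarasimhan

variable {T : ℕ} {V Q : Type} [AddCommGroup V] [Module ℂ V] [AddCommGroup Q] [Module ℂ Q]
  [FiniteDimensional ℂ V] [FiniteDimensional ℂ Q]

omit [FiniteDimensional ℂ V] [FiniteDimensional ℂ Q] in
theorem chiF_sub_eq (f : Fin 3 → Filt T V) (g : Fin 3 → Filt T Q) (S : Submodule ℂ V) :
    chiF (fun m => (f m).sub S) g = chi T (finrank ℂ S) (finrank ℂ Q)
      (fun m t => finrank ℂ ↥(S ⊓ (f m).F t)) (fun m => (g m).dim) := by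
  unfold chiF
  congr 1
  ext m t
  exact (f m).dim_sub S t

omit [FiniteDimensional ℂ Q] in
theorem chiF_ge (f : Fin 3 → Filt T V) (g : Fin 3 → Filt T Q) :
    -(2 * finrank ℂ V * finrank ℂ Q : ℤ) ≤ chiF f g := by
  have : 0 ≤ ∑ m, eul T ((f m).dim) ((g m).dim) :=
    Finset.sum_nonneg fun m _ => eul_nonneg T _ _ (f m).dim_mono
  unfold chiF chi
  linarith

/-- Inductive slope inequality attached to a filtered map from a subspace to its quotient. -/
theorem chiF_add_le (f : Fin 3 → Filt T V) (g : Fin 3 → Filt T Q) (S : Submodule ℂ V)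
    {φ : S →ₗ[ℂ] (V ⧸ S)} (hφ : φ ∈ Hom3 (fun m => (f m).sub S)
      (fun m => (f m).map S.mkQ S.mkQ_surjective)) :
    chiF (fun m => (f m).sub ((LinearMap.range φ).comap S.mkQ)) g +
      chiF (fun m => (f m).sub ((LinearMap.ker φ).map S.subtype)) g ≤
      2 * chiF (fun m => (f m).sub S) g ∧
    finrank ℂ ((LinearMap.range φ).comap S.mkQ) + finrank ℂ ((LinearMap.ker φ).map S.subtype) =
      2 * finrank ℂ S := by
  rw [mem_Hom3] at hφ
  set S' := (LinearMap.range φ).comap S.mkQ with hS'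
  set K := (LinearMap.ker φ).map S.subtype with hK
  have hSS' : S ≤ S' := by
    intro x hx
    have : S.mkQ x = 0 := (Submodule.Quotient.mk_eq_zero _).2 hx
    rw [hS', Submodule.mem_comap, this]
    exact zero_mem _
  have h1 : ∀ F : Submodule ℂ V, finrank ℂ ↥(S' ⊓ F) =
      finrank ℂ ((S' ⊓ F).map S.mkQ) + finrank ℂ ↥(S ⊓ F) := by
    intro F
    rw [finrank_eq_of_restrict S.mkQ (S' ⊓ F), Submodule.ker_mkQ, ← inf_assoc,
      inf_eq_left.2 hSS']
  have hsub : ∀ (A : Submodule ℂ V) (B : Submodule ℂ V), finrank ℂ (B.comap A.subtype) =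
      finrank ℂ ↥(A ⊓ B) := by
    intro A B
    rw [← Submodule.map_comap_subtype]
    exact (Submodule.equivMapOfInjective A.subtype A.injective_subtype _).finrank_eq
  have h2 : ∀ F : Submodule ℂ V, finrank ℂ ↥(S ⊓ F) =
      finrank ℂ ((F.comap S.subtype).map φ) + finrank ℂ ↥(K ⊓ F) := by
    intro F
    rw [← hsub, finrank_eq_of_restrict φ]
    congr 1
    rw [(Submodule.equivMapOfInjective S.subtype S.injective_subtype _).finrank_eq,
      Submodule.map_inf _ S.injective_subtype, ← hK, Submodule.map_comap_subtype, ← inf_assoc]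
    have : K ⊓ S = K := inf_eq_left.2 (Submodule.map_subtype_le _ _)
    rw [this]
  have hle : ∀ m t, finrank ℂ ↥(S ⊓ (f m).F t) + finrank ℂ ↥(S ⊓ (f m).F t) ≤
      finrank ℂ ↥(S' ⊓ (f m).F t) + finrank ℂ ↥(K ⊓ (f m).F t) := by
    intro m t
    have h3 : finrank ℂ (((((f m).F t)).comap S.subtype).map φ) ≤
        finrank ℂ ((S' ⊓ (f m).F t).map S.mkQ) := by
      refine Submodule.finrank_mono ?_
      rintro _ ⟨x, hx, rfl⟩
      obtain ⟨v, hv, hvx⟩ := hφ m t x hx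
      refine ⟨v, ⟨?_, hv⟩, hvx⟩
      rw [SetLike.mem_coe, hS', Submodule.mem_comap, hvx]
      exact ⟨x, rfl⟩
    have h4 := h1 ((f m).F t)
    have h5 := h2 ((f m).F t)
    omega
  have htot : finrank ℂ S' + finrank ℂ K = 2 * finrank ℂ S := by
    have h4 := h1 ⊤
    have h5 := h2 ⊤
    rw [inf_top_eq, inf_top_eq, hS', Submodule.map_comap_eq_of_surjective S.mkQ_surjective,
      ← hS'] at h4
    rw [inf_top_eq, inf_top_eq, Submodule.comap_top, Submodule.map_top] at h5
    omega
  refine ⟨?_, htot⟩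
  rw [two_mul, chiF_sub_eq, chiF_sub_eq, chiF_sub_eq]
  rw [← chi_add_left T _ _ _ _ (fun m t => finrank ℂ ↥(S' ⊓ (f m).F t) +
    finrank ℂ ↥(K ⊓ (f m).F t)) _ _ _ rfl (fun _ _ => rfl),
    ← chi_add_left T _ _ _ _ (fun m t => finrank ℂ ↥(S ⊓ (f m).F t) +
    finrank ℂ ↥(S ⊓ (f m).F t)) _ _ _ rfl (fun _ _ => rfl), htot, ← two_mul]
  refine sub_le_sub_right (Finset.sum_le_sum fun m _ => ?_) _
  refine eul_anti T _ _ _ ?_ ?_ ?_ (g m).dim_mono (hle m)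
  · simp [(f m).zero]
  · simp [(f m).zero]
  · change finrank ℂ ↥(S ⊓ (f m).F T) + finrank ℂ ↥(S ⊓ (f m).F T) =
      finrank ℂ ↥(S' ⊓ (f m).F T) + finrank ℂ ↥(K ⊓ (f m).F T)
    rw [(f m).top, inf_top_eq, inf_top_eq, inf_top_eq]
    omega

theorem exists_min_slope (f : Fin 3 → Filt T V) (g : Fin 3 → Filt T Q) (S₀ : Submodule ℂ V)
    (h₀ : chiF (fun m => (f m).sub S₀) g < 0) :
    ∃ S : Submodule ℂ V, chiF (fun m => (f m).sub S) g < 0 ∧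
      Hom3 (fun m => (f m).sub S) (fun m => (f m).map S.mkQ S.mkQ_surjective) = ⊥ := by
  let θ : Submodule ℂ V → ℤ := fun S => chiF (fun m => (f m).sub S) g
  let key : Submodule ℂ V → ℤ × ℕ := fun S => (θ S, finrank ℂ S)
  let val : ℤ × ℕ → ℚ ×ₗ ℤ := fun x => toLex ((x.1 : ℚ) / x.2, -(x.2 : ℤ))
  have hpos : ∀ S, θ S < 0 → 0 < finrank ℂ S := by
    intro S hS
    by_contra h0
    have h1 : -(2 * finrank ℂ S * finrank ℂ Q : ℤ) ≤ θ S := chiF_ge _ _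
    obtain h2 : finrank ℂ S = 0 := by omega
    rw [h2] at h1
    simp at h1
    omega
  have hfin : (key '' {S | θ S < 0}).Finite := by
    refine ((Set.finite_Icc (-(2 * finrank ℂ V * finrank ℂ Q : ℤ)) 0).prod
      (Set.finite_Iic (finrank ℂ V))).subset ?_
    rintro _ ⟨S, hS, rfl⟩
    have hd : finrank ℂ S ≤ finrank ℂ V := Submodule.finrank_le S
    refine ⟨⟨?_, le_of_lt hS⟩, hd⟩
    have h1 : -(2 * finrank ℂ S * finrank ℂ Q : ℤ) ≤ θ S := chiF_ge _ _
    refine le_trans ?_ h1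
    gcongr
  obtain ⟨_, ⟨S, hS, rfl⟩, hmin⟩ := Set.exists_min_image _ val hfin ⟨_, S₀, h₀, rfl⟩
  have hmin' : ∀ S', θ S' < 0 → val (key S) ≤ val (key S') := fun S' h => hmin _ ⟨S', h, rfl⟩
  refine ⟨S, hS, ?_⟩
  rw [Submodule.eq_bot_iff]
  intro φ hφ
  by_contra hφ0
  obtain ⟨h1, h2⟩ := chiF_add_le f g S hφ
  set S' := (LinearMap.range φ).comap S.mkQ with hS'
  set K := (LinearMap.ker φ).map S.subtype with hK
  change θ S' + θ K ≤ 2 * θ S at h1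
  have hs : 0 < finrank ℂ S := hpos S hS
  have hKs : finrank ℂ K < finrank ℂ S := by
    refine Submodule.finrank_lt_finrank_of_lt (lt_of_le_of_ne (Submodule.map_subtype_le _ _) ?_)
    intro h
    refine hφ0 (LinearMap.ker_eq_top.1 ?_)
    refine Submodule.map_injective_of_injective S.injective_subtype ?_
    rw [← hK, h, Submodule.map_top, Submodule.range_subtype]
  have hslope : ∀ S₁ : Submodule ℂ V, 0 < finrank ℂ S₁ → θ S * finrank ℂ S₁ ≤ θ S₁ * finrank ℂ S := by
    intro S₁ h₁
    rcases lt_or_ge (θ S₁) 0 with h | h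
    · have h3 := (Prod.Lex.le_iff.1 (hmin' S₁ h))
      have h4 : (θ S : ℚ) / finrank ℂ S ≤ (θ S₁ : ℚ) / finrank ℂ S₁ := by
        rcases h3 with h3 | h3
        · exact h3.le
        · exact h3.1.le
      rw [div_le_div_iff₀ (by exact_mod_cast hs) (by exact_mod_cast h₁)] at h4
      exact_mod_cast h4
    · exact (mul_nonpos_of_nonpos_of_nonneg (le_of_lt hS) (by positivity)).trans
        (mul_nonneg h (by positivity))
  have hK' : θ S * finrank ℂ K ≤ θ K * finrank ℂ S := by
    rcases Nat.eq_zero_or_pos (finrank ℂ K) with h | h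
    · have : -(2 * finrank ℂ K * finrank ℂ Q : ℤ) ≤ θ K := chiF_ge _ _
      rw [h] at this ⊢
      simp at this ⊢
      positivity
    · exact hslope K h
  have hS'' : θ S * finrank ℂ S' < θ S' * finrank ℂ S := by
    have hpos' : 0 < finrank ℂ S' := by omega
    refine lt_of_le_of_ne (hslope S' hpos') fun heq => ?_
    have hneg : θ S' < 0 := by
      by_contra hc
      have := mul_neg_of_neg_of_pos (show θ S < 0 from hS)
        (show (0 : ℤ) < finrank ℂ S' by exact_mod_cast hpos')
      have h5 := mul_nonneg (not_lt.1 hc) (show (0 : ℤ) ≤ finrank ℂ S by positivity)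
      omega
    rcases Prod.Lex.le_iff.1 (hmin' S' hneg) with h3 | h3
    · have h4 : (θ S : ℚ) / finrank ℂ S < (θ S' : ℚ) / finrank ℂ S' := h3
      rw [div_lt_div_iff₀ (by exact_mod_cast hs) (by exact_mod_cast hpos')] at h4
      have : θ S * finrank ℂ S' < θ S' * finrank ℂ S := by exact_mod_cast h4
      omega
    · have h4 : -(finrank ℂ S : ℤ) ≤ -(finrank ℂ S' : ℤ) := h3.2
      omega
  have h6 : θ S * (finrank ℂ S' + finrank ℂ K : ℕ) = θ S * (2 * finrank ℂ S : ℕ) := by rw [h2]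
  push_cast at h6
  nlinarith [mul_le_mul_of_nonneg_right h1 (show (0 : ℤ) ≤ finrank ℂ S by positivity)]

end HarderNarasimhan

theorem Movable.exists_destabilizing {T r q : ℕ} {f : Fin 3 → Filt T (Fin r → ℂ)}
    {g : Fin 3 → Filt T (Fin q → ℂ)} (h : Movable f g) (S₀ : Submodule ℂ (Fin r → ℂ))
    (h₀ : chiF (fun m => (f m).sub S₀) g < 0) :
    ∃ S : Submodule ℂ (Fin r → ℂ), chiF (fun m => (f m).sub S) g < 0 ∧
      Surj (fun m => (f m).sub S) (fun m => (f m).map S.mkQ S.mkQ_surjective) ∧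
      chiF (fun m => (f m).sub S) (fun m => (f m).map S.mkQ S.mkQ_surjective) = 0 := by
  obtain ⟨S, h1, h2⟩ := exists_min_slope f g S₀ h₀
  refine ⟨S, h1, h.surj_mkQ S, ?_⟩
  rw [← (h.surj_mkQ S).finrank_eq, h2, finrank_bot, Nat.cast_zero]

section Generic

/-- Vectors supported on the first `k` coordinates. -/
def std (r k : ℕ) : Submodule ℂ (Fin r → ℂ) where
  carrier := {x | ∀ i : Fin r, k ≤ i → x i = 0}
  add_mem' hx hy i hi := by simp [hx i hi, hy i hi]
  zero_mem' i hi := rfl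
  smul_mem' c x hx i hi := by simp [hx i hi]

theorem mem_std {r k : ℕ} {x : Fin r → ℂ} : x ∈ std r k ↔ ∀ i : Fin r, k ≤ i → x i = 0 := Iff.rfl

theorem std_mono (r : ℕ) : Monotone (std r) := fun _ _ h _ hx i hi => hx i (h.trans hi)

theorem std_zero (r : ℕ) : std r 0 = ⊥ :=
  (Submodule.eq_bot_iff _).2 fun _ hx => funext fun i => hx i (Nat.zero_le _)

theorem std_eq_top {r k : ℕ} (h : r ≤ k) : std r k = ⊤ :=
  top_le_iff.1 fun _ _ i hi => absurd i.2 (by omega)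

theorem std_eq_ker (r k : ℕ) : std r k = LinearMap.ker
    (LinearMap.funLeft ℂ ℂ (Subtype.val : {i : Fin r // k ≤ i} → Fin r)) := by
  ext x
  rw [mem_std, LinearMap.mem_ker, funext_iff]
  exact ⟨fun h i => h i i.2, fun h i hi => h ⟨i, hi⟩⟩

theorem finrank_std {r k : ℕ} (h : k ≤ r) : finrank ℂ (std r k) = k := by
  have h1 := LinearMap.finrank_range_add_finrank_ker
    (LinearMap.funLeft ℂ ℂ (Subtype.val : {i : Fin r // k ≤ i} → Fin r))
  rw [← std_eq_ker, LinearMap.range_eq_top.2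
    (LinearMap.funLeft_surjective_of_injective ℂ ℂ _ Subtype.val_injective), finrank_top,
    finrank_fintype_fun_eq_card, finrank_fin_fun] at h1
  have h2 : Fintype.card {i : Fin r // k ≤ i} = r - k := by
    have h3 := Fintype.card_subtype_compl fun i : Fin r => (i : ℕ) < k
    have h4 : Fintype.card {i : Fin r // (i : ℕ) < k} = k := by
      rw [Fintype.card_congr (Fin.castLEquiv h).symm]
      simp
    simp only [not_lt, Fintype.card_fin] at h3
    omega
  omega

/-- Dimension functions of filtrations of an `r`-dimensional space. -/
structure IsType (T r : ℕ) (N : ℕ → ℕ) : Prop where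
  mono : Monotone N
  zero : N 0 = 0
  top : N T = r
  le : ∀ t, N t ≤ r

theorem Filt.isType {T : ℕ} {V : Type} [AddCommGroup V] [Module ℂ V] [FiniteDimensional ℂ V]
    (f : Filt T V) : IsType T (finrank ℂ V) f.dim :=
  ⟨f.dim_mono, f.dim_zero, f.dim_top, fun _ => Submodule.finrank_le _⟩

/-- The filtration obtained by moving a coordinate filtration. -/
def flag {T r : ℕ} {N : ℕ → ℕ} (hN : IsType T r N) (a : Matrix (Fin r) (Fin r) ℂ)
    (ha : IsUnit a.det) : Filt T (Fin r → ℂ) where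
  F t := (std r (N t)).map a.mulVecLin
  mono _ _ h := Submodule.map_mono (std_mono r (hN.mono h))
  zero := by rw [hN.zero, std_zero, Submodule.map_bot]
  top := by
    rw [hN.top, std_eq_top le_rfl, Submodule.map_top, LinearMap.range_eq_top]
    exact Matrix.mulVec_surjective_iff_isUnit.2 ((Matrix.isUnit_iff_isUnit_det a).2 ha)

theorem det_ne_zero_of_algebraicIndependent {r : ℕ} {a : Matrix (Fin r) (Fin r) ℂ}
    (ha : AlgebraicIndependent ℚ fun i : Fin r × Fin r => a i.1 i.2) : a.det ≠ 0 := by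
  intro h
  have h1 := Matrix.det_mvPolynomialX_ne_zero (Fin r) ℚ
  refine h1 (ha ?_)
  rw [map_zero, ← h, AlgHom.map_det]
  congr 1
  ext i j
  simp [Matrix.mvPolynomialX]

variable {T r q : ℕ} {N M : Fin 3 → ℕ → ℕ}

/-- The list of all matrix entries of two triples of matrices. -/
def entries (a : Fin 3 → Matrix (Fin r) (Fin r) ℂ) (b : Fin 3 → Matrix (Fin q) (Fin q) ℂ) :
    (Fin 3 × Fin r × Fin r) ⊕ (Fin 3 × Fin q × Fin q) → ℂ :=
  Sum.elim (fun i => a i.1 i.2.1 i.2.2) fun i => b i.1 i.2.1 i.2.2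

/-- Filtrations of given dimension types in general position. -/
def Generic (N M : Fin 3 → ℕ → ℕ) (f : Fin 3 → Filt T (Fin r → ℂ))
    (g : Fin 3 → Filt T (Fin q → ℂ)) : Prop :=
  ∃ a b, AlgebraicIndependent ℚ (entries a b) ∧
    (∀ m t, (f m).F t = (std r (N m t)).map (a m).mulVecLin) ∧
    ∀ m t, (g m).F t = (std q (M m t)).map (b m).mulVecLin

theorem mem_map_std_of_derivation (δ : Derivation ℤ ℂ ℂ) (a : Matrix (Fin r) (Fin r) ℂ)
    (e : (Fin r → ℂ) →ₗ[ℂ] (Fin r → ℂ))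
    (h : ∀ i j, δ (a i j) = (LinearMap.toMatrix' e * a) i j) (k : ℕ) (x : Fin r → ℂ)
    (hx : x ∈ (std r k).map a.mulVecLin) :
    (fun i => δ (x i)) - e x ∈ (std r k).map a.mulVecLin := by
  obtain ⟨y, hy, rfl⟩ := hx
  refine ⟨fun i => δ (y i), fun i hi => by simp [hy i hi], ?_⟩
  rw [eq_sub_iff_add_eq]
  have he : e (a.mulVecLin y) = (LinearMap.toMatrix' e * a).mulVec y := by
    rw [← Matrix.mulVec_mulVec, LinearMap.toMatrix'_mulVec, Matrix.mulVecLin_apply]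
  rw [he]
  ext i
  simp only [Matrix.mulVecLin_apply, Matrix.mulVec, dotProduct, Pi.add_apply, map_sum,
    Derivation.leibniz, smul_eq_mul, ← h, ← Finset.sum_add_distrib]
  exact Finset.sum_congr rfl fun j _ => by ring

theorem Generic.movable {f : Fin 3 → Filt T (Fin r → ℂ)} {g : Fin 3 → Filt T (Fin q → ℂ)}
    (h : Generic N M f g) : Movable f g := by
  obtain ⟨a, b, hab, hf, hg⟩ := h
  intro e k
  obtain ⟨δ, hδ⟩ := exists_derivation hab (entries
    (fun m => LinearMap.toMatrix' (e m) * a m) (fun m => LinearMap.toMatrix' (k m) * b m))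
  refine ⟨δ, fun m t x hx => ?_, fun m t x hx => ?_⟩
  · rw [hf] at hx ⊢
    exact mem_map_std_of_derivation δ (a m) (e m) (fun i j => hδ (Sum.inl (m, i, j))) _ x hx
  · rw [hg] at hx ⊢
    exact mem_map_std_of_derivation δ (b m) (k m) (fun i j => hδ (Sum.inr (m, i, j))) _ x hx

theorem entries_left {a : Fin 3 → Matrix (Fin r) (Fin r) ℂ}
    {b : Fin 3 → Matrix (Fin q) (Fin q) ℂ} (h : AlgebraicIndependent ℚ (entries a b)) :
    AlgebraicIndependent ℚ fun i : Fin 3 × Fin r × Fin r => a i.1 i.2.1 i.2.2 :=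
  h.comp Sum.inl Sum.inl_injective

theorem entries_right {a : Fin 3 → Matrix (Fin r) (Fin r) ℂ}
    {b : Fin 3 → Matrix (Fin q) (Fin q) ℂ} (h : AlgebraicIndependent ℚ (entries a b)) :
    AlgebraicIndependent ℚ fun i : Fin 3 × Fin q × Fin q => b i.1 i.2.1 i.2.2 :=
  h.comp Sum.inr Sum.inr_injective

theorem isUnit_det_of_algebraicIndependent {a : Fin 3 → Matrix (Fin r) (Fin r) ℂ}
    (h : AlgebraicIndependent ℚ fun i : Fin 3 × Fin r × Fin r => a i.1 i.2.1 i.2.2) (m : Fin 3) :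
    IsUnit (a m).det := by
  have h1 : AlgebraicIndependent ℚ fun i : Fin r × Fin r => a m i.1 i.2 :=
    h.comp (fun i : Fin r × Fin r => ((m, i) : Fin 3 × Fin r × Fin r)) (Prod.mk_right_injective m)
  exact (det_ne_zero_of_algebraicIndependent h1).isUnit

theorem exists_algebraicIndependent (ι : Type) [Fintype ι] :
    ∃ x : ι → ℂ, AlgebraicIndependent ℚ x :=
  (dense_algebraicIndependent ι).nonempty

theorem Generic.perm {f : Fin 3 → Filt T (Fin r → ℂ)} {g : Fin 3 → Filt T (Fin q → ℂ)}
    (h : Generic N M f g) (σ : Equiv.Perm (Fin 3)) :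
    Generic N (fun m => M (σ m)) f (fun m => g (σ m)) := by
  obtain ⟨a, b, hab, hf, hg⟩ := h
  refine ⟨a, fun m => b (σ m), ?_, hf, fun m t => hg (σ m) t⟩
  have := hab.comp (Sum.map id (Prod.map σ id))
    (Function.Injective.sumMap Function.injective_id (σ.injective.prodMap Function.injective_id))
  convert this using 1
  ext i
  rcases i with i | i <;> rfl

theorem finrank_map_std {a : Matrix (Fin r) (Fin r) ℂ} (ha : IsUnit a.det) {k : ℕ} (hk : k ≤ r) :
    finrank ℂ ((std r k).map a.mulVecLin) = k := by
  have hinj : Function.Injective a.mulVecLin :=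
    Matrix.mulVec_injective_iff_isUnit.2 ((Matrix.isUnit_iff_isUnit_det a).2 ha)
  rw [← (Submodule.equivMapOfInjective a.mulVecLin hinj _).finrank_eq, finrank_std hk]

theorem Generic.dim_left {f : Fin 3 → Filt T (Fin r → ℂ)} {g : Fin 3 → Filt T (Fin q → ℂ)}
    (h : Generic N M f g) (hN : ∀ m, IsType T r (N m)) (m : Fin 3) : (f m).dim = N m := by
  obtain ⟨a, b, hab, hf, hg⟩ := h
  ext t
  rw [Filt.dim, hf, finrank_map_std (isUnit_det_of_algebraicIndependent (entries_left hab) m)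
    ((hN m).le t)]

theorem Generic.dim_right {f : Fin 3 → Filt T (Fin r → ℂ)} {g : Fin 3 → Filt T (Fin q → ℂ)}
    (h : Generic N M f g) (hM : ∀ m, IsType T q (M m)) (m : Fin 3) : (g m).dim = M m := by
  obtain ⟨a, b, hab, hf, hg⟩ := h
  ext t
  rw [Filt.dim, hg, finrank_map_std (isUnit_det_of_algebraicIndependent (entries_right hab) m)
    ((hM m).le t)]

theorem exists_generic (hN : ∀ m, IsType T r (N m)) (hM : ∀ m, IsType T q (M m)) :
    ∃ (f : Fin 3 → Filt T (Fin r → ℂ)) (g : Fin 3 → Filt T (Fin q → ℂ)), Generic N M f g := by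
  obtain ⟨x, hx⟩ := exists_algebraicIndependent
    ((Fin 3 × Fin r × Fin r) ⊕ (Fin 3 × Fin q × Fin q))
  let a : Fin 3 → Matrix (Fin r) (Fin r) ℂ := fun m => Matrix.of fun i j => x (Sum.inl (m, i, j))
  let b : Fin 3 → Matrix (Fin q) (Fin q) ℂ := fun m => Matrix.of fun i j => x (Sum.inr (m, i, j))
  have hab : AlgebraicIndependent ℚ (entries a b) := by
    convert hx using 1
    ext i
    rcases i with i | i <;> rfl
  exact ⟨fun m => flag (hN m) (a m) (isUnit_det_of_algebraicIndependent (entries_left hab) m),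
    fun m => flag (hM m) (b m) (isUnit_det_of_algebraicIndependent (entries_right hab) m),
    a, b, hab, fun _ _ => rfl, fun _ _ => rfl⟩

end Generic

section Intersection

/-- Three partial flags, moved by the matrices `a`, have a subspace of dimension `d` meeting
them in prescribed dimensions. -/
def Loc (N N' : Fin 3 → ℕ → ℕ) (d : ℕ) {r : ℕ} (a : Fin 3 → Matrix (Fin r) (Fin r) ℂ) : Prop :=
  ∃ S : Submodule ℂ (Fin r → ℂ), finrank ℂ S = d ∧
    ∀ m t, N' m t ≤ finrank ℂ ↥(S ⊓ (std r (N m t)).map (a m).mulVecLin)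

/-- In every `r`-dimensional space with three filtrations of dimension types at least `N`, there
is a subspace of dimension `d` meeting the filtrations in dimensions at least `N'`. -/
def Int (N N' : Fin 3 → ℕ → ℕ) (d r : ℕ) : Prop :=
  ∀ (V : Type) [AddCommGroup V] [Module ℂ V] [FiniteDimensional ℂ V], finrank ℂ V = r →
    ∀ F : Fin 3 → ℕ → Submodule ℂ V, (∀ m, Monotone (F m)) →
      (∀ m t, N m t ≤ finrank ℂ (F m t)) →
        ∃ S : Submodule ℂ V, finrank ℂ S = d ∧ ∀ m t, N' m t ≤ finrank ℂ ↥(S ⊓ F m t)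

/-- Coordinatewise action of a field automorphism. -/
def semi (r : ℕ) (τ : ℂ ≃+* ℂ) : (Fin r → ℂ) →ₛₗ[(τ : ℂ →+* ℂ)] (Fin r → ℂ) where
  toFun x i := τ (x i)
  map_add' _ _ := by ext i; simp
  map_smul' _ _ := by ext i; simp

theorem semi_injective (r : ℕ) (τ : ℂ ≃+* ℂ) : Function.Injective (semi r τ) := fun x y h =>
  funext fun i => τ.injective (congrFun h i)

instance (τ : ℂ ≃+* ℂ) : RingHomSurjective (τ : ℂ →+* ℂ) := ⟨τ.surjective⟩

theorem finrank_map_semi {r : ℕ} (τ : ℂ ≃+* ℂ) (S : Submodule ℂ (Fin r → ℂ)) :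
    finrank ℂ (S.map (semi r τ)) = finrank ℂ S := by
  let j : S →+ S.map (semi r τ) :=
    { toFun := fun x => ⟨semi r τ x, x, x.2, rfl⟩
      map_zero' := Subtype.ext (map_zero (semi r τ))
      map_add' := fun x y => Subtype.ext (map_add (semi r τ) _ _) }
  have hj : Function.Bijective j := by
    refine ⟨fun x y h => Subtype.ext (semi_injective r τ (congrArg Subtype.val h)), ?_⟩
    rintro ⟨_, x, hx, rfl⟩
    exact ⟨⟨x, hx⟩, rfl⟩
  have := rank_eq_of_equiv_equiv (R := ℂ) (R' := ℂ) τ (AddEquiv.ofBijective j hj) τ.bijective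
    (fun c m => Subtype.ext (map_smulₛₗ (semi r τ) c (m : Fin r → ℂ)))
  rw [finrank, finrank, this]

theorem Loc.map {N N' : Fin 3 → ℕ → ℕ} {d r : ℕ} {a : Fin 3 → Matrix (Fin r) (Fin r) ℂ}
    (h : Loc N N' d a) (τ : ℂ ≃+* ℂ) : Loc N N' d fun m => (a m).map τ := by
  obtain ⟨S, hS, h⟩ := h
  refine ⟨S.map (semi r τ), by rw [finrank_map_semi, hS], fun m t => (h m t).trans ?_⟩
  rw [← finrank_map_semi τ]
  refine Submodule.finrank_mono ?_
  rintro _ ⟨x, ⟨hx, y, hy, hxy⟩, rfl⟩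
  refine ⟨⟨x, hx, rfl⟩, semi r τ y, fun i hi => ?_, ?_⟩
  · change τ (y i) = 0
    rw [hy i hi, map_zero]
  · rw [← hxy]
    ext i
    simp [semi, Matrix.mulVec, dotProduct]

/-- Component of a frame transverse to a moved coordinate subspace. -/
noncomputable def transv (k : ℕ) {r d : ℕ} (a : Matrix (Fin r) (Fin r) ℂ) (s : Matrix (Fin r) (Fin d) ℂ) :
    (Fin d → ℂ) →ₗ[ℂ] ({i : Fin r // k ≤ i} → ℂ) :=
  LinearMap.funLeft ℂ ℂ Subtype.val ∘ₗ (a.adjugate * s).mulVecLin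

theorem finrank_inf_map_std {k r d : ℕ} {a : Matrix (Fin r) (Fin r) ℂ} (ha : IsUnit a.det)
    {s : Matrix (Fin r) (Fin d) ℂ} (hs : Function.Injective s.mulVecLin) :
    finrank ℂ ↥(LinearMap.range s.mulVecLin ⊓ (std r k).map a.mulVecLin) +
      finrank ℂ (LinearMap.range (transv k a s)) = d := by
  have h1 := LinearMap.finrank_range_add_finrank_ker (transv k a s)
  rw [finrank_fin_fun] at h1
  have h2 : LinearMap.ker (transv k a s) =
      ((std r k).map a.mulVecLin).comap s.mulVecLin := by
    rw [transv, LinearMap.ker_comp, ← std_eq_ker]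
    ext y
    rw [Submodule.mem_comap, Submodule.mem_comap, Matrix.mulVecLin_apply, ← Matrix.mulVec_mulVec]
    constructor
    · intro h
      refine ⟨(a.det)⁻¹ • (a.adjugate.mulVec (s.mulVec y)), Submodule.smul_mem _ _ h, ?_⟩
      rw [map_smul, Matrix.mulVecLin_apply, Matrix.mulVec_mulVec, Matrix.mul_adjugate,
        Matrix.smul_mulVec, Matrix.one_mulVec, smul_smul, inv_mul_cancel₀ ha.ne_zero, one_smul,
        Matrix.mulVecLin_apply]
    · rintro ⟨z, hz, hzy⟩
      rw [← Matrix.mulVecLin_apply s, ← hzy, Matrix.mulVecLin_apply, Matrix.mulVec_mulVec,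
        Matrix.adjugate_mul, Matrix.smul_mulVec, Matrix.one_mulVec]
      exact Submodule.smul_mem _ _ hz
  rw [← Submodule.map_comap_eq, ← h2, ← (Submodule.equivMapOfInjective _ hs _).finrank_eq]
  omega

theorem isClosed_rank_transv (k c r d : ℕ) :
    IsClosed {x : Matrix (Fin r) (Fin r) ℂ × Matrix (Fin r) (Fin d) ℂ |
      finrank ℂ (LinearMap.range (transv k x.1 x.2)) ≤ c} := by
  let L : Matrix (Fin r) (Fin d) ℂ →ₗ[ℂ] ((Fin d → ℂ) →L[ℂ] ({i : Fin r // k ≤ i} → ℂ)) :=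
    LinearMap.toContinuousLinearMap.toLinearMap ∘ₗ
      LinearMap.compRight ℂ (LinearMap.funLeft ℂ ℂ Subtype.val) ∘ₗ
      (Matrix.toLin' (R := ℂ)).toLinearMap
  have hL : Continuous L := LinearMap.continuous_of_finiteDimensional L
  have hc : Continuous fun x : Matrix (Fin r) (Fin r) ℂ × Matrix (Fin r) (Fin d) ℂ =>
      x.1.adjugate * x.2 := by fun_prop
  have ho := (isOpen_setOfPred_nat_le_rank (𝕜 := ℂ) (E := Fin d → ℂ)
    (F := {i : Fin r // k ≤ i} → ℂ) (c + 1)).preimage (hL.comp hc)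
  rw [← isOpen_compl_iff]
  convert ho using 1
  ext x
  simp only [Set.mem_compl_iff, Set.mem_ofPred_eq, not_le, Set.mem_preimage]
  have : ((L (x.1.adjugate * x.2) : (Fin d → ℂ) →L[ℂ] ({i : Fin r // k ≤ i} → ℂ)) :
      (Fin d → ℂ) →ₗ[ℂ] ({i : Fin r // k ≤ i} → ℂ)) = transv k x.1 x.2 := rfl
  rw [Function.comp_apply, this, LinearMap.rank, ← finrank_eq_rank, Nat.cast_le]
  exact Nat.lt_iff_add_one_le

/-- Orthonormal frames. -/
def frames (r d : ℕ) : Set (Matrix (Fin r) (Fin d) ℂ) := {s | s.conjTranspose * s = 1}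

theorem isCompact_frames (r d : ℕ) : IsCompact (frames r d) := by
  have h1 : IsCompact (Set.univ.pi fun _ : Fin r => Set.univ.pi fun _ : Fin d =>
      Metric.closedBall (0 : ℂ) 1) :=
    isCompact_univ_pi fun _ => isCompact_univ_pi fun _ => isCompact_closedBall _ _
  refine h1.of_isClosed_subset ?_ ?_
  · exact isClosed_eq (by fun_prop) continuous_const
  · intro (s : Matrix (Fin r) (Fin d) ℂ) hs i _ j _
    rw [mem_closedBall_zero_iff]
    have h2 : (s.conjTranspose * s) j j = (1 : Matrix (Fin d) (Fin d) ℂ) j j :=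
      congrFun (congrFun hs j) j
    rw [Matrix.mul_apply, Matrix.one_apply_eq] at h2
    have h3 : ∀ i, s.conjTranspose j i * s i j = ((‖s i j‖ ^ 2 : ℝ) : ℂ) := by
      intro i
      rw [Matrix.conjTranspose_apply, Complex.star_def, Complex.conj_mul']
      push_cast
      rfl
    simp only [h3] at h2
    have h4 : ∑ i, ‖s i j‖ ^ 2 = 1 := by exact_mod_cast h2
    have h5 := Finset.single_le_sum (f := fun i => ‖s i j‖ ^ 2) (fun i _ => by positivity)
      (Finset.mem_univ i)
    simp only [h4] at h5
    exact (sq_le_one_iff₀ (norm_nonneg _)).1 h5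

theorem frames_injective {r d : ℕ} {s : Matrix (Fin r) (Fin d) ℂ} (hs : s ∈ frames r d) :
    Function.Injective s.mulVecLin := by
  intro x y h
  have := congrArg (s.conjTranspose.mulVec) h
  simpa [Matrix.mulVec_mulVec, show s.conjTranspose * s = 1 from hs] using this

theorem exists_frame {r : ℕ} (S : Submodule ℂ (Fin r → ℂ)) :
    ∃ s ∈ frames r (finrank ℂ S), LinearMap.range s.mulVecLin = S := by
  let e := (WithLp.linearEquiv 2 ℂ (Fin r → ℂ)).symm
  let S' : Submodule ℂ (EuclideanSpace ℂ (Fin r)) := S.map e.toLinearMap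
  have hd : finrank ℂ S' = finrank ℂ S := LinearEquiv.finrank_map_eq e S
  let b := (stdOrthonormalBasis ℂ S').reindex (finCongr hd)
  let s : Matrix (Fin r) (Fin (finrank ℂ S)) ℂ := Matrix.of fun i j => (b j : EuclideanSpace ℂ (Fin r)) i
  have hs : s ∈ frames r (finrank ℂ S) := by
    change s.conjTranspose * s = 1
    ext j k
    have h1 := (orthonormal_iff_ite.1 b.orthonormal) j k
    rw [Matrix.mul_apply, Matrix.one_apply, ← h1, Submodule.coe_inner, PiLp.inner_apply]
    refine Finset.sum_congr rfl fun i _ => ?_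
    simp [s, mul_comm]
  refine ⟨s, hs, ?_⟩
  refine Submodule.eq_of_le_of_finrank_eq ?_ ?_
  · rw [Matrix.range_mulVecLin, Submodule.span_le]
    rintro _ ⟨j, rfl⟩
    obtain ⟨x, hx, hxe⟩ := (b j).2
    have : s.col j = x := by
      ext i
      simp only [s, Matrix.col, Matrix.of_apply, Matrix.transpose_apply]
      rw [← hxe]
      rfl
    rw [this]
    exact hx
  · rw [LinearMap.finrank_range_of_inj (frames_injective hs), finrank_fin_fun]

theorem loc_iff {N N' : Fin 3 → ℕ → ℕ} {d r : ℕ} {a : Fin 3 → Matrix (Fin r) (Fin r) ℂ}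
    (ha : ∀ m, IsUnit (a m).det) : Loc N N' d a ↔ ∃ s ∈ frames r d, ∀ m t,
      N' m t + finrank ℂ (LinearMap.range (transv (N m t) (a m) s)) ≤ d := by
  constructor
  · rintro ⟨S, rfl, h⟩
    obtain ⟨s, hs, hsS⟩ := exists_frame S
    refine ⟨s, hs, fun m t => ?_⟩
    have h1 := finrank_inf_map_std (k := N m t) (ha m) (frames_injective hs)
    rw [hsS] at h1
    have := h m t
    omega
  · rintro ⟨s, hs, h⟩
    refine ⟨LinearMap.range s.mulVecLin, ?_, fun m t => ?_⟩
    · rw [LinearMap.finrank_range_of_inj (frames_injective hs), finrank_fin_fun]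
    · have h1 := finrank_inf_map_std (k := N m t) (ha m) (frames_injective hs)
      have := h m t
      omega

theorem isClosed_frame_condition (N N' : Fin 3 → ℕ → ℕ) (d r : ℕ) :
    IsClosed {a : Fin 3 → Matrix (Fin r) (Fin r) ℂ | ∃ s ∈ frames r d, ∀ m t,
      N' m t + finrank ℂ (LinearMap.range (transv (N m t) (a m) s)) ≤ d} := by
  have : CompactSpace (frames r d) := isCompact_iff_compactSpace.1 (isCompact_frames r d)
  have h1 : IsClosed {x : (Fin 3 → Matrix (Fin r) (Fin r) ℂ) × frames r d | ∀ m t,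
      N' m t + finrank ℂ (LinearMap.range (transv (N m t) (x.1 m) x.2.1)) ≤ d} := by
    have hcl : ∀ m t, IsClosed {x : (Fin 3 → Matrix (Fin r) (Fin r) ℂ) × frames r d |
        N' m t + finrank ℂ (LinearMap.range (transv (N m t) (x.1 m) x.2.1)) ≤ d} := by
      intro m t
      rcases le_or_gt (N' m t) d with h | h
      · have h2 := (isClosed_rank_transv (N m t) (d - N' m t) r d).preimage
          (f := fun x : (Fin 3 → Matrix (Fin r) (Fin r) ℂ) × frames r d =>
            (x.1 m, (x.2 : Matrix (Fin r) (Fin d) ℂ))) (by fun_prop)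
        convert h2 using 1
        ext x
        simp only [Set.mem_ofPred_eq, Set.mem_preimage]
        omega
      · convert isClosed_empty using 1
        ext x
        simp only [Set.mem_ofPred_eq, Set.mem_empty_iff_false, iff_false]
        omega
    simp only [Set.ofPred_forall]
    exact isClosed_iInter fun m => isClosed_iInter fun t => hcl m t
  have h2 := isClosedMap_fst_of_compactSpace _ h1
  convert h2 using 1
  ext a
  constructor
  · rintro ⟨s, hs, h⟩
    exact ⟨(a, ⟨s, hs⟩), h, rfl⟩
  · rintro ⟨⟨a, s⟩, h, rfl⟩
    exact ⟨s, s.2, h⟩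

/-- One generic triple of flags suffices to conclude for all triples of flags. -/
theorem loc_of_generic {N N' : Fin 3 → ℕ → ℕ} {d r : ℕ}
    {a₀ : Fin 3 → Matrix (Fin r) (Fin r) ℂ}
    (h₀ : AlgebraicIndependent ℚ fun i : Fin 3 × Fin r × Fin r => a₀ i.1 i.2.1 i.2.2)
    (h : Loc N N' d a₀) {a : Fin 3 → Matrix (Fin r) (Fin r) ℂ} (ha : ∀ m, IsUnit (a m).det) :
    Loc N N' d a := by
  rw [loc_iff ha]
  let Z := {x : Fin 3 × Fin r × Fin r → ℂ | ∃ s ∈ frames r d, ∀ m t,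
    N' m t + finrank ℂ (LinearMap.range
      (transv (N m t) (Matrix.of fun i j => x (m, i, j)) s)) ≤ d}
  have hZ : IsClosed Z := by
    refine (isClosed_frame_condition N N' d r).preimage
      (f := fun x : Fin 3 × Fin r × Fin r → ℂ => fun m => Matrix.of fun i j => x (m, i, j)) ?_
    refine continuous_pi fun m => continuous_matrix fun i j => ?_
    exact continuous_apply (A := fun _ => ℂ) (m, i, j)
  have hsub : {x : Fin 3 × Fin r × Fin r → ℂ | AlgebraicIndependent ℚ x} ⊆ Z := by
    intro x hx
    obtain ⟨τ, hτ⟩ := exists_ringEquiv_of_algebraicIndependent h₀ hx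
    have h1 : (fun m => (a₀ m).map τ) = fun m => Matrix.of fun i j => x (m, i, j) := by
      ext m i j
      exact hτ (m, i, j)
    have h2 := h.map τ
    rw [h1] at h2
    exact (loc_iff fun m => isUnit_det_of_algebraicIndependent
      (a := fun m => Matrix.of fun i j => x (m, i, j)) hx m).1 h2
  have : (fun i : Fin 3 × Fin r × Fin r => a i.1 i.2.1 i.2.2) ∈ Z := by
    have h1 := (dense_algebraicIndependent (Fin 3 × Fin r × Fin r)).closure_eq
    exact hZ.closure_subset_iff.2 hsub (h1 ▸ Set.mem_univ _)
  exact this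

theorem exists_linearIndependent_mem {V : Type} [AddCommGroup V] [Module ℂ V]
    [FiniteDimensional ℂ V] : ∀ (r : ℕ) (E : ℕ → Submodule ℂ V),
      (∀ i < r, i + 1 ≤ finrank ℂ (E i)) →
      ∃ v : Fin r → V, LinearIndependent ℂ v ∧ ∀ i : Fin r, v i ∈ E i := by
  intro r
  induction r with
  | zero => exact fun E _ => ⟨Fin.elim0, linearIndependent_empty_type, fun i => i.elim0⟩
  | succ r ih =>
    intro E hE
    obtain ⟨v, hv, hvE⟩ := ih E fun i hi => hE i (by omega)
    obtain ⟨x, hx, hxv⟩ : ∃ x ∈ E r, x ∉ Submodule.span ℂ (Set.range v) := by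
      by_contra! hcon
      have h1 := Submodule.finrank_mono (show E r ≤ Submodule.span ℂ (Set.range v) from hcon)
      have h2 := finrank_range_le_card (R := ℂ) v
      have h3 := hE r (by omega)
      rw [Fintype.card_fin] at h2
      have h4 : finrank ℂ (Submodule.span ℂ (Set.range v)) ≤ r := h2
      omega
    refine ⟨Fin.snoc v x, linearIndependent_finSnoc.2 ⟨hv, hxv⟩, fun i => ?_⟩
    refine Fin.lastCases ?_ (fun j => ?_) i
    · simpa using hx
    · simpa using hvE j

theorem exists_adapted {r : ℕ} (N : ℕ → ℕ) (F : ℕ → Submodule ℂ (Fin r → ℂ)) (hF : Monotone F)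
    (hN : ∀ t, N t ≤ finrank ℂ (F t)) :
    ∃ a : Matrix (Fin r) (Fin r) ℂ, IsUnit a.det ∧
      ∀ t, (std r (N t)).map a.mulVecLin ≤ F t := by
  classical
  let E : ℕ → Submodule ℂ (Fin r → ℂ) := fun i =>
    if h : ∃ t, i < N t then F (Nat.find h) else ⊤
  obtain ⟨v, hv, hvE⟩ := exists_linearIndependent_mem r E fun i hi => by
    by_cases h : ∃ t, i < N t
    · have h1 : E i = F (Nat.find h) := dif_pos h
      rw [h1]
      exact (Nat.find_spec h).trans_le (hN _)
    · have h1 : E i = ⊤ := dif_neg h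
      rw [h1, finrank_top, finrank_fin_fun]
      omega
  refine ⟨Matrix.of fun i j => v j i, ?_, fun t => ?_⟩
  · rw [← Matrix.isUnit_iff_isUnit_det, ← Matrix.linearIndependent_cols_iff_isUnit]
    exact hv
  · rintro _ ⟨x, hx, rfl⟩
    have : (Matrix.of fun i j => v j i).mulVecLin x = ∑ j, x j • v j := by
      ext i
      simp [Matrix.mulVec, dotProduct, mul_comm]
    rw [this]
    refine Submodule.sum_mem _ fun j _ => ?_
    rcases Nat.lt_or_ge j (N t) with h | h
    · refine Submodule.smul_mem _ _ (?_ : v j ∈ F t)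
      have hex : ∃ t, (j : ℕ) < N t := ⟨t, h⟩
      have h1 : E j = F (Nat.find hex) := dif_pos hex
      exact hF (Nat.find_min' hex h) (h1 ▸ hvE j)
    · rw [hx j h, zero_smul]
      exact zero_mem _

theorem int_of_loc {N N' : Fin 3 → ℕ → ℕ} {d r : ℕ}
    (h : ∀ a : Fin 3 → Matrix (Fin r) (Fin r) ℂ, (∀ m, IsUnit (a m).det) → Loc N N' d a) :
    Int N N' d r := by
  intro V _ _ _ hV F hF hN
  let e : V ≃ₗ[ℂ] (Fin r → ℂ) := LinearEquiv.ofFinrankEq _ _ (by rw [hV, finrank_fin_fun])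
  choose a ha haF using fun m => exists_adapted (N m) (fun t => (F m t).map e.toLinearMap)
    (fun _ _ h => Submodule.map_mono (hF m h))
    (fun t => by rw [LinearEquiv.finrank_map_eq]; exact hN m t)
  obtain ⟨S, hS, hSF⟩ := h a ha
  refine ⟨S.map e.symm.toLinearMap, by rw [LinearEquiv.finrank_map_eq, hS], fun m t => ?_⟩
  refine (hSF m t).trans ?_
  rw [← LinearEquiv.finrank_map_eq e.symm]
  refine Submodule.finrank_mono ?_
  rintro _ ⟨x, ⟨hx, hx'⟩, rfl⟩
  refine ⟨⟨x, hx, rfl⟩, ?_⟩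
  obtain ⟨y, hy, rfl⟩ := haF m t hx'
  simpa using hy

theorem int_of_generic {N N' : Fin 3 → ℕ → ℕ} {d r : ℕ}
    {a₀ : Fin 3 → Matrix (Fin r) (Fin r) ℂ}
    (h₀ : AlgebraicIndependent ℚ fun i : Fin 3 × Fin r × Fin r => a₀ i.1 i.2.1 i.2.2)
    (h : Loc N N' d a₀) : Int N N' d r :=
  int_of_loc fun _ ha => loc_of_generic h₀ h ha

end Intersection

section Comparison

variable {T : ℕ} {V V' Q Q' : Type} [AddCommGroup V] [Module ℂ V] [AddCommGroup V'] [Module ℂ V']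
  [AddCommGroup Q] [Module ℂ Q] [AddCommGroup Q'] [Module ℂ Q']
  [FiniteDimensional ℂ V] [FiniteDimensional ℂ V'] [FiniteDimensional ℂ Q]
  [FiniteDimensional ℂ Q']

omit [FiniteDimensional ℂ V] [FiniteDimensional ℂ V'] [FiniteDimensional ℂ Q]
  [FiniteDimensional ℂ Q'] in
theorem chiF_congr (f : Fin 3 → Filt T V) (f' : Fin 3 → Filt T V') (g : Fin 3 → Filt T Q)
    (g' : Fin 3 → Filt T Q') (hf : ∀ m, (f m).dim = (f' m).dim) (hg : ∀ m, (g m).dim = (g' m).dim) :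
    chiF f g = chiF f' g' := by
  have h1 : finrank ℂ V = finrank ℂ V' := by
    rw [← (f 0).dim_top, ← (f' 0).dim_top, hf]
  have h2 : finrank ℂ Q = finrank ℂ Q' := by
    rw [← (g 0).dim_top, ← (g' 0).dim_top, hg]
  simp only [chiF, hf, hg, h1, h2]

omit [FiniteDimensional ℂ V] [FiniteDimensional ℂ V'] in
theorem chiF_anti_of_finrank_eq (f : Fin 3 → Filt T V) (f' : Fin 3 → Filt T V')
    (g : Fin 3 → Filt T Q) (hV : finrank ℂ V = finrank ℂ V')
    (h : ∀ m t, (f m).dim t ≤ (f' m).dim t) : chiF f' g ≤ chiF f g := by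
  rw [chiF, chiF, hV]
  refine sub_le_sub_right (Finset.sum_le_sum fun m _ => ?_) _
  exact eul_anti T _ _ _ (f m).dim_zero (f' m).dim_zero (by
    show (f m).dim T = (f' m).dim T
    rw [Filt.dim_top, Filt.dim_top, hV])
    (g m).dim_mono (h m)

omit [FiniteDimensional ℂ Q] in
theorem finrank_Hom3_le (f : Fin 3 → Filt T V) (g : Fin 3 → Filt T Q) (g' : Fin 3 → Filt T Q')
    (ι : Q →ₗ[ℂ] Q') (hι : Function.Injective ι) (h : ∀ m t, ∀ x ∈ (g m).F t, ι x ∈ (g' m).F t) :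
    finrank ℂ (Hom3 f g) ≤ finrank ℂ (Hom3 f g') := by
  have hinj : Function.Injective (LinearMap.compRight ℂ (M := V) ι) := fun φ ψ h =>
    LinearMap.ext fun x => hι (LinearMap.congr_fun h x)
  rw [(Submodule.equivMapOfInjective _ hinj (Hom3 f g)).finrank_eq]
  refine Submodule.finrank_mono ?_
  rintro _ ⟨φ, hφ, rfl⟩
  rw [mem_Hom3]
  exact fun m t x hx => h m t _ (mem_Hom3.1 hφ m t x hx)

omit [FiniteDimensional ℂ V] in
theorem Filt.dim_sub_map_subtype (f : Filt T V) (S : Submodule ℂ V) (U : Submodule ℂ S) (t : ℕ) :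
    (f.sub (U.map S.subtype)).dim t = ((f.sub S).sub U).dim t := by
  rw [dim_sub, dim_sub, (Submodule.equivMapOfInjective _ S.injective_subtype _).finrank_eq]
  suffices U.map S.subtype ⊓ f.F t = (U ⊓ (f.sub S).F t).map S.subtype by rw [this]
  ext x
  constructor
  · rintro ⟨⟨y, hy, rfl⟩, hx⟩
    exact ⟨y, ⟨hy, hx⟩, rfl⟩
  · rintro ⟨y, ⟨hy, hy'⟩, rfl⟩
    exact ⟨⟨y, hy, rfl⟩, hy'⟩

end Comparison

section HornInequalities

variable {T r q : ℕ} {N M : Fin 3 → ℕ → ℕ}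

theorem Generic.exists_left {f : Fin 3 → Filt T (Fin r → ℂ)} {g : Fin 3 → Filt T (Fin q → ℂ)}
    (h : Generic N M f g) {s : ℕ} {N' : Fin 3 → ℕ → ℕ} (hN' : ∀ m, IsType T s (N' m)) :
    ∃ a : Fin 3 → Filt T (Fin s → ℂ), Generic N' M a g := by
  obtain ⟨a₀, b, hab, -, hg⟩ := h
  obtain ⟨x, hx⟩ := exists_algebraicIndependent
    ((Fin 3 × Fin s × Fin s) ⊕ (Fin 3 × Fin q × Fin q))
  obtain ⟨τ, hτ⟩ := exists_ringEquiv_of_algebraicIndependent (hx.comp Sum.inr Sum.inr_injective)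
    (entries_right hab)
  let a : Fin 3 → Matrix (Fin s) (Fin s) ℂ := fun m =>
    Matrix.of fun i j => τ (x (Sum.inl (m, i, j)))
  have hab' : AlgebraicIndependent ℚ (entries a b) := by
    have h1 := hx.map' (f := (τ : ℂ →+* ℂ).toRatAlgHom) τ.injective
    convert h1 using 1
    ext i
    rcases i with i | i
    · rfl
    · exact (hτ i).symm
  exact ⟨fun m => flag (hN' m) (a m) (isUnit_det_of_algebraicIndependent (entries_left hab') m),
    a, b, hab', fun _ _ => rfl, hg⟩

variable {V : Type} [AddCommGroup V] [Module ℂ V] [FiniteDimensional ℂ V]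

/-- Positions of subspaces for a generic triple of flags occur for every triple of flags of the
same type. -/
theorem Generic.exists_sub {f : Fin 3 → Filt T (Fin r → ℂ)} {g : Fin 3 → Filt T (Fin q → ℂ)}
    (h : Generic N M f g) (f' : Fin 3 → Filt T V) (hV : finrank ℂ V = r)
    (hN : ∀ m t, N m t ≤ (f' m).dim t) (S : Submodule ℂ (Fin r → ℂ)) :
    ∃ U : Submodule ℂ V, finrank ℂ U = finrank ℂ S ∧
      ∀ m t, ((f m).sub S).dim t ≤ ((f' m).sub U).dim t := by
  obtain ⟨a, b, hab, hf, -⟩ := h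
  have h1 : Loc N (fun m t => ((f m).sub S).dim t) (finrank ℂ S) a := by
    refine ⟨S, rfl, fun m t => ?_⟩
    rw [← hf, ← Filt.dim_sub]
  obtain ⟨U, hU, hU'⟩ := int_of_generic (entries_left hab) h1 V hV (fun m => (f' m).F)
    (fun m => (f' m).mono) hN
  refine ⟨U, hU, fun m t => ?_⟩
  rw [(f' m).dim_sub]
  exact hU' m t

theorem Generic.exists_nonneg {f : Fin 3 → Filt T (Fin r → ℂ)} {g : Fin 3 → Filt T (Fin q → ℂ)}
    (h : Generic N M f g) (f' : Fin 3 → Filt T V)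
    (hpos : ∀ S : Submodule ℂ V, 0 ≤ chiF (fun m => (f' m).sub S) g)
    (S : Submodule ℂ V) :
    ∃ a : Fin 3 → Filt T (Fin (finrank ℂ S) → ℂ),
      Generic (fun m => ((f' m).sub S).dim) M a g ∧
      (∀ m, (a m).dim = ((f' m).sub S).dim) ∧
      ∀ U : Submodule ℂ (Fin (finrank ℂ S) → ℂ), 0 ≤ chiF (fun m => (a m).sub U) g := by
  have hty := fun m => ((f' m).sub S).isType
  obtain ⟨a, ha⟩ := h.exists_left hty
  refine ⟨a, ha, ha.dim_left hty, fun U => ?_⟩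
  obtain ⟨U', hU', hle⟩ := ha.exists_sub (fun m => (f' m).sub S) rfl (fun _ _ => le_rfl) U
  refine (hpos (U'.map S.subtype)).trans
    (le_trans (chiF_congr _ _ _ _ (fun m => funext fun t => (f' m).dim_sub_map_subtype S U' t)
      fun _ => rfl).le ?_)
  exact chiF_anti_of_finrank_eq _ _ _ hU'.symm hle

theorem Generic.surj_of_nonneg : ∀ {r : ℕ} {N : Fin 3 → ℕ → ℕ} {f : Fin 3 → Filt T (Fin r → ℂ)}
    {g : Fin 3 → Filt T (Fin q → ℂ)}, Generic N M f g →
    (∀ S : Submodule ℂ (Fin r → ℂ), 0 ≤ chiF (fun m => (f m).sub S) g) → Surj f g := by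
  intro r
  induction r using Nat.strong_induction_on with
  | _ r ih =>
  intro N f g h hpos
  obtain ⟨φ, hφ, hle⟩ := h.movable.exists_decomposition
  rw [surj_iff]
  refine hle.trans ?_
  have h1 := chiF_eq_add_ker f g φ.rangeRestrict (LinearMap.surjective_rangeRestrict φ)
  rw [LinearMap.ker_rangeRestrict] at h1
  rw [h1]
  change _ ≤ _ + chiF (onRange f φ) g
  refine add_le_add_left ?_ _
  set S := LinearMap.ker φ with hS
  rcases (Submodule.finrank_le S).lt_or_eq with hlt | heq
  · rw [finrank_fin_fun] at hlt
    obtain ⟨a, ha, hdim, hapos⟩ := h.exists_nonneg f hpos S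
    have hsurj := ih _ hlt ha hapos
    rw [← chiF_congr a (fun m => (f m).sub S) (onRange f φ) _ hdim fun _ => rfl,
      ← chiF_congr a (fun m => (f m).sub S) g _ hdim fun _ => rfl, ← hsurj.finrank_eq]
    refine (chiF_le _ _).trans ?_
    exact_mod_cast finrank_Hom3_le a (onRange f φ) g (LinearMap.range φ).subtype
      (Submodule.injective_subtype _) fun m t x hx => by
        obtain ⟨y, hy, hyx⟩ := mem_onRange.1 hx
        rw [Submodule.subtype_apply, ← hyx]
        exact mem_Hom3.1 hφ m t y hy
  · have htop : S = ⊤ := Submodule.eq_top_of_finrank_eq heq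
    have h0 : φ = 0 := LinearMap.ker_eq_top.1 htop
    have h2 : chiF (fun m => (f m).sub S) (onRange f φ) = 0 := by
      have h3 : finrank ℂ (LinearMap.range φ) = 0 := by rw [h0, LinearMap.range_zero, finrank_bot]
      have h4 : ∀ m t, (onRange f φ m).dim t = 0 := fun m t =>
        Nat.le_zero.1 ((Submodule.finrank_le _).trans h3.le)
      simp [chiF, chi, eul, h3, h4]
    rw [h2]
    exact hpos S

/-- If the Euler characteristics of all subobjects are nonnegative, the type of each subobject
has a representative with vanishing obstruction. -/
theorem Generic.exists_surj {f : Fin 3 → Filt T (Fin r → ℂ)} {g : Fin 3 → Filt T (Fin q → ℂ)}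
    (h : Generic N M f g) (hpos : ∀ S : Submodule ℂ (Fin r → ℂ), 0 ≤ chiF (fun m => (f m).sub S) g)
    (S : Submodule ℂ (Fin r → ℂ)) :
    ∃ a : Fin 3 → Filt T (Fin (finrank ℂ S) → ℂ), (∀ m, (a m).dim = ((f m).sub S).dim) ∧
      Surj a g := by
  obtain ⟨a, ha, hdim, hapos⟩ := h.exists_nonneg f hpos S
  exact ⟨a, hdim, ha.surj_of_nonneg hapos⟩

end HornInequalities

section Tangent

/-- Endomorphisms preserving each subspace of a family. -/
def stabilizer {W : Type} [AddCommGroup W] [Module ℂ W] [TopologicalSpace W] {ι : Type}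
    (F : ι → Submodule ℂ W) [IsTopologicalAddGroup W] [ContinuousConstSMul ℂ W] :
    Submodule ℂ (W →L[ℂ] W) where
  carrier := {φ | ∀ t, ∀ x ∈ F t, φ x ∈ F t}
  add_mem' hφ hψ t x hx := add_mem (hφ t x hx) (hψ t x hx)
  zero_mem' _ _ _ := zero_mem _
  smul_mem' c _ hφ t x hx := Submodule.smul_mem _ c (hφ t x hx)

theorem hasStrictFDerivAt_mul_mul {X A : Type} [NormedAddCommGroup X] [NormedSpace ℂ X]
    [NormedRing A] [NormedAlgebra ℂ A] (L₁ L₂ L₃ : X →L[ℂ] A) :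
    HasStrictFDerivAt (fun x => (1 + L₁ x) * (1 + L₂ x) * (1 + L₃ x)) (L₁ + L₂ + L₃) 0 := by
  have e1 := (L₁.hasStrictFDerivAt (x := 0)).const_add (1 : A)
  have e2 := (L₂.hasStrictFDerivAt (x := 0)).const_add (1 : A)
  have e3 := (L₃.hasStrictFDerivAt (x := 0)).const_add (1 : A)
  refine ((e1.mul' e2).mul' e3).congr_fderiv ?_
  ext x
  simp
  abel

theorem one_add_mul_mul_zero {X A : Type} [NormedAddCommGroup X] [NormedSpace ℂ X]
    [NormedRing A] [NormedAlgebra ℂ A] (L₁ L₂ L₃ : X →L[ℂ] A) :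
    (1 + L₁ 0) * (1 + L₂ 0) * (1 + L₃ 0) = 1 := by
  simp

open Filter Topology in
theorem eventually_isUnit_one_add {X A : Type} [NormedAddCommGroup X] [NormedSpace ℂ X]
    [NormedRing A] [NormedAlgebra ℂ A] [CompleteSpace A] (L : X →L[ℂ] A) :
    ∀ᶠ x in 𝓝 (0 : X), IsUnit (1 + L x) := by
  have h1 : Tendsto (fun x => 1 + L x) (𝓝 0) (𝓝 1) := by
    have : Continuous fun x => 1 + L x := by fun_prop
    simpa using this.tendsto 0
  exact h1.eventually (Units.isOpen.mem_nhds isUnit_one)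

open Filter Topology in
/-- If three triples of tangent directions span, then every triple of operators close to the
identity factors accordingly. -/
theorem eventually_exists_factorization {W : Type} [NormedAddCommGroup W] [NormedSpace ℂ W]
    [FiniteDimensional ℂ W] (Y : Submodule ℂ (W →L[ℂ] W)) (C : Fin 3 → Submodule ℂ (W →L[ℂ] W))
    (h : ∀ z : Fin 3 → W →L[ℂ] W, ∃ u, ∀ m, ∃ y ∈ Y, ∃ c ∈ C m, z m = u + y + c) :
    ∀ᶠ z : Fin 3 → W →L[ℂ] W in 𝓝 1, ∃ u, IsUnit u ∧ ∀ m, ∃ y ∈ Y, ∃ c ∈ C m,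
      IsUnit (1 + y) ∧ IsUnit (1 + c) ∧ z m = u * (1 + y) * (1 + c) := by
  have : CompleteSpace W := FiniteDimensional.complete ℂ W
  have : FiniteDimensional ℂ (W →L[ℂ] W) := inferInstance
  let X := (W →L[ℂ] W) × (Fin 3 → Y) × (∀ m, C m)
  have : CompleteSpace X := FiniteDimensional.complete ℂ X
  let L₁ : X →L[ℂ] (W →L[ℂ] W) := ContinuousLinearMap.fst ℂ _ _
  let L₂ : Fin 3 → X →L[ℂ] (W →L[ℂ] W) := fun m =>
    Y.subtypeL.comp ((ContinuousLinearMap.proj m).comp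
      ((ContinuousLinearMap.fst ℂ _ _).comp (ContinuousLinearMap.snd ℂ _ _)))
  let L₃ : Fin 3 → X →L[ℂ] (W →L[ℂ] W) := fun m =>
    (C m).subtypeL.comp ((ContinuousLinearMap.proj m).comp
      ((ContinuousLinearMap.snd ℂ _ _).comp (ContinuousLinearMap.snd ℂ _ _)))
  let Ψ : X → Fin 3 → W →L[ℂ] W := fun x m => (1 + L₁ x) * (1 + L₂ m x) * (1 + L₃ m x)
  let D : X →L[ℂ] (Fin 3 → W →L[ℂ] W) := ContinuousLinearMap.pi fun m => L₁ + L₂ m + L₃ m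
  have hD : HasStrictFDerivAt Ψ D 0 := by
    refine hasStrictFDerivAt_pi.2 fun m => ?_
    exact hasStrictFDerivAt_mul_mul L₁ (L₂ m) (L₃ m)
  have hsurj : LinearMap.range (D : X →ₗ[ℂ] (Fin 3 → W →L[ℂ] W)) = ⊤ := by
    rw [LinearMap.range_eq_top]
    intro z
    obtain ⟨u, hu⟩ := h z
    choose y hy c hc hz using hu
    exact ⟨(u, fun m => ⟨y m, hy m⟩, fun m => ⟨c m, hc m⟩), funext fun m => (hz m).symm⟩
  have hmap := hD.map_nhds_eq_of_surj hsurj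
  have h0 : Ψ 0 = 1 := by
    funext m
    exact one_add_mul_mul_zero L₁ (L₂ m) (L₃ m)
  rw [h0] at hmap
  rw [← hmap, eventually_map]
  filter_upwards [eventually_isUnit_one_add L₁, eventually_all.2 fun m => eventually_isUnit_one_add (L₂ m),
    eventually_all.2 fun m => eventually_isUnit_one_add (L₃ m)] with x h1 h2 h3
  exact ⟨1 + L₁ x, h1, fun m => ⟨L₂ m x, (x.2.1 m).2, L₃ m x, (x.2.2 m).2, h2 m, h3 m, rfl⟩⟩

theorem finrank_le_of_factorization {W : Type} [NormedAddCommGroup W] [NormedSpace ℂ W]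
    [FiniteDimensional ℂ W] (S F : Submodule ℂ W) (u y c : W →L[ℂ] W) (hu : IsUnit u)
    (hy : IsUnit y) (hc : IsUnit c) (hyS : ∀ x ∈ S, y x ∈ S) (hcF : ∀ x ∈ F, c x ∈ F) :
    finrank ℂ ↥(S ⊓ F) ≤ finrank ℂ ↥(S.map (u : W →ₗ[ℂ] W) ⊓ F.map ((u * y * c :) : W →ₗ[ℂ] W)) := by
  have inj : ∀ v : W →L[ℂ] W, IsUnit v → Function.Injective v := fun v hv x x' hx => by
    obtain ⟨w, rfl⟩ := hv
    have := congrArg (w⁻¹ : (W →L[ℂ] W)ˣ).1 hx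
    rw [← mul_apply_eq_comp, ← mul_apply_eq_comp] at this
    simpa using this
  have hcF' : F.map (c : W →ₗ[ℂ] W) = F := by
    refine Submodule.eq_of_le_of_finrank_eq (Submodule.map_le_iff_le_comap.2 hcF) ?_
    exact ((Submodule.equivMapOfInjective (c : W →ₗ[ℂ] W) (inj c hc) F).finrank_eq).symm
  have hinj : Function.Injective ((u * y : W →L[ℂ] W) : W →ₗ[ℂ] W) := inj _ (hu.mul hy)
  rw [(Submodule.equivMapOfInjective _ hinj (S ⊓ F)).finrank_eq]
  refine Submodule.finrank_mono ?_
  rintro _ ⟨x, ⟨hxS, hxF⟩, rfl⟩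
  refine ⟨⟨y x, hyS x hxS, rfl⟩, ?_⟩
  rw [← hcF'] at hxF
  obtain ⟨z, hz, rfl⟩ := hxF
  exact ⟨z, hz, rfl⟩

open Filter Topology in
theorem int_of_spanning {T r : ℕ} (f : Fin 3 → Filt T (Fin r → ℂ)) (S : Submodule ℂ (Fin r → ℂ))
    (h : ∀ z : Fin 3 → (Fin r → ℂ) →L[ℂ] (Fin r → ℂ), ∃ u, ∀ m,
      ∃ y ∈ stabilizer fun _ : Unit => S, ∃ c ∈ stabilizer (f m).F, z m = u + y + c) :
    Int (fun m => (f m).dim) (fun m t => ((f m).sub S).dim t) (finrank ℂ S) r := by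
  choose a ha haF using fun m => exists_adapted (f m).dim (f m).F (f m).mono fun _ => le_rfl
  have haF' : ∀ m t, (std r ((f m).dim t)).map (a m).mulVecLin = (f m).F t := by
    intro m t
    refine Submodule.eq_of_le_of_finrank_eq (haF m t) ?_
    exact finrank_map_std (ha m) ((Submodule.finrank_le _).trans (finrank_fin_fun ℂ).le)
  let E : Matrix (Fin r) (Fin r) ℂ →ₗ[ℂ] ((Fin r → ℂ) →L[ℂ] (Fin r → ℂ)) :=
    LinearMap.toContinuousLinearMap.toLinearMap ∘ₗ (Matrix.toLin' (R := ℂ)).toLinearMap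
  have hE : Continuous E := LinearMap.continuous_of_finiteDimensional E
  have hE1 : E 1 = 1 := by
    ext x : 1
    change Matrix.toLin' (1 : Matrix (Fin r) (Fin r) ℂ) x = x
    rw [Matrix.toLin'_one, LinearMap.id_apply]
  let Z : (Fin 3 × Fin r × Fin r → ℂ) → Fin 3 → (Fin r → ℂ) →L[ℂ] (Fin r → ℂ) := fun x m =>
    E (Matrix.of (fun i j => x (m, i, j)) * (a m)⁻¹)
  have hZ : Continuous Z := by
    refine continuous_pi fun m => hE.comp ?_
    refine Continuous.matrix_mul (continuous_matrix fun i j => ?_) continuous_const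
    exact continuous_apply (A := fun _ => ℂ) (m, i, j)
  let x₀ : Fin 3 × Fin r × Fin r → ℂ := fun i => a i.1 i.2.1 i.2.2
  have hZ0 : Z x₀ = 1 := by
    ext m : 1
    change E (a m * (a m)⁻¹) = 1
    rw [Matrix.mul_nonsing_inv _ (ha m), hE1]
  have hev := (hZ0 ▸ hZ.tendsto x₀).eventually
    (eventually_exists_factorization _ (fun m => stabilizer (f m).F) h)
  obtain ⟨x, hx, hxf⟩ := (dense_algebraicIndependent (Fin 3 × Fin r × Fin r)).exists_mem_open
    isOpen_interior (mem_interior_iff_mem_nhds.2 hev |> fun h => ⟨x₀, h⟩)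
  obtain ⟨u, hu, huf⟩ := interior_subset hxf
  refine int_of_generic (a₀ := fun m => Matrix.of fun i j => x (m, i, j)) hx
    ⟨S.map (u : (Fin r → ℂ) →ₗ[ℂ] (Fin r → ℂ)), ?_, fun m t => ?_⟩
  · have hinj : Function.Injective (u : (Fin r → ℂ) →ₗ[ℂ] (Fin r → ℂ)) := fun x x' hx => by
      obtain ⟨w, rfl⟩ := hu
      have := congrArg (w⁻¹ : ((Fin r → ℂ) →L[ℂ] (Fin r → ℂ))ˣ).1 hx
      change ((w⁻¹ : ((Fin r → ℂ) →L[ℂ] (Fin r → ℂ))ˣ).1 * w.1) x =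
        ((w⁻¹ : ((Fin r → ℂ) →L[ℂ] (Fin r → ℂ))ˣ).1 * w.1) x' at this
      simpa using this
    exact ((Submodule.equivMapOfInjective _ hinj S).finrank_eq).symm
  · obtain ⟨y, hy, c, hc, hy1, hc1, hz⟩ := huf m
    refine ((f m).dim_sub S t).le.trans ?_
    refine (finrank_le_of_factorization S ((f m).F t) u (1 + y) (1 + c) hu hy1 hc1
      (fun x hx => add_mem hx (hy () x hx)) fun x hx => add_mem hx (hc t x hx)).trans ?_
    refine Submodule.finrank_mono (inf_le_inf_left _ ?_)
    rw [← haF', ← Submodule.map_comp]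
    refine le_of_eq ?_
    change _ = Submodule.map (Matrix.of fun i j => x (m, i, j)).mulVecLin _
    congr 1
    refine LinearMap.ext fun w => ?_
    refine (DFunLike.congr_fun hz ((a m).mulVec w)).symm.trans ?_
    change Matrix.toLin' (Matrix.of (fun i j => x (m, i, j)) * (a m)⁻¹) ((a m).mulVec w) = _
    rw [Matrix.toLin'_apply, Matrix.mulVec_mulVec, Matrix.mul_assoc,
      Matrix.nonsing_inv_mul _ (ha m), mul_one]
    rfl

theorem finrank_submodule_prod {V Q : Type} [AddCommGroup V] [Module ℂ V] [AddCommGroup Q]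
    [Module ℂ Q] [FiniteDimensional ℂ V] [FiniteDimensional ℂ Q] (S : Submodule ℂ V)
    (U : Submodule ℂ Q) : finrank ℂ (S.prod U) = finrank ℂ S + finrank ℂ U := by
  rw [← finrank_prod]
  have h : S.prod U = LinearMap.range (S.subtype.prodMap U.subtype) := by
    rw [LinearMap.range_prodMap, Submodule.range_subtype, Submodule.range_subtype]
  rw [h]
  exact LinearMap.finrank_range_of_inj (S.injective_subtype.prodMap U.injective_subtype)

/-- If the obstruction for maps from `V` to `Q` vanishes, then subspaces of the position of `V`
in the direct sum of `V` and `Q` exist for all filtrations. -/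
theorem int_of_surj {T : ℕ} {V Q : Type} [AddCommGroup V] [Module ℂ V] [AddCommGroup Q]
    [Module ℂ Q] [FiniteDimensional ℂ V] [FiniteDimensional ℂ Q] {f : Fin 3 → Filt T V}
    {g : Fin 3 → Filt T Q} (h : Surj f g) :
    Int (fun m t => (f m).dim t + (g m).dim t) (fun m => (f m).dim) (finrank ℂ V)
      (finrank ℂ V + finrank ℂ Q) := by
  have hr : finrank ℂ (V × Q) = finrank ℂ V + finrank ℂ Q := finrank_prod
  let e : (V × Q) ≃ₗ[ℂ] (Fin (finrank ℂ V + finrank ℂ Q) → ℂ) :=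
    LinearEquiv.ofFinrankEq _ _ (by rw [hr, finrank_fin_fun])
  let k : Fin 3 → Filt T (Fin (finrank ℂ V + finrank ℂ Q) → ℂ) := fun m =>
    { F := fun t => (((f m).F t).prod ((g m).F t)).map e.toLinearMap
      mono := fun s t hst => Submodule.map_mono (Submodule.prod_mono ((f m).mono hst)
        ((g m).mono hst))
      zero := by rw [(f m).zero, (g m).zero, Submodule.prod_bot, Submodule.map_bot]
      top := by
        rw [(f m).top, (g m).top, Submodule.prod_top, Submodule.map_top, LinearEquiv.range] }
  let i : V →ₗ[ℂ] (Fin (finrank ℂ V + finrank ℂ Q) → ℂ) := e.toLinearMap ∘ₗ LinearMap.inl ℂ V Q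
  have hi : Function.Injective i := e.injective.comp LinearMap.inl_injective
  have hdim : ∀ m, (k m).dim = fun t => (f m).dim t + (g m).dim t := by
    intro m
    ext t
    rw [Filt.dim, LinearEquiv.finrank_map_eq, finrank_submodule_prod]
    rfl
  have hsub : ∀ m, (fun t => ((k m).sub (LinearMap.range i)).dim t) = (f m).dim := by
    intro m
    ext t
    rw [Filt.dim_sub, Filt.dim, (Submodule.equivMapOfInjective i hi ((f m).F t)).finrank_eq]
    suffices LinearMap.range i ⊓ (k m).F t = ((f m).F t).map i by rw [this]
    ext x
    constructor
    · rintro ⟨⟨v, rfl⟩, ⟨p, hp, hpe⟩⟩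
      obtain rfl : p = (v, 0) := e.injective hpe
      exact ⟨v, hp.1, rfl⟩
    · rintro ⟨v, hv, rfl⟩
      exact ⟨⟨v, rfl⟩, (v, 0), ⟨hv, zero_mem _⟩, rfl⟩
  have hmain := int_of_spanning k (LinearMap.range i) ?_
  · rw [LinearMap.finrank_range_of_inj hi] at hmain
    simpa only [hdim, hsub] using hmain
  intro z
  obtain ⟨φ, hφ⟩ := h fun m => LinearMap.snd ℂ V Q ∘ₗ e.symm.toLinearMap ∘ₗ (z m) ∘ₗ i
  let blk : (V →ₗ[ℂ] Q) → (Fin (finrank ℂ V + finrank ℂ Q) → ℂ) →L[ℂ] _ := fun ψ =>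
    LinearMap.toContinuousLinearMap
      (e.toLinearMap ∘ₗ LinearMap.inr ℂ V Q ∘ₗ ψ ∘ₗ LinearMap.fst ℂ V Q ∘ₗ e.symm.toLinearMap)
  have hblk : ∀ ψ x, blk ψ x = e (0, ψ (e.symm x).1) := fun _ _ => rfl
  refine ⟨blk φ, fun m => ?_⟩
  let ψ : V →ₗ[ℂ] Q := LinearMap.snd ℂ V Q ∘ₗ e.symm.toLinearMap ∘ₗ (z m) ∘ₗ i
  refine ⟨z m - blk φ + blk (φ - ψ), ?_, -blk (φ - ψ), neg_mem ?_, by abel⟩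
  · rintro - _ ⟨v, rfl⟩
    refine ⟨(e.symm (z m (i v))).1, ?_⟩
    apply e.symm.injective
    have h1 : e.symm (i v) = (v, 0) := e.symm_apply_apply _
    have h2 : e.symm (i (e.symm (z m (i v))).1) = ((e.symm (z m (i v))).1, 0) :=
      e.symm_apply_apply _
    rw [h2]
    simp only [_root_.add_apply, _root_.sub_apply, hblk, map_add,
      map_sub, e.symm_apply_apply, h1]
    have h3 : ψ v = (e.symm (z m (i v))).2 := rfl
    ext <;> simp [h3]
  · rintro t _ ⟨p, hp, rfl⟩
    rw [hblk]
    refine ⟨_, ⟨zero_mem _, hφ m t _ ?_⟩, rfl⟩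
    simpa using hp.1

end Tangent

section Counting

/-- Number of elements of a set up to a bound. -/
def cnt (X : Finset ℕ) (t : ℕ) : ℕ := (X.filter (· ≤ t)).card

theorem cnt_mono (X : Finset ℕ) : Monotone (cnt X) := fun _ _ h =>
  Finset.card_le_card (Finset.monotone_filter_right X fun _ _ hx => le_trans hx h)

theorem cnt_le_card (X : Finset ℕ) (t : ℕ) : cnt X t ≤ X.card :=
  Finset.card_le_card (Finset.filter_subset _ _)

theorem cnt_succ (X : Finset ℕ) (t : ℕ) :
    cnt X (t + 1) = cnt X t + if t + 1 ∈ X then 1 else 0 := by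
  have h : X.filter (· ≤ t + 1) = X.filter (· ≤ t) ∪ X.filter (· = t + 1) := by
    rw [← Finset.filter_or]
    refine Finset.filter_congr fun x _ => ?_
    omega
  rw [cnt, h, Finset.card_union_of_disjoint, cnt, Finset.filter_eq']
  · split_ifs <;> simp
  · rw [Finset.disjoint_filter]
    intro x _ hx
    omega

theorem cnt_zero {X : Finset ℕ} {n : ℕ} (hX : X ⊆ Finset.Icc 1 n) : cnt X 0 = 0 := by
  rw [cnt, Finset.card_eq_zero, Finset.filter_eq_empty_iff]
  intro x hx
  have := Finset.mem_Icc.1 (hX hx)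
  omega

theorem cnt_of_le {X : Finset ℕ} {n t : ℕ} (hX : X ⊆ Finset.Icc 1 n) (ht : n ≤ t) :
    cnt X t = X.card := by
  rw [cnt, Finset.filter_true_of_mem]
  intro x hx
  have := Finset.mem_Icc.1 (hX hx)
  omega

theorem cnt_lt {X : Finset ℕ} {s t : ℕ} (hst : s < t) (ht : t ∈ X) : cnt X s < cnt X t := by
  obtain ⟨t, rfl⟩ : ∃ k, t = k + 1 := ⟨t - 1, by omega⟩
  rw [cnt_succ, if_pos ht]
  have := cnt_mono X (show s ≤ t by omega)
  omega

theorem cnt_pos {X : Finset ℕ} {x : ℕ} (hx : x ∈ X) : 1 ≤ cnt X x :=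
  Finset.card_pos.2 ⟨x, Finset.mem_filter.2 ⟨hx, le_rfl⟩⟩

theorem cnt_mem_Icc {X : Finset ℕ} {x : ℕ} (hx : x ∈ X) : cnt X x ∈ Finset.Icc 1 X.card :=
  Finset.mem_Icc.2 ⟨cnt_pos hx, cnt_le_card X x⟩

theorem cnt_injOn (X : Finset ℕ) : Set.InjOn (cnt X) X := by
  intro x hx y hy h
  rcases lt_trichotomy x y with hlt | heq | hlt
  · exact absurd h (cnt_lt hlt hy).ne
  · exact heq
  · exact absurd h (cnt_lt hlt hx).ne'

theorem image_cnt (X : Finset ℕ) : X.image (cnt X) = Finset.Icc 1 X.card := by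
  refine Finset.eq_of_subset_of_card_le (Finset.image_subset_iff.2 fun x hx => cnt_mem_Icc hx) ?_
  rw [Finset.card_image_of_injOn (cnt_injOn X), Nat.card_Icc]
  omega

theorem cnt_le_self {X : Finset ℕ} {n : ℕ} (hX : X ⊆ Finset.Icc 1 n) (t : ℕ) :
    cnt X t ≤ min t n := by
  have h : X.filter (· ≤ t) ⊆ Finset.Icc 1 (min t n) := by
    intro x hx
    rw [Finset.mem_filter] at hx
    have := Finset.mem_Icc.1 (hX hx.1)
    rw [Finset.mem_Icc]
    omega
  exact (Finset.card_le_card h).trans (by rw [Nat.card_Icc]; omega)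

theorem nthElt_eq {X : Finset ℕ} {x : ℕ} (hx : x ∈ X) : nthElt X (cnt X x) = x := by
  have hx' : x ∈ X.sort (· ≤ ·) := (Finset.mem_sort _).2 hx
  obtain ⟨i, hi, rfl⟩ := List.getElem_of_mem hx'
  have hlen : (X.sort (· ≤ ·)).length = X.card := Finset.length_sort _
  have hc : cnt X (X.sort (· ≤ ·))[i] = i + 1 := by
    have : X.filter (· ≤ (X.sort (· ≤ ·))[i]) =
        (Finset.range (i + 1)).image fun j => (X.sort (· ≤ ·)).getD j 0 := by
      ext y
      rw [Finset.mem_filter, Finset.mem_image]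
      constructor
      · rintro ⟨hy, hyi⟩
        obtain ⟨j, hj, rfl⟩ := List.getElem_of_mem ((Finset.mem_sort (· ≤ ·)).2 hy)
        refine ⟨j, ?_, List.getD_eq_getElem _ _ hj⟩
        rw [Finset.mem_range]
        by_contra hlt
        have := (Finset.sortedLT_sort X).strictMono_get (a := ⟨i, hi⟩) (b := ⟨j, hj⟩)
          (show i < j by omega)
        simp only [List.get_eq_getElem] at this
        omega
      · rintro ⟨j, hj, rfl⟩
        rw [Finset.mem_range] at hj
        have hj' : j < (X.sort (· ≤ ·)).length := by omega
        have h1 : (X.sort (· ≤ ·)).getD j 0 = (X.sort (· ≤ ·))[j] := List.getD_eq_getElem _ _ hj'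
        rw [h1]
        refine ⟨(Finset.mem_sort (· ≤ ·)).1 (List.getElem_mem _), ?_⟩
        exact (Finset.sortedLT_sort X).strictMono_get.monotone (a := ⟨j, hj'⟩) (b := ⟨i, hi⟩)
          (show j ≤ i by omega)
    rw [cnt, this, Finset.card_image_of_injOn, Finset.card_range]
    intro j hj k hk hjk
    have hj : j < (X.sort (· ≤ ·)).length := by simp at hj; omega
    have hk : k < (X.sort (· ≤ ·)).length := by simp at hk; omega
    have h1 : (X.sort (· ≤ ·)).getD j 0 = (X.sort (· ≤ ·))[j] := List.getD_eq_getElem _ _ hj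
    have h2 : (X.sort (· ≤ ·)).getD k 0 = (X.sort (· ≤ ·))[k] := List.getD_eq_getElem _ _ hk
    simp only [h1, h2] at hjk
    have := (Finset.sortedLT_sort X).strictMono_get.injective (a₁ := ⟨j, hj⟩) (a₂ := ⟨k, hk⟩) hjk
    simpa using this
  rw [hc]
  exact List.getD_eq_getElem _ _ hi

theorem exists_cnt_eq {X : Finset ℕ} {b : ℕ} (hb : b ∈ Finset.Icc 1 X.card) :
    ∃ x ∈ X, cnt X x = b := by
  rw [← image_cnt, Finset.mem_image] at hb
  exact hb

theorem nthElt_mem {X : Finset ℕ} {b : ℕ} (hb : b ∈ Finset.Icc 1 X.card) : nthElt X b ∈ X := by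
  obtain ⟨x, hx, rfl⟩ := exists_cnt_eq hb
  rwa [nthElt_eq hx]

theorem cnt_nthElt {X : Finset ℕ} {b : ℕ} (hb : b ∈ Finset.Icc 1 X.card) :
    cnt X (nthElt X b) = b := by
  obtain ⟨x, hx, rfl⟩ := exists_cnt_eq hb
  rw [nthElt_eq hx]

theorem cnt_image_cnt {X Y : Finset ℕ} (hY : Y ⊆ X) (y : ℕ) :
    cnt (Y.image (cnt X)) (cnt X y) = cnt Y y := by
  have h : (Y.image (cnt X)).filter (· ≤ cnt X y) = (Y.filter (· ≤ y)).image (cnt X) := by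
    rw [Finset.filter_image]
    congr 1
    refine Finset.filter_congr fun x hx => ⟨fun h => ?_, fun h => cnt_mono X h⟩
    by_contra hlt
    have := cnt_lt (not_le.1 hlt) (hY hx)
    omega
  rw [cnt, h, Finset.card_image_of_injOn, cnt]
  exact (cnt_injOn X).mono fun x hx => hY (Finset.mem_filter.1 hx).1

theorem nthElt_image_cnt {X Y : Finset ℕ} (hY : Y ⊆ X) {y : ℕ} (hy : y ∈ Y) :
    nthElt (Y.image (cnt X)) (cnt Y y) = cnt X y := by
  rw [← cnt_image_cnt hY y]
  exact nthElt_eq (Finset.mem_image_of_mem _ hy)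

theorem eul_cnt {n : ℕ} {X : Finset ℕ} (hX : X ⊆ Finset.Icc 1 n) (M : ℕ → ℕ) :
    eul n (cnt X) M = ∑ x ∈ X, (M x : ℤ) := by
  have h1 : ∀ t, ((cnt X (t + 1) : ℤ) - cnt X t) * M (t + 1) =
      if t + 1 ∈ X then (M (t + 1) : ℤ) else 0 := by
    intro t
    rw [cnt_succ]
    split_ifs <;> simp
  simp only [eul, h1]
  rw [← Finset.sum_filter]
  refine Finset.sum_bij (fun t _ => t + 1) (fun t ht => (Finset.mem_filter.1 ht).2)
    (fun _ _ _ _ h => by omega) (fun x hx => ?_) fun _ _ => rfl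
  have := Finset.mem_Icc.1 (hX hx)
  refine ⟨x - 1, ?_, by omega⟩
  rw [Finset.mem_filter, Finset.mem_range]
  have h2 : x - 1 + 1 = x := by omega
  rw [h2]
  exact ⟨by omega, hx⟩

theorem cnt_comp_cnt {n : ℕ} {Y C : Finset ℕ} (hY : Y ⊆ Finset.Icc 1 n)
    (hC : C ⊆ Finset.Icc 1 Y.card) (t : ℕ) :
    cnt C (cnt Y t) = cnt (Y.filter (cnt Y · ∈ C)) t := by
  induction t with
  | zero =>
    rw [cnt_zero hY, cnt_zero hC, cnt_zero ((Finset.filter_subset _ _).trans hY)]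
  | succ t ih =>
    rw [cnt_succ (Y.filter _), ← ih]
    simp only [Finset.mem_filter]
    by_cases h : t + 1 ∈ Y
    · have h1 : cnt Y (t + 1) = cnt Y t + 1 := by rw [cnt_succ, if_pos h]
      simp only [h, true_and]
      rw [h1, cnt_succ]
    · simp [h, cnt_succ]

theorem sum_nthElt {Y C : Finset ℕ} (hC : C ⊆ Finset.Icc 1 Y.card) (w : ℕ → ℤ) :
    ∑ y ∈ Y.filter (cnt Y · ∈ C), w y = ∑ c ∈ C, w (nthElt Y c) := by
  refine Finset.sum_bij (fun y _ => cnt Y y) (fun y hy => (Finset.mem_filter.1 hy).2)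
    (fun x hx y hy h => cnt_injOn Y (Finset.mem_filter.1 hx).1 (Finset.mem_filter.1 hy).1 h)
    (fun c hc => ⟨nthElt Y c, ?_, cnt_nthElt (hC hc)⟩) fun y hy => ?_
  · rw [Finset.mem_filter, cnt_nthElt (hC hc)]
    exact ⟨nthElt_mem (hC hc), hc⟩
  · rw [nthElt_eq (Finset.mem_filter.1 hy).1]

theorem eul_cnt_comp_cnt {n : ℕ} {Y C : Finset ℕ} (hY : Y ⊆ Finset.Icc 1 n)
    (hC : C ⊆ Finset.Icc 1 Y.card) (M : ℕ → ℕ) :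
    eul n (fun t => cnt C (cnt Y t)) M = ∑ c ∈ C, (M (nthElt Y c) : ℤ) := by
  have h : (fun t => cnt C (cnt Y t)) = cnt (Y.filter (cnt Y · ∈ C)) :=
    funext fun t => cnt_comp_cnt hY hC t
  rw [h, eul_cnt ((Finset.filter_subset _ _).trans hY), sum_nthElt hC fun y => (M y : ℤ)]

theorem exists_eq_cnt {n : ℕ} {X : Finset ℕ} (hX : X ⊆ Finset.Icc 1 n) (D D' : ℕ → ℕ)
    (hD : Monotone D) (hD' : Monotone D') (h : ∀ t, cnt X t = D t + D' t) :
    ∃ Y ⊆ X, ∀ t, cnt Y t = D t := by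
  refine ⟨X.filter fun t => D t ≠ D (t - 1), Finset.filter_subset _ _, fun t => ?_⟩
  induction t with
  | zero =>
    rw [cnt_zero ((Finset.filter_subset _ _).trans hX)]
    have := h 0
    rw [cnt_zero hX] at this
    omega
  | succ t ih =>
    rw [cnt_succ, ih]
    simp only [Finset.mem_filter]
    have h1 := h t
    have h2 := h (t + 1)
    rw [cnt_succ] at h2
    have h3 := hD t.le_succ
    have h4 := hD' t.le_succ
    simp only [Nat.succ_eq_add_one, add_tsub_cancel_right] at *
    by_cases hx : t + 1 ∈ X
    · simp only [hx, if_true, true_and] at *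
      split_ifs <;> omega
    · simp only [hx, if_false, false_and] at *
      omega

/-- Reversal of a subset of `{1, …, n}`. -/
def flip (n : ℕ) (X : Finset ℕ) : Finset ℕ := X.image (n + 1 - ·)

variable {n : ℕ} {X : Finset ℕ}

theorem flip_subset (hX : X ⊆ Finset.Icc 1 n) : flip n X ⊆ Finset.Icc 1 n := by
  intro y hy
  obtain ⟨x, hx, rfl⟩ := Finset.mem_image.1 hy
  have := Finset.mem_Icc.1 (hX hx)
  rw [Finset.mem_Icc]
  omega

theorem flip_injOn (hX : X ⊆ Finset.Icc 1 n) : Set.InjOn (n + 1 - ·) (X : Set ℕ) := by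
  intro x hx y hy h
  have h1 := Finset.mem_Icc.1 (hX hx)
  have h2 := Finset.mem_Icc.1 (hX hy)
  simp only at h
  omega

theorem card_flip (hX : X ⊆ Finset.Icc 1 n) : (flip n X).card = X.card :=
  Finset.card_image_of_injOn (flip_injOn hX)

theorem sum_flip (hX : X ⊆ Finset.Icc 1 n) (w : ℕ → ℤ) :
    ∑ y ∈ flip n X, w y = ∑ x ∈ X, w (n + 1 - x) :=
  Finset.sum_image (flip_injOn hX)

theorem flip_flip (hX : X ⊆ Finset.Icc 1 n) : flip n (flip n X) = X := by
  rw [flip, flip, Finset.image_image]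
  conv_rhs => rw [← Finset.image_id (s := X)]
  refine Finset.image_congr fun x hx => ?_
  have := Finset.mem_Icc.1 (hX hx)
  simp only [Function.comp_apply, id]
  omega

theorem nthElt_flip (hX : X ⊆ Finset.Icc 1 n) {b : ℕ} (hb : b ∈ Finset.Icc 1 X.card) :
    nthElt (flip n X) (X.card + 1 - b) = n + 1 - nthElt X b := by
  obtain ⟨x, hx, rfl⟩ := exists_cnt_eq hb
  rw [nthElt_eq hx]
  have hxn := Finset.mem_Icc.1 (hX hx)
  suffices h : cnt (flip n X) (n + 1 - x) = X.card + 1 - cnt X x by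
    rw [← h]
    exact nthElt_eq (Finset.mem_image_of_mem _ hx)
  have h1 : (flip n X).filter (· ≤ n + 1 - x) = (X.filter (x ≤ ·)).image (n + 1 - ·) := by
    rw [flip, Finset.filter_image]
    congr 1
    refine Finset.filter_congr fun y hy => ?_
    have := Finset.mem_Icc.1 (hX hy)
    omega
  rw [cnt, h1, Finset.card_image_of_injOn
    ((flip_injOn hX).mono (Finset.coe_subset.2 (Finset.filter_subset _ _)))]
  obtain ⟨k, rfl⟩ : ∃ k, x = k + 1 := ⟨x - 1, by omega⟩
  have h2 := Finset.card_filter_add_card_filter_not (s := X) (· ≤ k)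
  have h3 : X.filter (fun a => ¬ a ≤ k) = X.filter (k + 1 ≤ ·) :=
    Finset.filter_congr fun y _ => by omega
  rw [h3] at h2
  rw [cnt_succ, if_pos hx, cnt]
  omega

end Counting

theorem two_mul_sum_cnt (X : Finset ℕ) : 2 * ∑ x ∈ X, (cnt X x : ℤ) = X.card * (X.card + 1) := by
  have h : ∑ x ∈ X, cnt X x = ∑ i ∈ Finset.Icc 1 X.card, i := by
    rw [← image_cnt X, Finset.sum_image (cnt_injOn X)]
  have h2 : ∀ k : ℕ, 2 * ∑ i ∈ Finset.Icc 1 k, i = k * (k + 1) := by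
    intro k
    induction k with
    | zero => simp
    | succ k ih => rw [Finset.sum_Icc_succ_top (by omega), mul_add, ih]; ring
  have := h2 X.card
  rw [← h] at this
  exact_mod_cast this

/-- Symmetric version of `IsT`, with the first two sets reversed. -/
def T3 (n r : ℕ) (X : Fin 3 → Finset ℕ) : Prop :=
  (∀ m, X m ⊆ Finset.Icc 1 n) ∧ IsT n r (flip n (X 0)) (flip n (X 1)) (X 2)

theorem T3.card {n r : ℕ} {X : Fin 3 → Finset ℕ} (h : T3 n r X) (m : Fin 3) :
    (X m).card = r := by
  obtain ⟨hX, hT⟩ := h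
  rw [IsT] at hT
  obtain ⟨⟨-, -, -, h0, h1, h2, -⟩, -⟩ := hT
  rw [card_flip (hX _)] at h0 h1
  fin_cases m <;> assumption

theorem sum_flip_id {n : ℕ} {X : Finset ℕ} (hX : X ⊆ Finset.Icc 1 n) :
    ((∑ x ∈ flip n X, x : ℕ) : ℤ) = X.card * (n + 1) - ∑ x ∈ X, (x : ℤ) := by
  push_cast
  rw [sum_flip hX (fun x => (x : ℤ)), ← nsmul_eq_mul, ← Finset.sum_const, ← Finset.sum_sub_distrib]
  refine Finset.sum_congr rfl fun x hx => ?_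
  have := Finset.mem_Icc.1 (hX hx)
  omega

theorem isU_flip_iff {n r : ℕ} {X : Fin 3 → Finset ℕ} (hX : ∀ m, X m ⊆ Finset.Icc 1 n) :
    IsU n r (flip n (X 0)) (flip n (X 1)) (X 2) ↔ (∀ m, (X m).card = r) ∧
      2 * ∑ m, ∑ x ∈ X m, (x : ℤ) = 4 * r * (n + 1) - r * (r + 1) := by
  have h2 : (2 : ℤ) * ((r * (r + 1) / 2 : ℕ) : ℤ) = r * (r + 1) := by
    exact_mod_cast Nat.mul_div_cancel' (Nat.even_mul_succ_self r).two_dvd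
  have h0 := sum_flip_id (hX 0)
  have h1 := sum_flip_id (hX 1)
  unfold IsU
  rw [card_flip (hX _), card_flip (hX _), Fin.sum_univ_three, Fin.forall_fin_succ, Fin.forall_fin_two]
  constructor
  · rintro ⟨-, -, -, c0, c1, c2, hs⟩
    refine ⟨⟨c0, c1, c2⟩, ?_⟩
    rw [c0] at h0
    rw [c1] at h1
    have hs' : ((∑ i ∈ flip n (X 0), i : ℕ) : ℤ) + (∑ j ∈ flip n (X 1), j : ℕ) =
      (∑ k ∈ X 2, k : ℕ) + (r * (r + 1) / 2 : ℕ) := by exact_mod_cast hs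
    have h3 : ((∑ k ∈ X 2, k : ℕ) : ℤ) = ∑ k ∈ X 2, (k : ℤ) := by push_cast; rfl
    linarith
  · rintro ⟨⟨c0, c1, c2⟩, hs⟩
    change (X 1).card = r at c1
    refine ⟨flip_subset (hX 0), flip_subset (hX 1), hX 2, c0, c1, c2, ?_⟩
    rw [c0] at h0
    rw [c1] at h1
    have h3 : ((∑ k ∈ X 2, k : ℕ) : ℤ) = ∑ k ∈ X 2, (k : ℤ) := by push_cast; rfl
    have hs' : ((∑ i ∈ flip n (X 0), i : ℕ) : ℤ) + (∑ j ∈ flip n (X 1), j : ℕ) =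
      (∑ k ∈ X 2, k : ℕ) + (r * (r + 1) / 2 : ℕ) := by linarith
    exact_mod_cast hs'

theorem T3.sum {n r : ℕ} {X : Fin 3 → Finset ℕ} (h : T3 n r X) :
    2 * ∑ m, ∑ x ∈ X m, (x : ℤ) = 4 * r * (n + 1) - r * (r + 1) := by
  have h' := h.2
  rw [IsT] at h'
  exact ((isU_flip_iff h.1).1 h'.1).2

theorem sum_nthElt_flip {n r : ℕ} {X Y : Finset ℕ} (hX : X ⊆ Finset.Icc 1 n) (hr : X.card = r)
    (hY : Y ⊆ Finset.Icc 1 r) :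
    ((∑ f ∈ flip r Y, nthElt (flip n X) f : ℕ) : ℤ) =
      Y.card * (n + 1) - ∑ c ∈ Y, (nthElt X c : ℤ) := by
  push_cast
  rw [sum_flip hY (fun f => (nthElt (flip n X) f : ℤ)), ← nsmul_eq_mul, ← Finset.sum_const,
    ← Finset.sum_sub_distrib]
  refine Finset.sum_congr rfl fun c hc => ?_
  subst hr
  have := Finset.mem_Icc.1 (hX (nthElt_mem (hY hc)))
  rw [nthElt_flip hX (hY hc)]
  omega

theorem nthElt_flip_sum_le_iff {n r s : ℕ} {X Y : Fin 3 → Finset ℕ}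
    (hX : ∀ m, X m ⊆ Finset.Icc 1 n) (hr : ∀ m, (X m).card = r)
    (hY : ∀ m, Y m ⊆ Finset.Icc 1 r) (hs : ∀ m, (Y m).card = s) :
    ∑ f ∈ flip r (Y 0), nthElt (flip n (X 0)) f + ∑ f ∈ flip r (Y 1), nthElt (flip n (X 1)) f ≤
      ∑ f ∈ Y 2, nthElt (X 2) f + s * (s + 1) / 2 ↔
    4 * s * (n + 1) - s * (s + 1) ≤ 2 * ∑ m, ∑ c ∈ Y m, (nthElt (X m) c : ℤ) := by
  have h2 : (2 : ℤ) * ((s * (s + 1) / 2 : ℕ) : ℤ) = s * (s + 1) := by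
    exact_mod_cast Nat.mul_div_cancel' (Nat.even_mul_succ_self s).two_dvd
  have h0 := sum_nthElt_flip (hX 0) (hr 0) (hY 0)
  have h1 := sum_nthElt_flip (hX 1) (hr 1) (hY 1)
  have h3 : ((∑ k ∈ Y 2, nthElt (X 2) k : ℕ) : ℤ) = ∑ k ∈ Y 2, (nthElt (X 2) k : ℤ) := by
    push_cast; rfl
  rw [hs] at h0 h1
  rw [Fin.sum_univ_three]
  zify at *
  constructor
  · intro h; linarith
  · intro h; linarith

theorem T3.le {n r s : ℕ} {X Y : Fin 3 → Finset ℕ} (h : T3 n r X) (hs : 1 ≤ s) (hsr : s < r)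
    (hY : T3 r s Y) :
    4 * s * (n + 1) - s * (s + 1) ≤ 2 * ∑ m, ∑ c ∈ Y m, (nthElt (X m) c : ℤ) := by
  have h' := h.2
  rw [IsT] at h'
  exact (nthElt_flip_sum_le_iff h.1 h.card hY.1 hY.card).1 (h'.2 s hs hsr _ _ _ hY.2)

theorem T3.intro {n r : ℕ} {X : Fin 3 → Finset ℕ} (hX : ∀ m, X m ⊆ Finset.Icc 1 n)
    (hr : ∀ m, (X m).card = r)
    (hsum : 2 * ∑ m, ∑ x ∈ X m, (x : ℤ) = 4 * r * (n + 1) - r * (r + 1))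
    (h : ∀ s Y, 1 ≤ s → s < r → T3 r s Y →
      4 * s * (n + 1) - s * (s + 1) ≤ 2 * ∑ m, ∑ c ∈ Y m, (nthElt (X m) c : ℤ)) :
    T3 n r X := by
  refine ⟨hX, ?_⟩
  rw [IsT]
  refine ⟨(isU_flip_iff hX).2 ⟨hr, hsum⟩, fun s hs hsr F G H hT => ?_⟩
  have hT' := hT
  rw [IsT] at hT'
  obtain ⟨⟨hF, hG, hH, -⟩, -⟩ := hT'
  have hY : T3 r s ![flip r F, flip r G, H] := by
    refine ⟨?_, ?_⟩
    · rw [Fin.forall_fin_succ, Fin.forall_fin_two]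
      exact ⟨flip_subset hF, flip_subset hG, hH⟩
    · simpa [flip_flip hF, flip_flip hG] using hT
  have key := (nthElt_flip_sum_le_iff hX hr hY.1 hY.card).2 (h s _ hs hsr hY)
  simpa [flip_flip hF, flip_flip hG] using key

theorem sum_image_cnt {X Y : Finset ℕ} (hY : Y ⊆ X) (w : ℕ → ℤ) :
    ∑ c ∈ Y.image (cnt X), w c = ∑ y ∈ Y, w (cnt X y) :=
  Finset.sum_image ((cnt_injOn X).mono (by exact_mod_cast hY))

theorem isType_cnt {n r : ℕ} {X : Finset ℕ} (hX : X ⊆ Finset.Icc 1 n) (hr : X.card = r) :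
    IsType n r (cnt X) where
  mono := cnt_mono X
  zero := cnt_zero hX
  top := by rw [cnt_of_le hX le_rfl, hr]
  le t := hr ▸ cnt_le_card X t

theorem isType_sub_cnt {n r : ℕ} {X : Finset ℕ} (hX : X ⊆ Finset.Icc 1 n) (hr : X.card = r) :
    IsType n (n - r) (fun t => min t n - cnt X t) := by
  have hm : Monotone fun t => min t n - cnt X t := by
    refine monotone_nat_of_le_succ fun t => ?_
    have h := cnt_succ X t
    rcases lt_or_ge t n with ht | ht
    · have : min (t + 1) n = min t n + 1 := by omega
      simp only [this]
      split_ifs at h <;> omega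
    · rw [cnt_of_le hX ht, cnt_of_le hX (by omega : n ≤ t + 1)]
      omega
  have ht : min n n - cnt X n = n - r := by rw [cnt_of_le hX le_rfl, hr, min_self]
  refine ⟨hm, by simp, ht, fun t => ?_⟩
  rw [← ht]
  rcases le_total t n with h | h
  · exact hm h
  · rw [cnt_of_le hX h, cnt_of_le hX le_rfl]
    omega

section

variable {n : ℕ} {V Q : Type} [AddCommGroup V] [Module ℂ V] [FiniteDimensional ℂ V]
  [AddCommGroup Q] [Module ℂ Q] [FiniteDimensional ℂ Q]

omit [FiniteDimensional ℂ V] [FiniteDimensional ℂ Q] in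
theorem chiF_of_cnt {f : Fin 3 → Filt n V} (g : Fin 3 → Filt n Q) {Y : Fin 3 → Finset ℕ}
    (hY : ∀ m, Y m ⊆ Finset.Icc 1 n) (hf : ∀ m t, (f m).dim t = cnt (Y m) t) :
    chiF f g = ∑ m, ∑ y ∈ Y m, ((g m).dim y : ℤ) - 2 * finrank ℂ V * finrank ℂ Q := by
  rw [chiF, chi]
  congr 1
  refine Finset.sum_congr rfl fun m _ => ?_
  rw [← eul_cnt (hY m)]
  congr 1
  exact funext (hf m)

theorem Int.exists_sub {N' : Fin 3 → ℕ → ℕ} {d s : ℕ} (h : Int (fun _ t => min t s) N' d s)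
    (f : Fin 3 → Filt n V) (hs : finrank ℂ V = s) :
    ∃ S : Submodule ℂ V, finrank ℂ S = d ∧
      ∀ m t, N' m ((f m).dim t) ≤ ((f m).sub S).dim t := by
  obtain ⟨F, hFe⟩ : ∃ F : Fin 3 → ℕ → Submodule ℂ V,
      ∀ m b, F m b = ⨅ t, ⨅ _ : b ≤ (f m).dim t, (f m).F t := ⟨_, fun _ _ => rfl⟩
  have hFt : ∀ m b t, b ≤ (f m).dim t → F m b ≤ (f m).F t := fun m b t ht => by
    rw [hFe]
    exact iInf₂_le t ht
  have hle : ∀ m b (X : Submodule ℂ V), (∀ t, b ≤ (f m).dim t → X ≤ (f m).F t) → X ≤ F m b :=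
    fun m b X hX => by
      rw [hFe]
      exact le_iInf₂ hX
  clear hFe
  have hF : ∀ m, Monotone (F m) := fun m b c hbc =>
    hle _ _ _ fun t ht => hFt m b t (le_trans hbc ht)
  have hFd : ∀ m b, min b s ≤ finrank ℂ (F m b) := by
    intro m b
    by_cases hb : ∃ t, b ≤ (f m).dim t
    · refine (min_le_left _ _).trans ((Nat.find_spec hb).trans ?_)
      exact Submodule.finrank_mono (hle _ _ _ fun t ht => (f m).mono (Nat.find_min' hb ht))
    · have : F m b = ⊤ := top_le_iff.1 (hle _ _ _ fun t ht => absurd ⟨t, ht⟩ hb)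
      rw [this, finrank_top, hs]
      exact min_le_right _ _
  obtain ⟨S, hS, hS'⟩ := h V hs F hF hFd
  refine ⟨S, hS, fun m t => (hS' m _).trans ?_⟩
  rw [Filt.dim_sub]
  exact Submodule.finrank_mono (inf_le_inf_left _ (hFt m _ t le_rfl))

/-- Intersections inside the source of a pair without obstruction. -/
theorem Surj.le_sum_of_int {f : Fin 3 → Filt n V} {g : Fin 3 → Filt n Q} (h : Surj f g)
    {s d : ℕ} {Y C : Fin 3 → Finset ℕ} (hY : ∀ m, Y m ⊆ Finset.Icc 1 n)
    (hf : ∀ m t, (f m).dim t = cnt (Y m) t) (hs : finrank ℂ V = s)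
    (hC : ∀ m, C m ⊆ Finset.Icc 1 s) (hd : ∀ m, (C m).card = d)
    (h_int : Int (fun _ t => min t s) (fun m => cnt (C m)) d s) :
    2 * d * finrank ℂ Q ≤ ∑ m, ∑ c ∈ C m, ((g m).dim (nthElt (Y m) c) : ℤ) := by
  obtain ⟨S, hS, hS'⟩ := h_int.exists_sub f hs
  have hcard : ∀ m, (Y m).card = s := fun m => by
    rw [← cnt_of_le (hY m) le_rfl, ← hf, (f m).dim_top, hs]
  have h1 : 0 ≤ chiF (fun m => (f m).sub S) g := by
    rw [← (h.sub S).finrank_eq]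
    positivity
  rw [chiF, chi, hS] at h1
  refine le_trans (by linarith) (Finset.sum_le_sum fun m _ => ?_ :
    ∑ m, eul n ((f m).sub S).dim (g m).dim ≤ _)
  rw [← eul_cnt_comp_cnt (hY m) (by rw [hcard]; exact hC m)]
  refine eul_anti n _ _ _ ?_ (Filt.dim_zero _) ?_ (Filt.dim_mono _) fun t => ?_
  · rw [cnt_zero (hY m), cnt_zero (hC m)]
  · rw [cnt_of_le (hY m) le_rfl, hcard, cnt_of_le (hC m) le_rfl, hd, Filt.dim_top, hS]
  · rw [← hf]
    exact hS' m t

end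

theorem T3.subset {n r : ℕ} {X : Fin 3 → Finset ℕ} (h : T3 n r X) (m : Fin 3) :
    X m ⊆ Finset.Icc 1 n := h.1 m

theorem T3.le_self {n r : ℕ} {X : Fin 3 → Finset ℕ} (h : T3 n r X) : r ≤ n := by
  rw [← h.card 0]
  simpa using Finset.card_le_card (h.subset 0)

/-- Membership in `T` passes to destabilizing subspaces. -/
theorem T3.of_surj {n r s : ℕ} {V Q : Type} [AddCommGroup V] [Module ℂ V] [FiniteDimensional ℂ V]
    [AddCommGroup Q] [Module ℂ Q] [FiniteDimensional ℂ Q] {f : Fin 3 → Filt n V}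
    {g : Fin 3 → Filt n Q} (h : Surj f g) (h0 : chiF f g = 0) {X Y : Fin 3 → Finset ℕ}
    (hX : ∀ m, X m ⊆ Finset.Icc 1 n) (hr : ∀ m, (X m).card = r) (hYX : ∀ m, Y m ⊆ X m)
    (hs : ∀ m, (Y m).card = s)
    (hf : ∀ m t, (f m).dim t = cnt (Y m) t)
    (hg : ∀ m t, cnt (X m) t = cnt (Y m) t + (g m).dim t)
    (h_int : ∀ d C, d < s → T3 s d C → Int (fun _ t => min t s) (fun m => cnt (C m)) d s) :
    T3 r s fun m => (Y m).image (cnt (X m)) := by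
  have hY : ∀ m, Y m ⊆ Finset.Icc 1 n := fun m => (hYX m).trans (hX m)
  have hV : finrank ℂ V = s := by
    rw [← (f 0).dim_top, hf, cnt_of_le (hY 0) le_rfl, hs]
  have hQ : r = s + finrank ℂ Q := by
    rw [← (g 0).dim_top, ← hs 0, ← cnt_of_le (hY 0) le_rfl, ← hg, cnt_of_le (hX 0) le_rfl, hr]
  have hg' : ∀ m t, ((g m).dim t : ℤ) = cnt (X m) t - cnt (Y m) t := fun m t => by
    rw [hg]; push_cast; ring
  have hQ' : (r : ℤ) = s + finrank ℂ Q := by exact_mod_cast hQ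
  have hc : ∀ m, 2 * ∑ y ∈ Y m, (cnt (Y m) y : ℤ) = s * (s + 1) := fun m => by
    rw [two_mul_sum_cnt, hs]
  refine T3.intro (fun m => ?_) (fun m => ?_) ?_ fun d C hd hds hC => ?_
  · refine Finset.image_subset_iff.2 fun y hy => ?_
    rw [← hr m]
    exact cnt_mem_Icc (hYX m hy)
  · rw [Finset.card_image_of_injOn ((cnt_injOn _).mono (by exact_mod_cast hYX m)), hs]
  · simp only [fun m => sum_image_cnt (hYX m) fun x => (x : ℤ)]
    rw [chiF_of_cnt g hY hf, hV] at h0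
    simp only [hg', Finset.sum_sub_distrib] at h0
    have := hc 0
    have := hc 1
    have := hc 2
    rw [hQ']
    simp only [Fin.sum_univ_three] at h0 ⊢
    nlinarith
  · have h1 := h.le_sum_of_int hY hf hV hC.1 hC.card (h_int d C hds hC)
    have h2 := hC.sum
    have h3 : ∑ m, ∑ c ∈ C m, ((g m).dim (nthElt (Y m) c) : ℤ) =
        ∑ m, ∑ c ∈ C m, (nthElt ((Y m).image (cnt (X m))) c : ℤ) - ∑ m, ∑ c ∈ C m, (c : ℤ) := by
      rw [← Finset.sum_sub_distrib]
      refine Finset.sum_congr rfl fun m _ => ?_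
      rw [← Finset.sum_sub_distrib]
      refine Finset.sum_congr rfl fun c hc => ?_
      have hc' : c ∈ Finset.Icc 1 (Y m).card := by rw [hs]; exact hC.1 m hc
      have h4 := nthElt_image_cnt (hYX m) (nthElt_mem hc')
      rw [cnt_nthElt hc'] at h4
      rw [hg', h4, cnt_nthElt hc']
    rw [h3] at h1
    rw [hQ']
    linarith

theorem T3.nonneg_and_int : ∀ {r n : ℕ} {X : Fin 3 → Finset ℕ}, T3 n r X →
    (∀ (f : Fin 3 → Filt n (Fin r → ℂ)) (g : Fin 3 → Filt n (Fin (n - r) → ℂ)),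
      Generic (fun m => cnt (X m)) (fun m t => min t n - cnt (X m) t) f g →
      ∀ S : Submodule ℂ (Fin r → ℂ), 0 ≤ chiF (fun m => (f m).sub S) g) ∧
    Int (fun _ t => min t n) (fun m => cnt (X m)) r n := by
  intro r
  induction r using Nat.strong_induction_on with
  | _ r ih =>
  intro n X hT
  have hN : ∀ m, IsType n r (cnt (X m)) := fun m => isType_cnt (hT.1 m) (hT.card m)
  have hM : ∀ m, IsType n (n - r) (fun t => min t n - cnt (X m) t) := fun m =>
    isType_sub_cnt (hT.1 m) (hT.card m)
  have hrn := hT.le_self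
  have key : ∀ (f : Fin 3 → Filt n (Fin r → ℂ)) (g : Fin 3 → Filt n (Fin (n - r) → ℂ)),
      Generic (fun m => cnt (X m)) (fun m t => min t n - cnt (X m) t) f g →
      ∀ S : Submodule ℂ (Fin r → ℂ), 0 ≤ chiF (fun m => (f m).sub S) g := by
    intro f g h S₀
    by_contra! h₀
    obtain ⟨S, hneg, hsurj, hzero⟩ := h.movable.exists_destabilizing S₀ h₀
    refine hneg.not_ge ?_
    have hdim : ∀ m t, cnt (X m) t =
        ((f m).sub S).dim t + ((f m).map S.mkQ S.mkQ_surjective).dim t := fun m t => by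
      rw [← h.dim_left hN m, (f m).dim_eq_add S.mkQ S.mkQ_surjective t, Submodule.ker_mkQ]
    choose Y hYX hY using fun m => exists_eq_cnt (hT.1 m) _ _ (((f m).sub S).dim_mono)
      (((f m).map S.mkQ S.mkQ_surjective).dim_mono) (hdim m)
    have hYn : ∀ m, Y m ⊆ Finset.Icc 1 n := fun m => (hYX m).trans (hT.1 m)
    have hs : ∀ m, (Y m).card = finrank ℂ S := fun m => by
      rw [← cnt_of_le (hYn m) le_rfl, hY, Filt.dim_top]
    set s := finrank ℂ S with hsdef
    have hsr : s ≤ r := by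
      rw [← hs 0, ← hT.card 0]; exact Finset.card_le_card (hYX 0)
    have hT' : T3 r s fun m => (Y m).image (cnt (X m)) :=
      T3.of_surj hsurj hzero hT.1 hT.card hYX hs (fun m t => (hY m t).symm)
        (fun m t => by rw [hdim, hY]) fun d C hd hC => (ih d (hd.trans_le hsr) hC).2
    have hle : 4 * (s : ℤ) * (n + 1) - s * (s + 1) ≤ 2 * ∑ m, ∑ y ∈ Y m, (y : ℤ) := by
      rcases Nat.eq_zero_or_pos s with h0 | hpos
      · have : 0 ≤ ∑ m, ∑ y ∈ Y m, (y : ℤ) := by positivity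
        simp only [h0]
        push_cast
        linarith
      rcases hsr.lt_or_eq with hlt | heq
      · have h1 := hT.le hpos hlt hT'
        simp only [fun m => sum_image_cnt (hYX m) fun c => (nthElt (X m) c : ℤ)] at h1
        refine h1.trans_eq ?_
        congr 1
        refine Finset.sum_congr rfl fun m _ => Finset.sum_congr rfl fun y hy => ?_
        rw [nthElt_eq (hYX m hy)]
      · have : ∀ m, Y m = X m := fun m =>
          Finset.eq_of_subset_of_card_le (hYX m) (by rw [hs, hT.card, heq])
        simp only [this]
        rw [hT.sum, heq]
    have hsum := hT'.sum
    simp only [fun m => sum_image_cnt (hYX m) fun x => (x : ℤ)] at hsum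
    rw [chiF_of_cnt g hYn fun m t => (hY m t).symm, ← hsdef, finrank_fin_fun]
    have h5 : ∑ m, ∑ y ∈ Y m, ((g m).dim y : ℤ) =
        ∑ m, ∑ y ∈ Y m, (y : ℤ) - ∑ m, ∑ y ∈ Y m, (cnt (X m) y : ℤ) := by
      rw [← Finset.sum_sub_distrib]
      refine Finset.sum_congr rfl fun m _ => ?_
      rw [← Finset.sum_sub_distrib]
      refine Finset.sum_congr rfl fun y hy => ?_
      have h6 := cnt_le_self (hT.1 m) y
      have h7 := Finset.mem_Icc.1 (hYn m hy)
      rw [h.dim_right hM m]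
      simp only
      omega
    rw [h5, Nat.cast_sub hrn]
    linarith
  refine ⟨key, ?_⟩
  obtain ⟨f, g, h⟩ := exists_generic hN hM
  have h_int := int_of_surj (h.surj_of_nonneg (key f g h))
  have e1 : finrank ℂ (Fin r → ℂ) = r := finrank_fin_fun ℂ
  have e2 : finrank ℂ (Fin (n - r) → ℂ) = n - r := finrank_fin_fun ℂ
  rw [e1, e2, show r + (n - r) = n by omega] at h_int
  convert h_int using 3 with m t m
  · rw [h.dim_left hN, h.dim_right hM]
    have := cnt_le_self (hT.1 m) t
    simp only
    omega
  · rw [h.dim_left hN]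

section Regrade

/-- Exchange of the first two arms. -/
abbrev arm : Equiv.Perm (Fin 3) := Equiv.swap 0 1

theorem arm_arm (m : Fin 3) : arm (arm m) = m := by
  revert m; decide

theorem sum_eul_sub_sum_eul_arm (T : ℕ) (α μ : Fin 3 → ℕ → ℕ) :
    ∑ m, eul T (α m) (μ m) - ∑ m, eul T (α m) (μ (arm m)) =
      ∑ t ∈ Finset.range T, (((α 0 (t + 1) : ℤ) - α 1 (t + 1)) - (α 0 t - α 1 t)) *
        ((μ 0 (t + 1) : ℤ) - μ 1 (t + 1)) := by
  have h2 : arm 2 = 2 := by decide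
  simp only [Fin.sum_univ_three, arm, Equiv.swap_apply_left, Equiv.swap_apply_right, eul]
  rw [show (Equiv.swap (0 : Fin 3) 1) 2 = 2 from h2]
  simp only [← Finset.sum_add_distrib, ← Finset.sum_sub_distrib]
  refine Finset.sum_congr rfl fun t _ => ?_
  ring

/-- Jumps of the arms of the regraded full type. -/
def full (p : ℕ) : Fin 3 → ℕ → ℕ :=
  ![fun t => min (t / 2) p, fun t => min ((t + 1) / 2) p, fun t => min (t / 2) p]

theorem eul_arm_eq (p d : ℕ) (α ρ μ : Fin 3 → ℕ → ℕ) (hα : ∀ m, Monotone (α m))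
    (hρ : ∀ m, Monotone (ρ m)) (hμ : ∀ m, Monotone (μ m))
    (h : ∀ m t, α m t + ρ m t + μ m t = full p m t)
    (hd : ∀ m, α m (2 * p) = d) :
    ∑ m, eul (2 * p) (α m) (μ (arm m)) = ∑ m, eul (2 * p) (α m) (μ m) +
      ∑ m, eul (2 * p) (α m) (ρ m) - ∑ m, eul (2 * p) (α m) (ρ (arm m)) := by
  have h1 := sum_eul_sub_sum_eul_arm (2 * p) α μ
  have h2 := sum_eul_sub_sum_eul_arm (2 * p) α ρ
  suffices h3 : ∑ t ∈ Finset.range (2 * p), (((α 0 (t + 1) : ℤ) - α 1 (t + 1)) - (α 0 t - α 1 t)) *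
        ((μ 0 (t + 1) : ℤ) - μ 1 (t + 1)) + ∑ t ∈ Finset.range (2 * p),
        (((α 0 (t + 1) : ℤ) - α 1 (t + 1)) - (α 0 t - α 1 t)) *
        ((ρ 0 (t + 1) : ℤ) - ρ 1 (t + 1)) = 0 by linarith
  rw [← Finset.sum_add_distrib]
  have h0 : ∀ t, α 0 t + ρ 0 t + μ 0 t = min (t / 2) p := h 0
  have h1 : ∀ t, α 1 t + ρ 1 t + μ 1 t = min ((t + 1) / 2) p := h 1
  have key : ∀ t ∈ Finset.range (2 * p),
      2 * ((((α 0 (t + 1) : ℤ) - α 1 (t + 1)) - (α 0 t - α 1 t)) *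
        ((μ 0 (t + 1) : ℤ) - μ 1 (t + 1)) + (((α 0 (t + 1) : ℤ) - α 1 (t + 1)) -
        (α 0 t - α 1 t)) * ((ρ 0 (t + 1) : ℤ) - ρ 1 (t + 1))) =
      ((α 1 (t + 1) : ℤ) - α 0 (t + 1) - ((α 0 (t + 1) : ℤ) - α 1 (t + 1)) ^ 2) -
       ((α 1 t : ℤ) - α 0 t - ((α 0 t : ℤ) - α 1 t) ^ 2) := by
    intro t ht
    have ht := Finset.mem_range.1 ht
    have a0 := hα 0 (Nat.le_succ t)
    have a1 := hα 1 (Nat.le_succ t)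
    have b0 := hρ 0 (Nat.le_succ t)
    have b1 := hρ 1 (Nat.le_succ t)
    have c0 := hμ 0 (Nat.le_succ t)
    have c1 := hμ 1 (Nat.le_succ t)
    have e0 := h0 t
    have e0' := h0 (t + 1)
    have e1 := h1 t
    have e1' := h1 (t + 1)
    simp only [Nat.succ_eq_add_one] at a0 a1 b0 b1 c0 c1
    rcases Nat.even_or_odd' t with ⟨k, rfl | rfl⟩
    · have f0 : α 0 (2 * k + 1) = α 0 (2 * k) := by omega
      have f1 : α 1 (2 * k + 1) = α 1 (2 * k) ∨ α 1 (2 * k + 1) = α 1 (2 * k) + 1 := by omega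
      have f2 : (μ 0 (2 * k + 1) : ℤ) - μ 1 (2 * k + 1) + (ρ 0 (2 * k + 1) - ρ 1 (2 * k + 1)) =
        -1 - (α 0 (2 * k + 1) - α 1 (2 * k + 1)) := by omega
      rw [← mul_add, f2, f0]
      rcases f1 with f1 | f1 <;> rw [f1] <;> push_cast <;> ring
    · have f1 : α 1 (2 * k + 1 + 1) = α 1 (2 * k + 1) := by omega
      have f0 : α 0 (2 * k + 1 + 1) = α 0 (2 * k + 1) ∨
        α 0 (2 * k + 1 + 1) = α 0 (2 * k + 1) + 1 := by omega
      have f2 : (μ 0 (2 * k + 1 + 1) : ℤ) - μ 1 (2 * k + 1 + 1) +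
          (ρ 0 (2 * k + 1 + 1) - ρ 1 (2 * k + 1 + 1)) =
        - (α 0 (2 * k + 1 + 1) - α 1 (2 * k + 1 + 1)) := by omega
      rw [← mul_add, f2, f1]
      rcases f0 with f0 | f0 <;> rw [f0] <;> push_cast <;> ring
  have hs := Finset.sum_congr rfl key
  rw [← Finset.mul_sum, Finset.sum_range_sub (fun t =>
    ((α 1 t : ℤ) - α 0 t - ((α 0 t : ℤ) - α 1 t) ^ 2)), hd, hd] at hs
  have z0 : α 0 0 = 0 := by have := h0 0; omega
  have z1 : α 1 0 = 0 := by have := h1 0; omega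
  rw [z0, z1] at hs
  push_cast at hs
  linarith

variable {T : ℕ} {V Q : Type} [AddCommGroup V] [Module ℂ V] [AddCommGroup Q] [Module ℂ Q]

theorem Surj.perm {f : Fin 3 → Filt T V} {g : Fin 3 → Filt T Q} (h : Surj f g)
    (σ : Equiv.Perm (Fin 3)) : Surj (fun m => f (σ m)) (fun m => g (σ m)) := by
  intro x
  obtain ⟨y, hy⟩ := h fun m => x (σ.symm m)
  refine ⟨y, fun m => ?_⟩
  have := hy (σ m)
  rwa [Equiv.symm_apply_apply] at this

theorem Generic.surj_arm {p r q : ℕ} {N M : Fin 3 → ℕ → ℕ}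
    {f : Fin 3 → Filt (2 * p) (Fin r → ℂ)} {g : Fin 3 → Filt (2 * p) (Fin q → ℂ)}
    (h : Generic N M f g) (hN : ∀ m, (f m).dim = N m) (hM : ∀ m, (g m).dim = M m)
    (hfull : ∀ m t, N m t + M m t = full p m t)
    (hpos : ∀ S : Submodule ℂ (Fin r → ℂ), 0 ≤ chiF (fun m => (f m).sub S) g) :
    Surj f (fun m => g (arm m)) := by
  obtain ⟨φ, hφ, hle⟩ := (h.perm arm).movable.exists_decomposition
  rw [surj_iff]
  refine hle.trans ?_
  have hπ : Function.Surjective φ.rangeRestrict := φ.surjective_rangeRestrict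
  have hdim : ∀ m t, (f m).dim t =
      ((f m).sub (LinearMap.ker φ)).dim t + (onRange f φ m).dim t := fun m t => by
    rw [(f m).dim_eq_add φ.rangeRestrict hπ t, LinearMap.ker_rangeRestrict]
    rfl
  have hadd : chiF f (fun m => g (arm m)) =
      chiF (fun m => (f m).sub (LinearMap.ker φ)) (fun m => g (arm m)) +
      chiF (onRange f φ) (fun m => g (arm m)) := by
    rw [chiF_eq_add_ker f _ φ.rangeRestrict hπ, LinearMap.ker_rangeRestrict]
    rfl
  rw [hadd]
  refine add_le_add_left ?_ _
  obtain ⟨a, ha, hsurj⟩ := h.exists_surj hpos (LinearMap.ker φ)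
  have h1 : chiF (fun m => (f m).sub (LinearMap.ker φ)) (fun m => onRange f φ (arm m)) ≤
      chiF (fun m => (f m).sub (LinearMap.ker φ)) g := by
    rw [← chiF_congr a _ _ _ ha fun _ => rfl, ← chiF_congr a _ g _ ha fun _ => rfl,
      ← hsurj.finrank_eq]
    refine (chiF_le _ _).trans ?_
    refine Nat.cast_le.2 (finrank_Hom3_le _ _ _ (LinearMap.range φ).subtype
      (Submodule.injective_subtype _) fun m t x hx => ?_)
    obtain ⟨y, hy, hyx⟩ := mem_onRange.1 hx
    have := mem_Hom3.1 hφ (arm m) t y hy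
    rwa [arm_arm, hyx] at this
  have h2 := eul_arm_eq p (finrank ℂ (LinearMap.ker φ))
    (fun m => ((f m).sub (LinearMap.ker φ)).dim) (fun m => (onRange f φ m).dim)
    (fun m => (g m).dim) (fun m => Filt.dim_mono _) (fun m => Filt.dim_mono _)
    (fun m => Filt.dim_mono _) (fun m t => by rw [← hdim, hN, hM, hfull])
    (fun m => Filt.dim_top _)
  simp only [chiF, chi] at h1 ⊢
  linarith

/-- Change of the time parameter of a filtration. -/
def Filt.regrade {n T : ℕ} (f : Filt n V) (w : ℕ → ℕ) (hw : Monotone w) (h0 : w 0 = 0)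
    (hT : w T = n) : Filt T V where
  F t := f.F (w t)
  mono := f.mono.comp hw
  zero := by rw [h0, f.zero]
  top := by rw [hT, f.top]

theorem Filt.Hom_regrade {n T : ℕ} (f : Filt n V) (g : Filt n Q) (w : ℕ → ℕ) (hw : Monotone w)
    (h0 : w 0 = 0) (hT : w T = n) (hs : Function.Surjective w) :
    (f.regrade w hw h0 hT).Hom (g.regrade w hw h0 hT) = f.Hom g := by
  ext φ
  exact ⟨fun h t x hx => by
    obtain ⟨u, rfl⟩ := hs t
    exact h u x hx, fun h t x hx => h (w t) x hx⟩

/-- Direct sum of filtrations. -/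
def Filt.prod (f : Filt T V) (g : Filt T Q) : Filt T (V × Q) where
  F t := (f.F t).prod (g.F t)
  mono _ _ h := Submodule.prod_mono (f.mono h) (g.mono h)
  zero := by rw [f.zero, g.zero, Submodule.prod_bot]
  top := by rw [f.top, g.top, Submodule.prod_top]

theorem Filt.dim_prod [FiniteDimensional ℂ V] [FiniteDimensional ℂ Q] (f : Filt T V)
    (g : Filt T Q) (t : ℕ) : (f.prod g).dim t = f.dim t + g.dim t :=
  finrank_submodule_prod _ _

theorem Surj.prod {V' Q' : Type} [AddCommGroup V'] [Module ℂ V'] [AddCommGroup Q'] [Module ℂ Q']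
    {f : Fin 3 → Filt T V} {f' : Fin 3 → Filt T V'} {g : Fin 3 → Filt T Q}
    {g' : Fin 3 → Filt T Q'} (h : Surj f g) (h1 : Surj f g') (h2 : Surj f' g)
    (h3 : Surj f' g') :
    Surj (fun m => (f m).prod (f' m)) (fun m => (g m).prod (g' m)) := by
  intro x
  obtain ⟨a, ha⟩ := h fun m => LinearMap.fst ℂ Q Q' ∘ₗ x m ∘ₗ LinearMap.inl ℂ V V'
  obtain ⟨b, hb⟩ := h1 fun m => LinearMap.snd ℂ Q Q' ∘ₗ x m ∘ₗ LinearMap.inl ℂ V V'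
  obtain ⟨c, hc⟩ := h2 fun m => LinearMap.fst ℂ Q Q' ∘ₗ x m ∘ₗ LinearMap.inr ℂ V V'
  obtain ⟨d, hd⟩ := h3 fun m => LinearMap.snd ℂ Q Q' ∘ₗ x m ∘ₗ LinearMap.inr ℂ V V'
  refine ⟨(a.prod b).coprod (c.prod d), fun m t v hv => ?_⟩
  have hx : x m v = x m (v.1, 0) + x m (0, v.2) := by
    rw [← map_add]; simp
  refine ⟨?_, ?_⟩
  · have := add_mem (ha m t v.1 hv.1) (hc m t v.2 hv.2)
    change _ ∈ (g m).F t
    convert this using 1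
    simp only [LinearMap.sub_apply, LinearMap.coprod_apply, hx, Prod.fst_sub, Prod.fst_add,
      LinearMap.prod_apply, LinearMap.comp_apply, LinearMap.inl_apply, LinearMap.inr_apply,
      LinearMap.fst_apply, Function.prod_apply]
    abel
  · have := add_mem (hb m t v.1 hv.1) (hd m t v.2 hv.2)
    change _ ∈ (g' m).F t
    convert this using 1
    simp only [LinearMap.sub_apply, LinearMap.coprod_apply, hx, Prod.snd_sub, Prod.snd_add,
      LinearMap.prod_apply, LinearMap.comp_apply, LinearMap.inl_apply, LinearMap.inr_apply,
      LinearMap.snd_apply, Function.prod_apply]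
    abel

/-- Time changes used to interleave the first two arms. -/
def rate : Fin 3 → ℕ → ℕ := ![fun t => t / 2, fun t => (t + 1) / 2, fun t => t / 2]

theorem rate_two_mul (m : Fin 3) (t : ℕ) : rate m (2 * t) = t := by
  fin_cases m <;> simp only [rate] <;> simp; omega

theorem rate_mono (m : Fin 3) : Monotone (rate m) := by
  intro a b h
  fin_cases m <;> simp only [rate] <;> simp <;> omega

theorem min_rate (p : ℕ) (m : Fin 3) (t : ℕ) : min (rate m t) p = full p m t := by
  fin_cases m <;> rfl

theorem T3.int_double {p r : ℕ} {X : Fin 3 → Finset ℕ} (h : T3 p r X) :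
    Int (fun m t => full p m t + full p (arm m) t)
      (fun m t => cnt (X m) (rate m t) + cnt (X (arm m)) (rate (arm m) t)) (r + r) (2 * p) := by
  have hN : ∀ m, IsType p r (cnt (X m)) := fun m => isType_cnt (h.1 m) (h.card m)
  have hM : ∀ m, IsType p (p - r) (fun t => min t p - cnt (X m) t) := fun m =>
    isType_sub_cnt (h.1 m) (h.card m)
  obtain ⟨f, g, hfg⟩ := exists_generic hN hM
  have hpos := h.nonneg_and_int.1 f g hfg
  have hsurj := hfg.surj_of_nonneg hpos
  let f' : Fin 3 → Filt (2 * p) (Fin r → ℂ) := fun m =>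
    (f m).regrade (rate m) (rate_mono m) (rate_two_mul m 0) (rate_two_mul m p)
  let g' : Fin 3 → Filt (2 * p) (Fin (p - r) → ℂ) := fun m =>
    (g m).regrade (rate m) (rate_mono m) (rate_two_mul m 0) (rate_two_mul m p)
  have hsr : ∀ m, Function.Surjective (rate m) := fun m t => ⟨2 * t, rate_two_mul m t⟩
  have hfg' : Generic (fun m t => cnt (X m) (rate m t))
      (fun m t => min (rate m t) p - cnt (X m) (rate m t)) f' g' := by
    obtain ⟨a, b, hab, hf, hg⟩ := hfg
    exact ⟨a, b, hab, fun m t => hf m (rate m t), fun m t => hg m (rate m t)⟩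
  have hN' : ∀ m, (f' m).dim = fun t => cnt (X m) (rate m t) := fun m => by
    ext t
    exact congrFun (hfg.dim_left hN m) (rate m t)
  have hM' : ∀ m, (g' m).dim = fun t => min (rate m t) p - cnt (X m) (rate m t) := fun m => by
    ext t
    exact congrFun (hfg.dim_right hM m) (rate m t)
  have hfull : ∀ m t, cnt (X m) (rate m t) + (min (rate m t) p - cnt (X m) (rate m t)) =
      full p m t := fun m t => by
    rw [← min_rate]
    have := cnt_le_self (h.1 m) (rate m t)
    omega
  have hsurj' : Surj f' g' := by
    unfold Surj
    have : (fun m => (f' m).Hom (g' m)) = fun m => (f m).Hom (g m) :=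
      funext fun m => Filt.Hom_regrade _ _ _ _ _ _ (hsr m)
    rw [this]
    exact hsurj
  have hpos' : ∀ S : Submodule ℂ (Fin r → ℂ), 0 ≤ chiF (fun m => (f' m).sub S) g' := by
    intro S
    have hS := hpos S
    rw [chiF_eq] at hS ⊢
    have e : ∀ m, ((f' m).sub S).Hom (g' m) = ((f m).sub S).Hom (g m) := fun m =>
      Filt.Hom_regrade ((f m).sub S) (g m) (rate m) (rate_mono m) (rate_two_mul m 0)
      (rate_two_mul m p) (hsr m)
    refine hS.trans_eq ?_
    congr 1
    refine Finset.sum_congr rfl fun m _ => ?_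
    exact congrArg (fun X : Submodule ℂ _ => (finrank ℂ X : ℤ)) (e m).symm
  have h1 : Surj f' (fun m => g' (arm m)) := hfg'.surj_arm hN' hM' hfull hpos'
  have h2 : Surj (fun m => f' (arm m)) g' := by
    have := h1.perm arm
    simpa only [arm_arm] using this
  have h3 := hsurj'.perm arm
  have h_int := int_of_surj (hsurj'.prod h1 h2 h3)
  simp only [Filt.dim_prod, hN', hM', finrank_prod, finrank_fin_fun] at h_int
  have hrp := h.le_self
  rw [show r + r + (p - r + (p - r)) = 2 * p by omega] at h_int
  convert h_int using 3 with m t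
  · rw [← hfull m, ← hfull (arm m)]
    omega
  · rw [Filt.dim_prod, hN', hN']

end Regrade

theorem exists_perm_of_prod_eq {n : ℕ} {a s : Fin n → ℝ}
    (h : ∏ i, (Polynomial.X - Polynomial.C (a i)) = ∏ i, (Polynomial.X - Polynomial.C (s i))) :
    ∃ e : Fin n ≃ Fin n, ∀ i, a (e i) = s i := by
  have hroots : ∀ b : Fin n → ℝ, (∏ i, (Polynomial.X - Polynomial.C (b i))).roots =
      Multiset.map b Finset.univ.val := by
    intro b
    rw [Polynomial.roots_prod]
    · simp
    · simp [Finset.prod_ne_zero_iff, Polynomial.X_sub_C_ne_zero]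
  have hm : Multiset.map a Finset.univ.val = Multiset.map s Finset.univ.val := by
    rw [← hroots, ← hroots, h]
  have hc : ∀ c, Fintype.card {i // s i = c} = Fintype.card {i // a i = c} := by
    intro c
    have h1 := congrArg (Multiset.count c) hm
    rw [Multiset.count_map, Multiset.count_map] at h1
    rw [Fintype.card_subtype, Fintype.card_subtype]
    simp only [eq_comm (a := c)] at h1
    exact h1.symm
  exact ⟨Equiv.ofFiberEquiv fun c => Fintype.equivOfCardEq (hc c),
    fun i => Equiv.ofFiberEquiv_map _ i⟩

theorem exists_eigenbasis {n : ℕ} {A : Matrix (Fin n) (Fin n) ℝ} (hA : A.IsSymm) {σ : ℕ → ℝ}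
    (h : A.charpoly = ∏ i ∈ Finset.Icc 1 n, (Polynomial.X - Polynomial.C (σ i))) :
    ∃ u : OrthonormalBasis (Fin n) ℂ (EuclideanSpace ℂ (Fin n)), ∀ i,
      Matrix.toEuclideanLin (A.map Complex.ofReal) (u i) = (σ (i + 1) : ℂ) • u i := by
  have hH : (A.map Complex.ofReal).IsHermitian := by
    ext i j
    simp [Matrix.conjTranspose_apply, hA.apply]
  have hp : (A.map Complex.ofReal).charpoly = A.charpoly.map Complex.ofRealHom :=
    A.charpoly_map Complex.ofRealHom
  have hq : ∏ i, (Polynomial.X - Polynomial.C (hH.eigenvalues i)) =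
      ∏ i : Fin n, (Polynomial.X - Polynomial.C (σ (i + 1))) := by
    apply Polynomial.map_injective Complex.ofRealHom Complex.ofReal_injective
    have h1 := hH.charpoly_eq
    rw [hp, h] at h1
    have h2 : ∏ i ∈ Finset.Icc 1 n, (Polynomial.X - Polynomial.C (σ i)) =
        ∏ i : Fin n, (Polynomial.X - Polynomial.C (σ (i + 1))) := by
      rw [Fin.prod_univ_eq_prod_range (fun i => Polynomial.X - Polynomial.C (σ (i + 1))) n,
        Finset.range_eq_Ico, Finset.prod_Ico_add' (fun i => Polynomial.X - Polynomial.C (σ i)) 0 n 1]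
      rfl
    rw [← h2, h1, Polynomial.map_prod]
    simp
  obtain ⟨e, he⟩ := exists_perm_of_prod_eq hq
  refine ⟨hH.eigenvectorBasis.reindex e.symm, fun i => ?_⟩
  rw [OrthonormalBasis.reindex_apply, Equiv.symm_symm, ← he i]
  ext j
  have := congrFun (hH.mulVec_eigenvectorBasis (e i)) j
  simpa [Matrix.toLpLin_apply] using this

section Weights

variable {n : ℕ} {E : Type} [NormedAddCommGroup E] [InnerProductSpace ℂ E] [FiniteDimensional ℂ E]
  (u : OrthonormalBasis (Fin n) ℂ E)

/-- The span of the first vectors of a basis. -/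
noncomputable def bflag (k : ℕ) : Submodule ℂ E := Submodule.span ℂ (u '' {i | (i : ℕ) < k})

omit [FiniteDimensional ℂ E] in
theorem bflag_mono : Monotone (bflag u) := fun _ _ h =>
  Submodule.span_mono (Set.image_mono fun _ hi => lt_of_lt_of_le hi h)

omit [FiniteDimensional ℂ E] in
theorem finrank_bflag (k : ℕ) : finrank ℂ (bflag u k) = min k n := by
  have hli : LinearIndependent ℂ fun i : {i : Fin n | (i : ℕ) < k} => u i :=
    u.orthonormal.linearIndependent.comp _ Subtype.val_injective
  have h := finrank_span_eq_card hli
  have hr : (Set.range fun i : {i : Fin n | (i : ℕ) < k} => u i) = u '' {i | (i : ℕ) < k} := by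
    ext x
    simp
  rw [hr] at h
  rw [bflag, h, ← Set.toFinset_card, min_comm, ← Fin.card_filter_val_lt]
  congr 1
  ext i
  simp

/-- Squared length of the projection of a basis vector. -/
noncomputable def wt (S : Submodule ℂ E) (i : Fin n) : ℝ := ‖S.starProjection (u i)‖ ^ 2

theorem wt_le_one (S : Submodule ℂ E) (i : Fin n) : wt u S i ≤ 1 := by
  have := S.norm_starProjection_apply_le (u i)
  rw [u.orthonormal.1 i] at this
  exact pow_le_one₀ (norm_nonneg _) this

theorem trace_comp_eq (S : Submodule ℂ E) (L : E →ₗ[ℂ] E) {τ : Fin n → ℝ}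
    (hL : ∀ i, L (u i) = (τ i : ℂ) • u i) :
    (LinearMap.trace ℂ E ((S.starProjection : E →ₗ[ℂ] E) ∘ₗ L)).re = ∑ i, wt u S i * τ i := by
  rw [LinearMap.trace_eq_sum_inner _ u, Complex.re_sum]
  refine Finset.sum_congr rfl fun i _ => ?_
  rw [LinearMap.comp_apply, hL, map_smul, inner_smul_right, Complex.re_ofReal_mul, mul_comm]
  congr 1
  rw [← inner_conj_symm, Complex.conj_re]
  exact S.re_inner_starProjection_eq_normSq (u i)

theorem sum_wt (S : Submodule ℂ E) : ∑ i, wt u S i = finrank ℂ S := by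
  have h := trace_comp_eq u S LinearMap.id (τ := fun _ => 1) (fun i => by simp)
  simp only [mul_one, LinearMap.comp_id] at h
  rw [← h]
  have : LinearMap.IsProj S (S.starProjection : E →ₗ[ℂ] E) :=
    ⟨fun x => S.starProjection_apply_mem x, fun x hx => Submodule.starProjection_eq_self_iff.2 hx⟩
  rw [this.trace]
  simp

theorem finrank_inf_bflag_le (S : Submodule ℂ E) (k : ℕ) :
    (finrank ℂ ↥(S ⊓ bflag u k) : ℝ) ≤ ∑ i ∈ Finset.univ.filter (fun i : Fin n => (i : ℕ) < k), wt u S i := by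
  rw [← sum_wt u, Finset.sum_filter]
  refine Finset.sum_le_sum fun i _ => ?_
  split_ifs with hi
  · have h1 := Submodule.starProjection_comp_starProjection_of_le
      (inf_le_left : S ⊓ bflag u k ≤ S)
    have h2 : (S ⊓ bflag u k).starProjection (u i) =
        (S ⊓ bflag u k).starProjection (S.starProjection (u i)) := by
      conv_lhs => rw [← h1]
      rfl
    rw [wt, wt, h2]
    exact pow_le_pow_left₀ (norm_nonneg _) (Submodule.norm_starProjection_apply_le _ _) 2
  · have : (S ⊓ bflag u k).starProjection (u i) = 0 := by
      rw [Submodule.starProjection_apply_eq_zero_iff]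
      have h3 : bflag u k ≤ (Submodule.span ℂ {u i})ᗮ := by
        rw [bflag, Submodule.span_le]
        rintro _ ⟨j, hj, rfl⟩
        rw [SetLike.mem_coe, Submodule.mem_orthogonal_singleton_iff_inner_right]
        exact u.orthonormal.2 fun h => hi (h ▸ hj)
      rw [Submodule.mem_orthogonal]
      intro y hy
      have := h3 hy.2
      rwa [Submodule.mem_orthogonal_singleton_iff_inner_left] at this
    rw [wt, this]
    simp

end Weights

theorem abel_ge {n : ℕ} {D w τ : ℕ → ℝ} (hτ : AntitoneOn τ (Set.Icc 1 n)) (h0 : D 0 = 0)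
    (hn : D n = ∑ t ∈ Finset.range n, w t) (hD : ∀ k ≤ n, D k ≤ ∑ t ∈ Finset.range k, w t) :
    ∑ t ∈ Finset.range n, (D (t + 1) - D t) * τ (t + 1) ≤
      ∑ t ∈ Finset.range n, w t * τ (t + 1) := by
  have key : ∀ k, k + 1 ≤ n → (∑ t ∈ Finset.range (k + 1), w t - D (k + 1)) * τ (k + 1) ≤
      ∑ t ∈ Finset.range (k + 1), (w t - (D (t + 1) - D t)) * τ (t + 1) := by
    intro k
    induction k with
    | zero => intro _; simp [h0]
    | succ k ih =>
      intro hk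
      have h1 := ih (by omega)
      rw [Finset.sum_range_succ _ (k + 1), Finset.sum_range_succ _ (k + 1)]
      have h2 : τ (k + 1 + 1) ≤ τ (k + 1) :=
        hτ ⟨by omega, by omega⟩ ⟨by omega, by omega⟩ (by omega)
      have h3 := hD (k + 1) (by omega)
      nlinarith [mul_le_mul_of_nonneg_left h2 (sub_nonneg.2 h3)]
  rcases n with _ | n
  · simp
  · have h := key n le_rfl
    rw [← hn, sub_self, zero_mul] at h
    simp only [sub_mul (w _), Finset.sum_sub_distrib] at h
    linarith

theorem sum_cnt_sub {X : Finset ℕ} {p : ℕ} (hX : X ⊆ Finset.Icc 1 p) (f : ℕ → ℝ) :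
    ∑ t ∈ Finset.range p, ((cnt X (t + 1) : ℝ) - cnt X t) * f (t + 1) = ∑ x ∈ X, f x := by
  have h1 : ∀ t, ((cnt X (t + 1) : ℝ) - cnt X t) * f (t + 1) = if t + 1 ∈ X then f (t + 1) else 0 := by
    intro t
    rw [cnt_succ]
    split_ifs <;> simp
  simp only [h1]
  rw [Finset.range_eq_Ico, Finset.sum_Ico_add' (fun t => if t ∈ X then f t else 0) 0 p 1,
    ← Finset.sum_filter]
  refine Finset.sum_congr ?_ fun _ _ => rfl
  ext x
  rw [Finset.mem_filter, Finset.mem_Ico]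
  refine ⟨fun h => h.2, fun h => ⟨?_, h⟩⟩
  have := Finset.mem_Icc.1 (hX h)
  omega

theorem sum_range_two_mul (p : ℕ) (f : ℕ → ℝ) :
    ∑ t ∈ Finset.range (2 * p), f t = ∑ t ∈ Finset.range p, (f (2 * t) + f (2 * t + 1)) := by
  induction p with
  | zero => simp
  | succ p ih =>
    rw [show 2 * (p + 1) = 2 * p + 1 + 1 by ring, Finset.sum_range_succ, Finset.sum_range_succ, ih,
      Finset.sum_range_succ]
    ring

/-- Summation against the interleaving of two counting functions. -/
theorem sum_interleave {X Y : Finset ℕ} {p : ℕ} (hX : X ⊆ Finset.Icc 1 p)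
    (hY : Y ⊆ Finset.Icc 1 p) {D : ℕ → ℝ}
    (hD : ∀ t, D t = cnt X (t / 2) + cnt Y ((t + 1) / 2)) (τ : ℕ → ℝ) :
    ∑ t ∈ Finset.range (2 * p), (D (t + 1) - D t) * τ (t + 1) =
      ∑ x ∈ X, τ (2 * x) + ∑ y ∈ Y, τ (2 * y - 1) := by
  rw [sum_range_two_mul, ← sum_cnt_sub hX (fun x => τ (2 * x)),
    ← sum_cnt_sub hY (fun y => τ (2 * y - 1)), ← Finset.sum_add_distrib]
  refine Finset.sum_congr rfl fun t _ => ?_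
  simp only [hD]
  rw [show (2 * t + 1) / 2 = t by omega, show (2 * t + 1 + 1) / 2 = t + 1 by omega,
    show 2 * t / 2 = t by omega, show (2 * t + 1 + 1 + 1) / 2 = t + 1 by omega,
    show 2 * (t + 1) - 1 = 2 * t + 1 by omega, show 2 * t + 1 + 1 = 2 * (t + 1) by ring]
  ring

section Estimate

variable {n : ℕ} {E : Type} [NormedAddCommGroup E] [InnerProductSpace ℂ E] [FiniteDimensional ℂ E]
  (u : OrthonormalBasis (Fin n) ℂ E)

/-- Real trace of the compression of an operator to a subspace. -/
noncomputable def ctr (S : Submodule ℂ E) (L : E →ₗ[ℂ] E) : ℝ :=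
  (LinearMap.trace ℂ E ((S.starProjection : E →ₗ[ℂ] E) ∘ₗ L)).re

theorem ctr_add (S : Submodule ℂ E) (L M : E →ₗ[ℂ] E) : ctr S (L + M) = ctr S L + ctr S M := by
  rw [ctr, LinearMap.comp_add, map_add, Complex.add_re, ctr, ctr]

theorem ctr_neg (S : Submodule ℂ E) (L : E →ₗ[ℂ] E) : ctr S (-L) = -ctr S L := by
  rw [ctr, LinearMap.comp_neg, map_neg, Complex.neg_re, ctr]

theorem le_ctr (S : Submodule ℂ E) (L : E →ₗ[ℂ] E) {τ : ℕ → ℝ}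
    (hτ : AntitoneOn τ (Set.Icc 1 n)) (hL : ∀ i : Fin n, L (u i) = (τ (i + 1) : ℂ) • u i)
    {D : ℕ → ℕ} (h0 : D 0 = 0) (hn : D n = finrank ℂ S)
    (hD : ∀ k < n, D k ≤ finrank ℂ ↥(S ⊓ bflag u k) ∨
      D k + 1 ≤ finrank ℂ ↥(S ⊓ bflag u (k + 1))) :
    ∑ t ∈ Finset.range n, ((D (t + 1) : ℝ) - D t) * τ (t + 1) ≤ ctr S L := by
  obtain ⟨w, hw⟩ : ∃ w : ℕ → ℝ, ∀ i : Fin n, w i = wt u S i :=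
    ⟨fun t => if h : t < n then wt u S ⟨t, h⟩ else 0, fun i => by simp⟩
  have hsum : ∀ f : ℕ → ℝ, ∑ i : Fin n, wt u S i * f i = ∑ t ∈ Finset.range n, w t * f t := by
    intro f
    rw [← Fin.sum_univ_eq_sum_range (fun t => w t * f t) n]
    exact Finset.sum_congr rfl fun i _ => by rw [hw]
  have htot := hsum fun _ => 1
  simp only [mul_one, sum_wt] at htot
  have hpart : ∀ k ≤ n, (finrank ℂ ↥(S ⊓ bflag u k) : ℝ) ≤ ∑ t ∈ Finset.range k, w t := by
    intro k hk
    refine (finrank_inf_bflag_le u S k).trans_eq ?_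
    have h1 := hsum fun t => if t < k then 1 else 0
    simp only [mul_ite, mul_one, mul_zero] at h1
    rw [← Finset.sum_filter, ← Finset.sum_filter] at h1
    rw [h1]
    refine Finset.sum_congr ?_ fun _ _ => rfl
    ext t
    simp only [Finset.mem_filter, Finset.mem_range]
    omega
  rw [ctr, trace_comp_eq u S L (τ := fun i => τ (i + 1)) hL, hsum fun t => τ (t + 1)]
  refine abel_ge (D := fun t => (D t : ℝ)) hτ (by simp [h0]) (by rw [hn, htot]) fun k hk => ?_
  rcases hk.lt_or_eq with hk | rfl
  · rcases hD k hk with h | h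
    · exact (Nat.cast_le.2 h).trans (hpart k hk.le)
    · have h1 := hpart (k + 1) hk
      rw [Finset.sum_range_succ, show w k = wt u S ⟨k, hk⟩ from hw ⟨k, hk⟩] at h1
      have h2 := wt_le_one u S ⟨k, hk⟩
      have h3 : ((D k + 1 : ℕ) : ℝ) ≤ finrank ℂ ↥(S ⊓ bflag u (k + 1)) := Nat.cast_le.2 h
      push_cast at h3
      linarith
  · rw [hn, htot]

theorem ctr_le (S : Submodule ℂ E) (L : E →ₗ[ℂ] E) {τ : ℕ → ℝ}
    (hτ : AntitoneOn τ (Set.Icc 1 n)) (hL : ∀ i : Fin n, L (u i) = (τ (i + 1) : ℂ) • u i)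
    {D : ℕ → ℕ} (h0 : D 0 = 0) (hn : D n = finrank ℂ S)
    (hD : ∀ k < n, D k ≤ finrank ℂ ↥(S ⊓ bflag (u.reindex Fin.revPerm) k)) :
    ctr S L ≤ ∑ t ∈ Finset.range n, ((D (t + 1) : ℝ) - D t) * τ (n + 1 - (t + 1)) := by
  have h := le_ctr (u.reindex Fin.revPerm) S (-L) (τ := fun x => -τ (n + 1 - x)) (D := D)
    (fun x hx y hy hxy => neg_le_neg (hτ ⟨by have := hy.2; omega, by have := hy.1; omega⟩
      ⟨by have := hx.2; omega, by have := hx.1; omega⟩ (by omega)))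
    (fun i => by
      rw [OrthonormalBasis.reindex_apply, LinearMap.neg_apply, hL, ← neg_smul]
      congr 1
      push_cast
      congr 3
      simp only [Fin.revPerm_symm, Fin.revPerm_apply, Fin.val_rev]
      omega) h0 hn (fun k hk => Or.inl (hD k hk))
  rw [ctr_neg] at h
  simp only [mul_neg, Finset.sum_neg_distrib] at h
  linarith

end Estimate

theorem T3.horn_le {p r : ℕ} {X : Fin 3 → Finset ℕ} (h : T3 p r X) {E : Type}
    [NormedAddCommGroup E] [InnerProductSpace ℂ E] [FiniteDimensional ℂ E]
    {σ γ : ℕ → ℝ} (hσ : AntitoneOn σ (Set.Icc 1 (2 * p))) (hγ : AntitoneOn γ (Set.Icc 1 (2 * p)))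
    (LA LB : E →ₗ[ℂ] E) (uA uB uC : OrthonormalBasis (Fin (2 * p)) ℂ E)
    (hA : ∀ i, LA (uA i) = (σ (i + 1) : ℂ) • uA i) (hB : ∀ i, LB (uB i) = (σ (i + 1) : ℂ) • uB i)
    (hC : ∀ i, (LA + LB) (uC i) = (γ (i + 1) : ℂ) • uC i) :
    ∑ k ∈ X 2, (γ (2 * k) + γ (2 * k - 1)) ≤ 2 *
      (∑ x ∈ X 0, σ (2 * p + 1 - 2 * x) + ∑ x ∈ X 1, σ (2 * p + 1 - (2 * x - 1))) := by
  have hE : finrank ℂ E = 2 * p := by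
    rw [finrank_eq_card_basis uC.toBasis, Fintype.card_fin]
  obtain ⟨S, hS, hSF⟩ := h.int_double E hE
    ![bflag (uA.reindex Fin.revPerm), bflag (uB.reindex Fin.revPerm), bflag uC]
    (by
      intro m
      fin_cases m
      · exact bflag_mono _
      · exact bflag_mono _
      · exact bflag_mono _)
    (by
      intro m t
      fin_cases m
      · change min (t / 2) p + min ((t + 1) / 2) p ≤ finrank ℂ (bflag _ t)
        rw [finrank_bflag]
        omega
      · change min ((t + 1) / 2) p + min (t / 2) p ≤ finrank ℂ (bflag _ t)
        rw [finrank_bflag]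
        omega
      · change min (t / 2) p + min (t / 2) p ≤ finrank ℂ (bflag _ t)
        rw [finrank_bflag]
        omega)
  have hA' : ∀ t, cnt (X 0) (t / 2) + cnt (X 1) ((t + 1) / 2) ≤
      finrank ℂ ↥(S ⊓ bflag (uA.reindex Fin.revPerm) t) := hSF 0
  have hB' : ∀ t, cnt (X 1) ((t + 1) / 2) + cnt (X 0) (t / 2) ≤
      finrank ℂ ↥(S ⊓ bflag (uB.reindex Fin.revPerm) t) := hSF 1
  have hC' : ∀ t, cnt (X 2) (t / 2) + cnt (X 2) (t / 2) ≤
      finrank ℂ ↥(S ⊓ bflag uC t) := hSF 2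
  have hz : ∀ m m', cnt (X m) (0 / 2) + cnt (X m') ((0 + 1) / 2) = 0 := fun m m' => by
    change cnt (X m) 0 + cnt (X m') 0 = 0
    rw [cnt_zero (h.1 m), cnt_zero (h.1 m')]
  have hn : ∀ m m', cnt (X m) (2 * p / 2) + cnt (X m') ((2 * p + 1) / 2) = finrank ℂ S :=
    fun m m' => by
      rw [cnt_of_le (h.1 m) (by omega), cnt_of_le (h.1 m') (by omega), h.card, h.card, hS]
  have e : ∀ m m' (τ : ℕ → ℝ), _ := fun m m' τ => sum_interleave (h.1 m) (h.1 m')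
    (D := fun t => ((cnt (X m) (t / 2) + cnt (X m') ((t + 1) / 2) : ℕ) : ℝ))
    (fun t => by push_cast; rfl) τ
  have eA := ctr_le uA S LA hσ hA (D := fun t => cnt (X 0) (t / 2) + cnt (X 1) ((t + 1) / 2))
    (hz 0 1) (hn 0 1) fun t _ => hA' t
  have eB := ctr_le uB S LB hσ hB (D := fun t => cnt (X 0) (t / 2) + cnt (X 1) ((t + 1) / 2))
    (hz 0 1) (hn 0 1) fun t _ => (add_comm _ _).trans_le (hB' t)
  have eC := le_ctr uC S (LA + LB) hγ hC
    (D := fun t => cnt (X 2) (t / 2) + cnt (X 2) ((t + 1) / 2)) (hz 2 2) (hn 2 2) fun t _ => by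
      rcases Nat.even_or_odd' t with ⟨c, rfl | rfl⟩
      · left
        have := hC' (2 * c)
        rwa [show (2 * c + 1) / 2 = 2 * c / 2 by omega]
      · rw [show (2 * c + 1) / 2 = c by omega, show (2 * c + 1 + 1) / 2 = c + 1 by omega, cnt_succ]
        split_ifs with hc
        · right
          have := hC' (2 * c + 1 + 1)
          rw [show (2 * c + 1 + 1) / 2 = c + 1 by omega, cnt_succ, if_pos hc] at this
          omega
        · left
          have := hC' (2 * c + 1)
          rw [show (2 * c + 1) / 2 = c by omega] at this
          omega
  rw [e 0 1 fun x => σ (2 * p + 1 - x)] at eA eB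
  rw [e 2 2 γ, ctr_add] at eC
  rw [Finset.sum_add_distrib]
  linarith

theorem sum_flip_real {n : ℕ} {X : Finset ℕ} (hX : X ⊆ Finset.Icc 1 n) (f : ℕ → ℝ) :
    ∑ x ∈ flip n X, f x = ∑ x ∈ X, f (n + 1 - x) :=
  Finset.sum_image (flip_injOn hX)

end Horn

/-- Theorem 4 of the paper. Let `C = A + B` be a sum of two real
symmetric `2p × 2p` matrices each with ordered spectrum `σ₁ ≥ ⋯ ≥ σ_{2p}` (here
`σ i` denotes `σᵢ` for `1 ≤ i ≤ 2p`), let `γ̂₁ ≥ ⋯ ≥ γ̂_{2p}` be the ordered spectrum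
of `C`, and set `ν_k = (γ̂_{2k-1} + γ̂_{2k})/2`.  Then for every `r < p` and every
`(I, J, K) ∈ T^p_r` the Horn inequality
`∑_{k∈K} ν_k ≤ ∑_{i∈I} σ_{2i-1} + ∑_{j∈J} σ_{2j}` holds. -/
theorem horn_inequality_for_projected_spectrum
    (p : ℕ) (hp : 1 ≤ p)
    (σ : ℕ → ℝ) (hσ : AntitoneOn σ (Set.Icc 1 (2 * p)))
    (A B : Matrix (Fin (2 * p)) (Fin (2 * p)) ℝ) (hA : A.IsSymm) (hB : B.IsSymm)
    (hAspec : A.charpoly = ∏ i ∈ Finset.Icc 1 (2 * p), (Polynomial.X - Polynomial.C (σ i)))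
    (hBspec : B.charpoly = ∏ i ∈ Finset.Icc 1 (2 * p), (Polynomial.X - Polynomial.C (σ i)))
    (γ : ℕ → ℝ) (hγ : AntitoneOn γ (Set.Icc 1 (2 * p)))
    (hCspec : (A + B).charpoly =
      ∏ i ∈ Finset.Icc 1 (2 * p), (Polynomial.X - Polynomial.C (γ i)))
    (r : ℕ) (hr : 1 ≤ r) (hrp : r < p)
    (I J K : Finset ℕ) (hT : IsT p r I J K) :
    ∑ k ∈ K, (γ (2 * k - 1) + γ (2 * k)) / 2 ≤
      ∑ i ∈ I, σ (2 * i - 1) + ∑ j ∈ J, σ (2 * j) := by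
  have hU := hT
  rw [IsT] at hU
  obtain ⟨⟨hI, hJ, hK, -⟩, -⟩ := hU
  have h3 : Horn.T3 p r ![Horn.flip p I, Horn.flip p J, K] := by
    refine ⟨fun m => ?_, ?_⟩
    · fin_cases m
      · exact Horn.flip_subset hI
      · exact Horn.flip_subset hJ
      · exact hK
    · change IsT p r (Horn.flip p (Horn.flip p I)) (Horn.flip p (Horn.flip p J)) K
      rwa [Horn.flip_flip hI, Horn.flip_flip hJ]
  obtain ⟨uA, huA⟩ := Horn.exists_eigenbasis hA hAspec
  obtain ⟨uB, huB⟩ := Horn.exists_eigenbasis hB hBspec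
  obtain ⟨uC, huC⟩ := Horn.exists_eigenbasis (hA.add hB) hCspec
  have hadd : (A + B).map Complex.ofReal = A.map Complex.ofReal + B.map Complex.ofReal :=
    Matrix.map_add _ Complex.ofReal_add A B
  rw [hadd, map_add] at huC
  have h := h3.horn_le hσ hγ _ _ uA uB uC huA huB huC
  change ∑ k ∈ K, (γ (2 * k) + γ (2 * k - 1)) ≤ 2 *
    (∑ x ∈ Horn.flip p I, σ (2 * p + 1 - 2 * x) +
      ∑ x ∈ Horn.flip p J, σ (2 * p + 1 - (2 * x - 1))) at h
  rw [Horn.sum_flip_real hI, Horn.sum_flip_real hJ] at h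
  have hI' : ∑ x ∈ I, σ (2 * p + 1 - 2 * (p + 1 - x)) = ∑ i ∈ I, σ (2 * i - 1) :=
    Finset.sum_congr rfl fun x hx => by
      have := Finset.mem_Icc.1 (hI hx)
      congr 1
      omega
  have hJ' : ∑ x ∈ J, σ (2 * p + 1 - (2 * (p + 1 - x) - 1)) = ∑ j ∈ J, σ (2 * j) :=
    Finset.sum_congr rfl fun x hx => by
      have := Finset.mem_Icc.1 (hJ hx)
      congr 1
      omega
  rw [hI', hJ'] at h
  rw [← Finset.sum_div]
  simp only [add_comm (γ (2 * _ - 1))]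
  linarith
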